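/- Uniform-in-time decay of the rescaled solution: let m ∈ (m_s, 1), let u be a radial energy solution of the fast diffusion equation with exponent m and extinction time T > 0, and let w be its rescaled solution. Then there exists a constant C₁ > 0 (depending on u_0, m, N) such that w(r,τ) ≤ C₁ e^{−(N−1)r/(2m)} for all r ≥ 0 and all τ > 0. -/

import Mathlib

open MeasureTheory Set Filter Topology

/-- Membership in the radial energy space `H¹_rad` on hyperbolic space `ℍ^N`:
`v` is locally absolutely continuous on `(0,∞)` (expressed via the fundamental theorem
of calculus for its a.e. derivative) and both `v` and `v'` are square-integrable with
respect to the weight `(sinh s)^(N-1)`. -/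
def MemH1rad (N : ℕ) (v : ℝ → ℝ) : Prop :=
  (∀ a b : ℝ, 0 < a → a ≤ b → v b - v a = ∫ s in a..b, deriv v s) ∧
  MeasureTheory.IntegrableOn (fun s => (v s) ^ 2 * Real.sinh s ^ (N - 1)) (Set.Ioi 0) ∧
  MeasureTheory.IntegrableOn (fun s => (deriv v s) ^ 2 * Real.sinh s ^ (N - 1)) (Set.Ioi 0)

/-- The squared `H¹` norm `‖v‖_2² + ‖v'‖_2²` with weight `(sinh s)^(N-1)`. -/
noncomputable def H1normSq (N : ℕ) (v : ℝ → ℝ) : ℝ :=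
  (∫ s in Set.Ioi (0:ℝ), (v s) ^ 2 * Real.sinh s ^ (N - 1)) +
  (∫ s in Set.Ioi (0:ℝ), (deriv v s) ^ 2 * Real.sinh s ^ (N - 1))

/-- A radial energy solution of the fast diffusion equation `u_t = Δ(u^m)` on `ℍ^N`,
with exponent `m`, extinction time `T` (initial datum `u(·,0)`). -/
structure IsRadialEnergySolution (N : ℕ) (m T : ℝ) (u : ℝ → ℝ → ℝ) : Prop where
  continuousOn : ContinuousOn (fun p : ℝ × ℝ => u p.1 p.2) (Set.Ici 0 ×ˢ Set.Icc 0 T)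
  nonneg : ∀ r ∈ Set.Ici (0:ℝ), ∀ t ∈ Set.Icc (0:ℝ) T, 0 ≤ u r t
  smooth : ContDiffOn ℝ (⊤ : ℕ∞) (fun p : ℝ × ℝ => u p.1 p.2) (Set.Ici 0 ×ˢ Set.Ioo 0 T)
  pos : ∀ r ∈ Set.Ici (0:ℝ), ∀ t ∈ Set.Ioo (0:ℝ) T, 0 < u r t
  pde : ∀ r > (0:ℝ), ∀ t ∈ Set.Ioo (0:ℝ) T,
    deriv (fun τ => u r τ) t
      = deriv (deriv (fun ρ => u ρ t ^ m)) r
        + ((N : ℝ) - 1) * (Real.cosh r / Real.sinh r) * deriv (fun ρ => u ρ t ^ m) r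
  neumann : ∀ t ∈ Set.Ioo (0:ℝ) T, deriv (fun ρ => u ρ t ^ m) 0 = 0
  extinction : ∀ r ∈ Set.Ici (0:ℝ), u r T = 0
  energy : ∀ t ∈ Set.Ioo (0:ℝ) T, MemH1rad N (fun ρ => u ρ t ^ m)
  energy_bdd : ∀ ε ∈ Set.Ioo (0:ℝ) T, ∃ C : ℝ, ∀ t ∈ Set.Ico ε T,
    H1normSq N (fun ρ => u ρ t ^ m) ≤ C
  init_bdd : ∃ M : ℝ, ∀ r ∈ Set.Ici (0:ℝ), u r 0 ≤ M
  init_nonzero : ∃ r ∈ Set.Ici (0:ℝ), u r 0 ≠ 0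
  init_energy : MemH1rad N (fun ρ => u ρ 0 ^ m)

/-- The rescaled solution `w(r,τ) = e^{τ/((1-m)T)} u(r, T - T e^{-τ/T})`. -/
noncomputable def rescaled (m T : ℝ) (u : ℝ → ℝ → ℝ) (r τ : ℝ) : ℝ :=
  Real.exp (τ / ((1 - m) * T)) * u r (T - T * Real.exp (-τ / T))


structure Reg (N : ℕ) (m T : ℝ) (u ut vr vrr : ℝ → ℝ → ℝ) : Prop where
  hN : 2 ≤ N
  hm0 : 0 < m
  hm1 : m < 1
  hT : 0 < T
  cu : ContinuousOn (fun p : ℝ × ℝ => u p.1 p.2) (Ici 0 ×ˢ Icc 0 T)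
  nn : ∀ r, 0 ≤ r → ∀ t ∈ Icc (0:ℝ) T, 0 ≤ u r t
  pos : ∀ r, 0 ≤ r → ∀ t ∈ Ioo (0:ℝ) T, 0 < u r t
  cut : ContinuousOn (fun p : ℝ × ℝ => ut p.1 p.2) (Ici 0 ×ˢ Ioo 0 T)
  cvr : ContinuousOn (fun p : ℝ × ℝ => vr p.1 p.2) (Ici 0 ×ˢ Ioo 0 T)
  dut : ∀ r, 0 ≤ r → ∀ t ∈ Ioo (0:ℝ) T, HasDerivAt (fun τ => u r τ) (ut r t) t
  dvr : ∀ r, 0 < r → ∀ t ∈ Ioo (0:ℝ) T, HasDerivAt (fun ρ => u ρ t ^ m) (vr r t) r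
  dvrr : ∀ r, 0 < r → ∀ t ∈ Ioo (0:ℝ) T, HasDerivAt (fun ρ => vr ρ t) (vrr r t) r
  pde : ∀ r, 0 < r → ∀ t ∈ Ioo (0:ℝ) T,
    ut r t = vrr r t + ((N:ℝ) - 1) * (Real.cosh r / Real.sinh r) * vr r t
  vr0 : ∀ t ∈ Ioo (0:ℝ) T, vr 0 t = 0
  dv0 : ∀ t ∈ Ioo (0:ℝ) T, HasDerivWithinAt (fun ρ => u ρ t ^ m) 0 (Ici 0) 0
  ext : ∀ r, 0 ≤ r → u r T = 0

lemma m_pos {N : ℕ} (hN : 2 ≤ N) {m : ℝ}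
    (hm : m ∈ Set.Ioo (((N : ℝ) - 2) / ((N : ℝ) + 2)) 1) : 0 < m := by
  have h2 : (2:ℝ) ≤ N := by exact_mod_cast hN
  have : 0 ≤ ((N : ℝ) - 2) / ((N : ℝ) + 2) := by apply div_nonneg <;> linarith
  exact lt_of_le_of_lt this hm.1

lemma reg_of_sol (N : ℕ) (hN : 2 ≤ N) (m T : ℝ)
    (hm : m ∈ Set.Ioo (((N : ℝ) - 2) / ((N : ℝ) + 2)) 1) (hT : 0 < T)
    (u : ℝ → ℝ → ℝ) (hu : IsRadialEnergySolution N m T u) :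
    ∃ ut vr vrr, Reg N m T u ut vr vrr := by
  set s : Set (ℝ × ℝ) := Ici 0 ×ˢ Ioo 0 T with hs
  have hud : UniqueDiffOn ℝ s := (uniqueDiffOn_Ici 0).prod (uniqueDiffOn_Ioo 0 T)
  set f : ℝ × ℝ → ℝ := fun p => u p.1 p.2 with hf
  have hfs : ContDiffOn ℝ (⊤ : ℕ∞) f s := hu.smooth
  set g : ℝ × ℝ → ℝ := fun p => f p ^ m with hg
  have hfpos : ∀ p ∈ s, 0 < f p := fun p hp => hu.pos p.1 hp.1 p.2 hp.2
  have hgs : ContDiffOn ℝ (⊤ : ℕ∞) g s :=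
    hfs.rpow_const_of_ne (fun p hp => (hfpos p hp).ne')
  have hone : ((1:ℕ∞):WithTop ℕ∞) ≤ ((⊤:ℕ∞):WithTop ℕ∞) := by exact_mod_cast le_top
  have hplus : (((⊤:ℕ∞):WithTop ℕ∞) + 1) ≤ ((⊤:ℕ∞):WithTop ℕ∞) := by exact_mod_cast le_top
  set gr : ℝ × ℝ → ℝ := fun p => fderivWithin ℝ g s p (1, 0) with hgr
  have hgrs : ContDiffOn ℝ (⊤ : ℕ∞) gr s :=
    (hgs.fderivWithin hud hplus).clm_apply contDiffOn_const
  set grr : ℝ × ℝ → ℝ := fun p => fderivWithin ℝ gr s p (1, 0) with hgrr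
  have hgrrs : ContDiffOn ℝ (⊤ : ℕ∞) grr s :=
    (hgrs.fderivWithin hud hplus).clm_apply contDiffOn_const
  set ft : ℝ × ℝ → ℝ := fun p => fderivWithin ℝ f s p (0, 1) with hft
  have hfts : ContDiffOn ℝ (⊤ : ℕ∞) ft s :=
    (hfs.fderivWithin hud hplus).clm_apply contDiffOn_const
  have hdiff : ∀ F : ℝ × ℝ → ℝ, ContDiffOn ℝ (⊤ : ℕ∞) F s → ∀ p ∈ s,
      HasFDerivWithinAt F (fderivWithin ℝ F s p) s p := fun F hF p hp =>
    ((hF.differentiableOn (by simp)) p hp).hasFDerivWithinAt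
  -- partial derivative in r, within
  have hr : ∀ F : ℝ × ℝ → ℝ, ContDiffOn ℝ (⊤ : ℕ∞) F s → ∀ r, 0 ≤ r → ∀ t ∈ Ioo (0:ℝ) T,
      HasDerivWithinAt (fun ρ => F (ρ, t)) (fderivWithin ℝ F s (r, t) (1, 0)) (Ici 0) r := by
    intro F hF r hr t ht
    have h1 : HasDerivWithinAt (fun ρ : ℝ => (ρ, t)) ((1:ℝ), (0:ℝ)) (Ici 0) r :=
      (hasDerivWithinAt_id r _).prodMk (hasDerivWithinAt_const r _ t)
    have hM : MapsTo (fun ρ : ℝ => (ρ, t)) (Ici 0) s := fun ρ hρ => ⟨hρ, ht⟩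
    exact (hdiff F hF (r, t) ⟨hr, ht⟩).comp_hasDerivWithinAt r h1 hM
  have hr' : ∀ F : ℝ × ℝ → ℝ, ContDiffOn ℝ (⊤ : ℕ∞) F s → ∀ r, 0 < r → ∀ t ∈ Ioo (0:ℝ) T,
      HasDerivAt (fun ρ => F (ρ, t)) (fderivWithin ℝ F s (r, t) (1, 0)) r := fun F hF r h0 t ht =>
    (hr F hF r h0.le t ht).hasDerivAt (Ici_mem_nhds h0)
  have htd : ∀ r, 0 ≤ r → ∀ t ∈ Ioo (0:ℝ) T, HasDerivAt (fun τ => u r τ) (ft (r, t)) t := by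
    intro r hr t ht
    have h1 : HasDerivWithinAt (fun τ : ℝ => (r, τ)) ((0:ℝ), (1:ℝ)) (Ioo 0 T) t :=
      (hasDerivWithinAt_const t _ r).prodMk (hasDerivWithinAt_id t _)
    have hM : MapsTo (fun τ : ℝ => (r, τ)) (Ioo 0 T) s := fun ρ hρ => ⟨hr, hρ⟩
    exact ((hdiff f hfs (r, t) ⟨hr, ht⟩).comp_hasDerivWithinAt t h1 hM).hasDerivAt (Ioo_mem_nhds ht.1 ht.2)
  have hpde : ∀ r, 0 < r → ∀ t ∈ Ioo (0:ℝ) T,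
    ft (r, t) = grr (r, t) + ((N:ℝ) - 1) * (Real.cosh r / Real.sinh r) * gr (r, t) := by
    intro r h0 t ht
    have e1 := hu.pde r h0 t ht
    have e2 : deriv (fun ρ => u ρ t ^ m) =ᶠ[𝓝 r] fun ρ => gr (ρ, t) := by
      filter_upwards [Ioi_mem_nhds h0] with ρ hρ
      exact (hr' g hgs ρ hρ t ht).deriv
    rw [(htd r h0.le t ht).deriv, e2.deriv_eq, e2.eq_of_nhds,
      (hr' gr hgrs r h0 t ht).deriv] at e1
    exact e1
  have hgr0 : ∀ t ∈ Ioo (0:ℝ) T, gr (0, t) = 0 := by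
    intro t ht
    have key : ∀ F : ℝ × ℝ → ℝ, ContDiffOn ℝ (⊤ : ℕ∞) F s →
        Tendsto (fun r : ℝ => F (r, t)) (𝓝[>] 0) (𝓝 (F (0, t))) := by
      intro F hF
      have h1 := (hr F hF 0 le_rfl t ht).continuousWithinAt
      exact h1.tendsto.mono_left (nhdsWithin_mono _ Ioi_subset_Ici_self)
    have hs0 : Tendsto (fun r => Real.sinh r) (𝓝[>] 0) (𝓝 0) := by
      have := Real.continuous_sinh.tendsto 0
      rw [Real.sinh_zero] at this
      exact this.mono_left nhdsWithin_le_nhds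
    have hc0 : Tendsto (fun r => Real.cosh r) (𝓝[>] 0) (𝓝 1) := by
      have := Real.continuous_cosh.tendsto 0
      rw [Real.cosh_zero] at this
      exact this.mono_left nhdsWithin_le_nhds
    have l1 := hs0.mul ((key ft hfts).sub (key grr hgrrs))
    have l2 := (hc0.const_mul ((N:ℝ)-1)).mul (key gr hgrs)
    have l3 : (fun r => Real.sinh r * (ft (r, t) - grr (r, t))) =ᶠ[𝓝[>] 0]
        fun r => ((N:ℝ)-1) * Real.cosh r * gr (r, t) := by
      filter_upwards [self_mem_nhdsWithin] with r h0
      rw [hpde r h0 t ht]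
      have : Real.sinh r ≠ 0 := (Real.sinh_pos_iff.mpr h0).ne'
      field_simp
      ring
    have := tendsto_nhds_unique (l1.congr' l3) l2
    have h2 : (2:ℝ) ≤ N := by exact_mod_cast hN
    have h3 : ((N:ℝ)-1) * gr (0, t) = 0 := by linarith
    rcases mul_eq_zero.mp h3 with h | h
    · linarith
    · exact h
  refine ⟨fun r t => ft (r, t), fun r t => gr (r, t), fun r t => grr (r, t), ?_⟩
  refine ⟨hN, m_pos hN hm, hm.2, hT, hu.continuousOn, hu.nonneg, hu.pos, hfts.continuousOn,
    hgrs.continuousOn, htd, hr' g hgs, hr' gr hgrs, hpde, hgr0, ?_, hu.extinction⟩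
  intro t ht
  have := hr g hgs 0 le_rfl t ht
  rw [show fderivWithin ℝ g s (0, t) (1, 0) = 0 from hgr0 t ht] at this
  exact this


lemma second_max {f f' : ℝ → ℝ} {f'' x : ℝ} (h1 : ∀ᶠ y in 𝓝 x, HasDerivAt f (f' y) y)
    (h2 : HasDerivAt f' f'' x) (hmax : IsLocalMax f x) : f' x = 0 ∧ f'' ≤ 0 := by
  have hd := h1.self_of_nhds
  have h0 : f' x = 0 := hmax.hasDerivAt_eq_zero hd
  refine ⟨h0, ?_⟩
  by_contra hc
  push Not at hc
  have e : deriv f =ᶠ[𝓝 x] f' := h1.mono fun y hy => hy.deriv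
  have hmin : IsLocalMin f x := by
    apply isLocalMin_of_deriv_deriv_pos
    · rw [e.deriv_eq, h2.deriv]; exact hc
    · rw [hd.deriv, h0]
    · exact hd.continuousAt
  have hconst : f =ᶠ[𝓝 x] fun _ => f x := by
    filter_upwards [hmin, hmax] with y a b using le_antisymm b a
  have e2 : deriv f =ᶠ[𝓝 x] fun _ => 0 := by
    have := hconst.deriv
    simpa using this
  have e3 : deriv (deriv f) x = 0 := by rw [e2.deriv_eq]; simp
  rw [e.deriv_eq, h2.deriv] at e3
  linarith

lemma deriv_left_nonneg {f : ℝ → ℝ} {d x a : ℝ} (ha : a < x) (h : HasDerivAt f d x)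
    (hle : ∀ y ∈ Ioo a x, f y ≤ f x) : 0 ≤ d := by
  have h1 := (hasDerivAt_iff_tendsto_slope.mp h).mono_left
    (nhdsWithin_mono x (fun y (hy : y < x) => hy.ne) : 𝓝[<] x ≤ 𝓝[≠] x)
  refine ge_of_tendsto h1 ?_
  filter_upwards [Ioo_mem_nhdsLT ha] with y hy
  rw [slope_def_field]
  apply div_nonneg_of_nonpos <;> [linarith [hle y hy]; linarith [hy.2]]

lemma deriv_right_nonpos {f : ℝ → ℝ} {d x b : ℝ} (hb : x < b)
    (h : HasDerivWithinAt f d (Ici x) x)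
    (hle : ∀ y ∈ Ioo x b, f y ≤ f x) : d ≤ 0 := by
  have h1 := hasDerivWithinAt_iff_tendsto_slope.mp h
  have h2 : Ici x \ {x} = Ioi x := by ext y; simp [lt_iff_le_and_ne]
  rw [h2] at h1
  refine le_of_tendsto h1 ?_
  filter_upwards [Ioo_mem_nhdsGT hb] with y hy
  rw [slope_def_field]
  apply div_nonpos_of_nonpos_of_nonneg <;> [linarith [hle y hy]; linarith [hy.1]]

lemma compare {N : ℕ} {m T : ℝ} {u ut vr vrr : ℝ → ℝ → ℝ} (H : Reg N m T u ut vr vrr)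
    {R t0 t1 : ℝ} (ht0 : 0 ≤ t0) (ht1 : t1 < T)
    (S W Wr Wrr St : ℝ → ℝ → ℝ)
    (hSc : ContinuousOn (fun p : ℝ × ℝ => S p.1 p.2) (Icc 0 R ×ˢ Icc t0 t1))
    (hSW : ∀ r ∈ Icc 0 R, ∀ t ∈ Icc t0 t1, W r t = S r t ^ m)
    (hinit : ∀ r ∈ Icc 0 R, u r t0 < S r t0)
    (hbd : ∀ t ∈ Icc t0 t1, u R t < S R t)
    (hSt : ∀ r ∈ Ioo 0 R, ∀ t ∈ Ioc t0 t1, HasDerivAt (fun τ => S r τ) (St r t) t)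
    (hWr : ∀ r ∈ Ioo 0 R, ∀ t ∈ Ioc t0 t1, HasDerivAt (fun ρ => W ρ t) (Wr r t) r)
    (hWrr : ∀ r ∈ Ioo 0 R, ∀ t ∈ Ioc t0 t1, HasDerivAt (fun ρ => Wr ρ t) (Wrr r t) r)
    (hsup : ∀ r ∈ Ioo 0 R, ∀ t ∈ Ioc t0 t1,
      Wrr r t + ((N:ℝ) - 1) * (Real.cosh r / Real.sinh r) * Wr r t < St r t)
    (h0 : ∀ t ∈ Ioc t0 t1, ∃ d < 0, HasDerivWithinAt (fun ρ => W ρ t) d (Ici 0) 0) :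
    ∀ r ∈ Icc 0 R, ∀ t ∈ Icc t0 t1, u r t < S r t := by
  by_contra hcon
  push Not at hcon
  obtain ⟨ra, hra, ta, hta, hua⟩ := hcon
  have huc : ContinuousOn (fun p : ℝ × ℝ => u p.1 p.2) (Icc 0 R ×ˢ Icc t0 t1) :=
    H.cu.mono (prod_mono (fun r hr => hr.1)
      (fun t ht => ⟨ht0.trans ht.1, ht.2.trans ht1.le⟩))
  have hcomp : IsCompact (Icc 0 R ×ˢ Icc t0 t1) := isCompact_Icc.prod isCompact_Icc
  set K : Set (ℝ × ℝ) := {p ∈ Icc 0 R ×ˢ Icc t0 t1 | S p.1 p.2 ≤ u p.1 p.2} with hK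
  have hKc : IsClosed K := hcomp.isClosed.isClosed_le hSc huc
  have hKcomp : IsCompact K := hcomp.of_isClosed_subset hKc (fun p hp => hp.1)
  obtain ⟨⟨rs, ts⟩, hmem, hmin⟩ := hKcomp.exists_isMinOn ⟨(ra, ta), ⟨⟨hra, hta⟩, hua⟩⟩
    continuousOn_snd
  have hmin' : ∀ r ∈ Icc 0 R, ∀ t ∈ Icc t0 t1, t < ts → u r t < S r t := by
    intro r hr t ht hlt
    by_contra hc
    have : ts ≤ t := isMinOn_iff.mp hmin (r, t) ⟨⟨hr, ht⟩, not_lt.mp hc⟩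
    linarith
  have hrs : rs ∈ Icc 0 R := hmem.1.1
  have hts : ts ∈ Icc t0 t1 := hmem.1.2
  have hSu : S rs ts ≤ u rs ts := hmem.2
  have hts0 : t0 < ts := by
    rcases hts.1.eq_or_lt with h | h
    · subst h; exact absurd hSu (not_le.mpr (hinit rs hrs))
    · exact h
  have hrsR : rs < R := by
    rcases hrs.2.eq_or_lt with h | h
    · subst h; exact absurd hSu (not_le.mpr (hbd ts hts))
    · exact h
  have htsT : ts ∈ Ioo 0 T := ⟨by linarith, by linarith [hts.2]⟩
  have htsc : ts ∈ Ioc t0 t1 := ⟨hts0, hts.2⟩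
  have hle : ∀ r ∈ Icc 0 R, u r ts ≤ S r ts := by
    intro r hr
    have hcl : ∀ F : ℝ → ℝ → ℝ,
        ContinuousOn (fun p : ℝ × ℝ => F p.1 p.2) (Icc 0 R ×ˢ Icc t0 t1) →
        Tendsto (fun t => F r t) (𝓝[Ioo t0 ts] ts) (𝓝 (F r ts)) := by
      intro F hF
      have h1 : ContinuousWithinAt (fun t => F r t) (Icc t0 t1) ts :=
        (hF.comp (f := fun t : ℝ => (r, t)) (by fun_prop) (fun t ht => ⟨hr, ht⟩)) ts hts
      exact h1.tendsto.mono_left (nhdsWithin_mono _ (fun t ht => ⟨ht.1.le, by linarith [ht.2, hts.2]⟩))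
    have hne : (𝓝[Ioo t0 ts] ts).NeBot := right_nhdsWithin_Ioo_neBot hts0
    refine le_of_tendsto_of_tendsto (hcl u huc) (hcl S hSc) ?_
    filter_upwards [self_mem_nhdsWithin] with t ht
    exact (hmin' r hr t ⟨ht.1.le, by linarith [ht.2, hts.2]⟩ ht.2).le
  have heq : u rs ts = S rs ts := le_antisymm (hle rs hrs) hSu
  have hvW : ∀ r ∈ Icc 0 R, u r ts ^ m ≤ W r ts := by
    intro r hr
    rw [hSW r hr ts hts]
    exact Real.rpow_le_rpow (H.pos r hr.1 ts htsT).le (hle r hr) H.hm0.le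
  have hveq : u rs ts ^ m = W rs ts := by rw [hSW rs hrs ts hts, heq]
  rcases hrs.1.eq_or_lt with h | hpos
  · subst h
    obtain ⟨d, hd, hW⟩ := h0 ts htsc
    have := deriv_right_nonpos hrsR ((H.dv0 ts htsT).sub hW) (by
      intro y hy
      have := hvW y ⟨hy.1.le, hy.2.le⟩
      simp only [Pi.sub_apply]
      linarith)
    linarith
  · have hIoo : Ioo 0 R ∈ 𝓝 rs := Ioo_mem_nhds hpos hrsR
    obtain ⟨e1, e2⟩ := second_max (f := fun ρ => u ρ ts ^ m - W ρ ts)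
      (f' := fun ρ => vr ρ ts - Wr ρ ts) (f'' := vrr rs ts - Wrr rs ts) (x := rs)
      (by filter_upwards [hIoo] with y hy
          exact (H.dvr y hy.1 ts htsT).sub (hWr y hy ts htsc))
      ((H.dvrr rs hpos ts htsT).sub (hWrr rs ⟨hpos, hrsR⟩ ts htsc))
      (by filter_upwards [hIoo] with y hy
          have := hvW y ⟨hy.1.le, hy.2.le⟩
          linarith)
    have e3 := deriv_left_nonneg hts0
      ((H.dut rs hpos.le ts htsT).sub (hSt rs ⟨hpos, hrsR⟩ ts htsc)) (by
        intro y hy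
        have := hmin' rs hrs y ⟨hy.1.le, by linarith [hy.2, hts.2]⟩ hy.2
        simp only [Pi.sub_apply]
        linarith)
    have e4 := hsup rs ⟨hpos, hrsR⟩ ts htsc
    have e5 := H.pde rs hpos ts htsT
    have e6 : vr rs ts = Wr rs ts := by linarith
    rw [e6] at e5
    linarith


noncomputable def om (N : ℕ) (r : ℝ) : ℝ := Real.sinh r ^ (N - 1)

lemma om_pos (N : ℕ) {r : ℝ} (h : 0 < r) : 0 < om N r := pow_pos (Real.sinh_pos_iff.mpr h) _
lemma om_nonneg (N : ℕ) {r : ℝ} (h : 0 ≤ r) : 0 ≤ om N r := pow_nonneg (Real.sinh_nonneg_iff.mpr h) _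
lemma om_cont (N : ℕ) : Continuous (om N) := Real.continuous_sinh.pow _
lemma om_mono (N : ℕ) {r s : ℝ} (h : 0 ≤ r) (hs : r ≤ s) : om N r ≤ om N s :=
  pow_le_pow_left₀ (Real.sinh_nonneg_iff.mpr h) (Real.sinh_le_sinh.mpr hs) _
lemma om_zero {N : ℕ} (hN : 2 ≤ N) : om N 0 = 0 := by
  unfold om; rw [Real.sinh_zero]; exact zero_pow (by omega)

lemma castN {N : ℕ} (hN : 2 ≤ N) : ((N - 1 : ℕ) : ℝ) = (N:ℝ) - 1 := by
  rw [Nat.cast_sub (by omega)]; simp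

lemma om_le_exp {N : ℕ} (hN : 2 ≤ N) {r : ℝ} (h : 0 ≤ r) :
    om N r ≤ Real.exp (((N:ℝ) - 1) * r) := by
  have h1 : Real.sinh r ≤ Real.exp r := by
    rw [Real.sinh_eq]; have := Real.exp_pos r; have := Real.exp_pos (-r); linarith
  have : om N r ≤ Real.exp r ^ (N - 1) := pow_le_pow_left₀ (Real.sinh_nonneg_iff.mpr h) h1 _
  rwa [← Real.exp_nat_mul, castN hN] at this

lemma om_ge_exp {N : ℕ} (hN : 2 ≤ N) {r : ℝ} (h : 1 ≤ r) :
    Real.exp (((N:ℝ) - 1) * r) ≤ 4 ^ (N - 1) * om N r := by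
  have h1 : Real.exp r ≤ 4 * Real.sinh r := by
    rw [Real.sinh_eq]
    have h2 : Real.exp (-r) ≤ 1 := Real.exp_le_one_iff.mpr (by linarith)
    have h3 : 2 ≤ Real.exp r := by have := Real.add_one_le_exp r; linarith
    linarith
  have : Real.exp r ^ (N - 1) ≤ (4 * Real.sinh r) ^ (N - 1) :=
    pow_le_pow_left₀ (Real.exp_pos r).le h1 _
  rwa [← Real.exp_nat_mul, castN hN, mul_pow] at this

lemma inv_om_le {N : ℕ} (hN : 2 ≤ N) {r : ℝ} (h : 1 ≤ r) :
    (om N r)⁻¹ ≤ 4 ^ (N - 1) * Real.exp (-(((N:ℝ) - 1) * r)) := by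
  have h1 := om_ge_exp hN h
  have h2 := om_pos N (show 0 < r by linarith)
  rw [Real.exp_neg, inv_le_iff_one_le_mul₀ h2]
  have h3 := Real.exp_pos (((N:ℝ) - 1) * r)
  rw [mul_comm, ← mul_assoc, mul_comm (om N r), ← div_eq_mul_inv, le_div_iff₀ h3]
  linarith

lemma inv_om_contOn (N : ℕ) : ContinuousOn (fun r => (om N r)⁻¹) (Ioi 0) :=
  (om_cont N).continuousOn.inv₀ (fun _ hr => (om_pos N hr).ne')

lemma inv_om_ii (N : ℕ) {a b : ℝ} (ha : 0 < a) (hab : a ≤ b) :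
    IntervalIntegrable (fun r => (om N r)⁻¹) volume a b := by
  apply ContinuousOn.intervalIntegrable
  rw [uIcc_of_le hab]
  exact (inv_om_contOn N).mono (fun x hx => lt_of_lt_of_le ha hx.1)

lemma int_exp_neg_le {c : ℝ} (hc : 0 < c) {a b : ℝ} :
    ∫ s in a..b, Real.exp (-(c * s)) ≤ Real.exp (-(c * a)) / c := by
  have : ∫ s in a..b, Real.exp (-(c * s)) = (- Real.exp (-(c * b)) / c) - (- Real.exp (-(c * a)) / c) := by
    apply intervalIntegral.integral_eq_sub_of_hasDerivAt
    · intro x _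
      have h1 : HasDerivAt (fun s => -(c * s)) (-(c * 1)) x := ((hasDerivAt_id x).const_mul c).neg
      have h2 := (h1.exp.neg.div_const c)
      have e : -(Real.exp (-(c * x)) * -(c * 1)) / c = Real.exp (-(c * x)) := by field_simp
      rw [e] at h2
      exact h2
    · apply Continuous.intervalIntegrable; fun_prop
  rw [this]
  have := Real.exp_pos (-(c * b))
  rw [neg_div, neg_div]
  have : 0 < Real.exp (-(c * b)) / c := by positivity
  linarith

lemma G_tail {N : ℕ} (hN : 2 ≤ N) {a b : ℝ} (ha : 1 ≤ a) (hab : a ≤ b) :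
    ∫ s in a..b, (om N s)⁻¹ ≤ 4 ^ (N - 1) * Real.exp (-(((N:ℝ) - 1) * a)) := by
  have h2 : (2:ℝ) ≤ N := by exact_mod_cast hN
  have h1 : ∫ s in a..b, (om N s)⁻¹ ≤ ∫ s in a..b, 4 ^ (N - 1) * Real.exp (-(((N:ℝ) - 1) * s)) := by
    apply intervalIntegral.integral_mono_on hab (inv_om_ii N (by linarith) hab)
    · apply Continuous.intervalIntegrable; fun_prop
    · intro x hx; exact inv_om_le hN (by linarith [hx.1])
  rw [intervalIntegral.integral_const_mul] at h1
  have h3 := int_exp_neg_le (c := (N:ℝ) - 1) (by linarith) (a := a) (b := b)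
  have h4 : Real.exp (-(((N:ℝ) - 1) * a)) / ((N:ℝ) - 1) ≤ Real.exp (-(((N:ℝ) - 1) * a)) := by
    apply div_le_self (Real.exp_pos _).le; linarith
  calc _ ≤ _ := h1
    _ ≤ _ := by gcongr; linarith

lemma init_decay {N : ℕ} (hN : 2 ≤ N) {v : ℝ → ℝ} (hv : MemH1rad N v)
    {M : ℝ} (hM : ∀ r, 0 ≤ r → v r ≤ M) :
    ∃ K > 0, ∀ r, 0 ≤ r → v r ≤ K * Real.exp (-(((N:ℝ) - 1) / 2 * r)) := by
  obtain ⟨hac, hL2, hD⟩ := hv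
  have h2 : (2:ℝ) ≤ N := by exact_mod_cast hN
  set κ : ℝ := ((N:ℝ) - 1) / 2 with hκ
  have hκ0 : 0 < κ := by rw [hκ]; linarith
  set D := ∫ s in Ioi (0:ℝ), (deriv v s) ^ 2 * om N s with hDdef
  have hD0 : 0 ≤ D := by
    apply setIntegral_nonneg measurableSet_Ioi
    intro x hx
    exact mul_nonneg (sq_nonneg _) (om_nonneg N (le_of_lt hx))
  have hD' : IntegrableOn (fun s => (deriv v s) ^ 2 * om N s) (Ioi 0) := hD
  set B : ℝ := D / 2 + 4 ^ (N - 1) / 2 with hB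
  have hB0 : 0 < B := by positivity
  have key : ∀ r, 1 ≤ r → v r ≤ B * Real.exp (-(κ * r)) := by
    intro r hr
    have step : ∀ b, r ≤ b → v r ≤ v b + B * Real.exp (-(κ * r)) := by
      intro b hb
      have e1 := hac r b (by linarith) hb
      set l := Real.exp (-(κ * r)) with hl
      have hl0 : 0 < l := Real.exp_pos _
      have hint1 : IntervalIntegrable (fun s => (deriv v s) ^ 2 * om N s) volume r b := by
        rw [intervalIntegrable_iff_integrableOn_Ioc_of_le hb]
        exact hD'.mono_set (fun x hx => lt_trans (by linarith : (0:ℝ) < r) hx.1)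
      have hint2 := inv_om_ii N (show 0 < r by linarith) hb
      have e2 : ‖∫ s in r..b, deriv v s‖ ≤
          ∫ s in r..b, ((l/2) * ((deriv v s) ^ 2 * om N s) + (l⁻¹/2) * (om N s)⁻¹) := by
        apply intervalIntegral.norm_integral_le_of_norm_le hb
        · refine Eventually.of_forall (fun s hs => ?_)
          have hs0 : 0 < om N s := om_pos N (by linarith [hs.1])
          rw [Real.norm_eq_abs, abs_le]
          have q : ∀ σ : ℝ, σ ^ 2 = 1 → σ * deriv v s ≤ l / 2 * (deriv v s ^ 2 * om N s) + l⁻¹ / 2 * (om N s)⁻¹ := by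
            intro σ hσ
            have : 0 ≤ (l * om N s * deriv v s - σ) ^ 2 / (2 * l * om N s) := by positivity
            have e : (l * om N s * deriv v s - σ) ^ 2 / (2 * l * om N s) =
              l / 2 * (deriv v s ^ 2 * om N s) + l⁻¹ / 2 * (om N s)⁻¹ * σ ^ 2 - σ * deriv v s := by
              field_simp; ring
            rw [e, hσ] at this
            linarith
          have q1 := q 1 (by norm_num)
          have q2 := q (-1) (by norm_num)
          constructor <;> linarith
        · exact (hint1.const_mul _).add (hint2.const_mul _)
      rw [intervalIntegral.integral_add (hint1.const_mul _) (hint2.const_mul _),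
        intervalIntegral.integral_const_mul, intervalIntegral.integral_const_mul] at e2
      have e3 : ∫ s in r..b, (deriv v s) ^ 2 * om N s ≤ D := by
        rw [intervalIntegral.integral_of_le hb]
        apply setIntegral_mono_set hD'
        · filter_upwards [ae_restrict_mem measurableSet_Ioi] with x hx
          exact mul_nonneg (sq_nonneg _) (om_nonneg N (le_of_lt hx))
        · exact (LE.le.eventuallyLE (fun x hx => lt_trans (by linarith : (0:ℝ) < r) hx.1))
      have e4 := G_tail hN hr hb
      have e5 : Real.exp (-(((N:ℝ) - 1) * r)) = l * l := by
        rw [hl, ← Real.exp_add]; congr 1; rw [hκ]; ring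
      rw [e5] at e4
      have e6 : l⁻¹ / 2 * ∫ s in r..b, (om N s)⁻¹ ≤ l⁻¹ / 2 * (4 ^ (N - 1) * (l * l)) := by
        gcongr
      have e7 : l⁻¹ / 2 * (4 ^ (N - 1) * (l * l)) = 4 ^ (N-1) / 2 * l := by field_simp
      have e8 : l / 2 * (∫ s in r..b, (deriv v s) ^ 2 * om N s) ≤ l / 2 * D := by gcongr
      have e9 := neg_abs_le (∫ s in r..b, deriv v s)
      rw [Real.norm_eq_abs] at e2
      rw [hB]
      linarith
    by_contra hc
    push Not at hc
    set ε := v r - B * Real.exp (-(κ * r)) with hε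
    have hε0 : 0 < ε := by rw [hε]; linarith
    have hge : ∀ b, r ≤ b → ε ≤ v b := fun b hb => by have := step b hb; rw [hε]; linarith
    have hmono : IntegrableOn (fun _ : ℝ => ε ^ 2 * om N r) (Ioi r) := by
      have h3 : IntegrableOn (fun s => (v s) ^ 2 * om N s) (Ioi r) :=
        (show IntegrableOn (fun s => (v s) ^ 2 * om N s) (Ioi (0:ℝ)) volume from hL2).mono_set
          (Ioi_subset_Ioi (by linarith : (0:ℝ) ≤ r))
      refine Integrable.mono' h3 (by fun_prop) ?_
      filter_upwards [ae_restrict_mem measurableSet_Ioi] with x hx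
      have hx' : r < x := hx
      have o1 := om_nonneg N (show 0 ≤ r by linarith)
      rw [Real.norm_eq_abs, abs_of_nonneg (by positivity)]
      have := hge x hx'.le
      have := om_mono N (show 0 ≤ r by linarith) hx'.le
      gcongr
    rw [integrableOn_const_iff] at hmono
    have := om_pos N (show 0 < r by linarith)
    rcases hmono with h | h
    · have : 0 < ε ^ 2 * om N r := by positivity
      simp at h
      rcases h with h | h <;> linarith
    · simp at h
  refine ⟨B + |M| * Real.exp κ, by positivity, fun r hr => ?_⟩
  rcases le_total 1 r with h | h
  · refine (key r h).trans ?_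
    gcongr
    have : 0 ≤ |M| * Real.exp κ := by positivity
    linarith
  · have h3 := (hM r hr).trans (le_abs_self M)
    have h4 : 1 ≤ Real.exp κ * Real.exp (-(κ * r)) := by
      rw [← Real.exp_add]; apply Real.one_le_exp; nlinarith
    have : |M| * 1 ≤ |M| * (Real.exp κ * Real.exp (-(κ * r))) := by gcongr
    have h5 : 0 ≤ B * Real.exp (-(κ * r)) := by positivity
    nlinarith


lemma coth_ge_one {r : ℝ} (h : 0 < r) : 1 ≤ Real.cosh r / Real.sinh r := by
  rw [le_div_iff₀ (Real.sinh_pos_iff.mpr h), one_mul]; exact (Real.sinh_lt_cosh r).le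

lemma coth_le {r : ℝ} (h : 0 < r) : r * (Real.cosh r / Real.sinh r) ≤ 1 + r := by
  have hs := Real.sinh_pos_iff.mpr h
  rw [← mul_div_assoc, div_le_iff₀ hs]
  have h1 : Real.cosh r = Real.sinh r + Real.exp (-r) := by
    rw [← Real.cosh_sub_sinh]; ring
  have h2 : Real.exp (-r) ≤ 1 := Real.exp_le_one_iff.mpr (by linarith)
  have h3 : r ≤ Real.sinh r := Real.self_le_sinh_iff.mpr h.le
  rw [h1]
  nlinarith

lemma coth_ge_inv {r : ℝ} (h : 0 < r) : 1 / r ≤ Real.cosh r / Real.sinh r := by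
  have hs := Real.sinh_pos_iff.mpr h
  rw [div_le_div_iff₀ h hs, one_mul]
  have hmono : MonotoneOn (fun x => x * Real.cosh x - Real.sinh x) (Ici 0) := by
    apply monotoneOn_of_deriv_nonneg (convex_Ici 0) (by fun_prop) (by fun_prop)
    intro x hx
    rw [interior_Ici] at hx
    have : HasDerivAt (fun x => x * Real.cosh x - Real.sinh x)
        (1 * Real.cosh x + x * Real.sinh x - Real.cosh x) x :=
      ((hasDerivAt_id x).mul (Real.hasDerivAt_cosh x)).sub (Real.hasDerivAt_sinh x)
    rw [this.deriv]
    have := mul_nonneg (le_of_lt hx) (Real.sinh_nonneg_iff.mpr (le_of_lt hx))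
    linarith
  have := hmono (mem_Ici.mpr le_rfl) (mem_Ici.mpr h.le) h.le
  simp at this
  linarith

lemma gs_alg {N : ℕ} {k r R z co s P y : ℝ} (hN2 : (2:ℝ) ≤ N) (hk0 : 0 < k) (hr0 : 0 < r)
    (hrR2 : r < R) (hR1 : 1 ≤ R) (hz : z = R ^ 2 - r ^ 2) (hz0 : 0 < z) (hc1 : 1 ≤ co)
    (hc2 : r * co ≤ 1 + r) (hs0 : 0 < s) (hP0 : 0 < P) (hy0 : 0 < y) :
    s * P * y * (2 * k * z * (1 + ((N:ℝ) - 1) * (r * co)) + 4 * k * (k + 1) * r ^ 2)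
        ≤ s * P * y * ((4 * k * N + 4 * k * (k + 1)) * R ^ 3) := by
  have b1 : z ≤ R ^ 2 := by rw [hz]; nlinarith
  have b2 : 1 + ((N:ℝ) - 1) * (r * co) ≤ 2 * N * R := by
    have : ((N:ℝ) - 1) * (r * co) ≤ ((N:ℝ) - 1) * (1 + R) := by
      apply mul_le_mul_of_nonneg_left _ (by linarith); linarith
    nlinarith
  have b3 : 2 * k * z * (1 + ((N:ℝ) - 1) * (r * co)) + 4 * k * (k + 1) * r ^ 2
      ≤ (4 * k * N + 4 * k * (k + 1)) * R ^ 3 := by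
    have h0 : 0 ≤ 1 + ((N:ℝ) - 1) * (r * co) := by
      have : 0 ≤ ((N:ℝ) - 1) * (r * co) := by
        apply mul_nonneg (by linarith); apply mul_nonneg hr0.le; linarith
      linarith
    have h1 : 2 * k * z * (1 + ((N:ℝ) - 1) * (r * co)) ≤ 2 * k * R ^ 2 * (2 * N * R) := by
      gcongr
    have h2 : r ^ 2 ≤ R ^ 3 := by
      have h4 : r ^ 2 ≤ R ^ 2 := by gcongr
      have h5 : R ^ 2 * 1 ≤ R ^ 2 * R := by gcongr
      linarith [show R ^ 2 * R = R ^ 3 by ring]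
    have h3 : 4 * k * (k + 1) * r ^ 2 ≤ 4 * k * (k + 1) * R ^ 3 := by gcongr
    linarith [show 2 * k * R ^ 2 * (2 * N * R) = 4 * k * N * R ^ 3 by ring,
      show (4 * k * N + 4 * k * (k + 1)) * R ^ 3 = 4 * k * N * R ^ 3 + 4 * k * (k + 1) * R ^ 3 by ring]
  exact mul_le_mul_of_nonneg_left b3 (by positivity)

set_option maxHeartbeats 1600000 in
lemma global_step {N : ℕ} {m T : ℝ} {u ut vr vrr : ℝ → ℝ → ℝ} (H : Reg N m T u ut vr vrr)
    {K : ℝ} (hK : 0 < K)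
    (h0 : ∀ r, 0 ≤ r → u r 0 ^ m < K * Real.exp (-(((N:ℝ) - 1) / 2 * r)))
    {q k C : ℝ} (hq : q = m / (1 - m)) (hk : k = 2 * q)
    (hC : C = (1 - m) * (4 * k * N + 4 * k * (k + 1)))
    {r1 t1 R : ℝ} (hr1 : 0 ≤ r1) (ht1 : 0 ≤ t1) (htT : t1 < T) (hR1 : 1 ≤ R) (hrR : r1 < R) :
    u r1 t1 ^ m ≤ K * Real.exp (-(((N:ℝ) - 1) / 2 * r1)) +
      (1 + t1) ^ q * ((C * R ^ 3) ^ q * (R ^ 2 - r1 ^ 2) ^ (-k)) := by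
  have hm0 := H.hm0
  have hm1 := H.hm1
  have hN2 : (2:ℝ) ≤ N := by exact_mod_cast H.hN
  set κ : ℝ := ((N:ℝ) - 1) / 2 with hκ
  have hκ0 : 0 < κ := by rw [hκ]; linarith
  have hq0 : 0 < q := by rw [hq]; apply div_pos <;> linarith
  have hk0 : 0 < k := by rw [hk]; linarith
  have hC0 : 0 < C := by rw [hC]; apply mul_pos <;> [linarith; positivity]
  set A : ℝ := (C * R ^ 3) ^ q with hA
  have hA0 : 0 < A := by rw [hA]; positivity
  -- choose the inner radius
  have hcomp : IsCompact (Icc 0 R ×ˢ Icc 0 T) := isCompact_Icc.prod isCompact_Icc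
  have hvc : ContinuousOn (fun p : ℝ × ℝ => u p.1 p.2 ^ m) (Icc 0 R ×ˢ Icc 0 T) :=
    (H.cu.mono (prod_mono (fun r hr => hr.1) (le_refl _))).rpow_const (fun _ _ => Or.inr hm0.le)
  obtain ⟨M, hM⟩ := hcomp.bddAbove_image hvc
  have hM' : ∀ r ∈ Icc 0 R, ∀ t ∈ Icc 0 T, u r t ^ m ≤ M := fun r hr t ht =>
    hM (mem_image_of_mem (fun p : ℝ × ℝ => u p.1 p.2 ^ m) (show (r, t) ∈ Icc 0 R ×ˢ Icc 0 T from ⟨hr, ht⟩))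
  have hz : ∃ z, 0 < z ∧ z < R ^ 2 - r1 ^ 2 ∧ M < A * z ^ (-k) := by
    have h1 : Tendsto (fun z : ℝ => A * z ^ (-k)) (𝓝[>] 0) atTop :=
      (tendsto_rpow_neg_nhdsGT_zero (by linarith)).const_mul_atTop hA0
    have h2 := (h1.eventually_gt_atTop M).and
      (Ioo_mem_nhdsGT (show 0 < R ^ 2 - r1 ^ 2 by nlinarith))
    obtain ⟨z, hz1, hz2⟩ := h2.exists
    exact ⟨z, hz2.1, hz2.2, hz1⟩
  obtain ⟨z0, hz0, hz1, hz2⟩ := hz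
  set R' := Real.sqrt (R ^ 2 - z0) with hR'
  have hR'sq : R' ^ 2 = R ^ 2 - z0 := Real.sq_sqrt (by nlinarith)
  have hR'0 : 0 ≤ R' := Real.sqrt_nonneg _
  have hR'R : R' < R := by nlinarith
  have hr1R' : r1 < R' := by nlinarith
  have zpos : ∀ r ∈ Icc 0 R', 0 < R ^ 2 - r ^ 2 := by
    intro r hr; nlinarith [hr.1, hr.2]
  set ψ : ℝ → ℝ := fun r => A * (R ^ 2 - r ^ 2) ^ (-k) with hψ
  set W : ℝ → ℝ → ℝ := fun r t => K * Real.exp (-(κ * r)) + (1 + t) ^ q * ψ r with hW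
  set S : ℝ → ℝ → ℝ := fun r t => W r t ^ (1 / m) with hS
  have hψ0 : ∀ r ∈ Icc 0 R', 0 < ψ r := fun r hr => by
    have := zpos r hr; rw [hψ]; positivity
  have hW0 : ∀ r ∈ Icc 0 R', ∀ t, 0 ≤ t → 0 < W r t := fun r hr t ht => by
    have := hψ0 r hr
    have := Real.exp_pos (-(κ * r))
    rw [hW]; positivity
  have hSm : ∀ r ∈ Icc 0 R', ∀ t, 0 ≤ t → S r t ^ m = W r t := fun r hr t ht => by
    rw [hS]; simp only; rw [← Real.rpow_mul (hW0 r hr t ht).le, one_div_mul_cancel hm0.ne', Real.rpow_one]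
  have hlt : ∀ r ∈ Icc 0 R', ∀ t ∈ Icc 0 T, u r t ^ m < W r t → u r t < S r t := by
    intro r hr t ht h
    rw [← hSm r hr t ht.1] at h
    have hSn : 0 ≤ S r t := Real.rpow_nonneg (hW0 r hr t ht.1).le _
    exact (Real.rpow_lt_rpow_iff (H.nn r hr.1 t ht) hSn hm0).mp h
  have hzd : ∀ r, HasDerivAt (fun r : ℝ => R ^ 2 - r ^ 2) (-(2 * r)) r := fun r => by
    have := (hasDerivAt_pow 2 r).const_sub (R ^ 2)
    simpa using this
  have hψd : ∀ r ∈ Ico 0 R', HasDerivAt ψ (A * (2 * k * r * (R ^ 2 - r ^ 2) ^ (-k - 1))) r := by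
    intro r hr
    have h1 := ((hzd r).rpow_const (p := -k) (Or.inl (zpos r ⟨hr.1, hr.2.le⟩).ne')).const_mul A
    refine h1.congr_deriv ?_
    ring
  have hψdd : ∀ r ∈ Ico 0 R',
      HasDerivAt (fun r => A * (2 * k * r * (R ^ 2 - r ^ 2) ^ (-k - 1)))
      (A * (2 * k * (R ^ 2 - r ^ 2) ^ (-k - 1) +
        4 * k * (k + 1) * r ^ 2 * (R ^ 2 - r ^ 2) ^ (-k - 2))) r := by
    intro r hr
    have h1 := ((hzd r).rpow_const (p := -k - 1) (Or.inl (zpos r ⟨hr.1, hr.2.le⟩).ne'))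
    have h2 := (((hasDerivAt_id r).const_mul (2 * k)).mul h1).const_mul A
    refine h2.congr_deriv ?_
    rw [show -k - 1 - 1 = -k - 2 by ring]
    simp only [id]
    ring
  have hed : ∀ r, HasDerivAt (fun r => K * Real.exp (-(κ * r))) (-(K * κ * Real.exp (-(κ * r)))) r := by
    intro r
    have h1 : HasDerivAt (fun s => -(κ * s)) (-(κ * 1)) r := ((hasDerivAt_id r).const_mul κ).neg
    exact (h1.exp.const_mul K).congr_deriv (by ring)
  have hedd : ∀ r, HasDerivAt (fun r => -(K * κ * Real.exp (-(κ * r))))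
      (K * κ ^ 2 * Real.exp (-(κ * r))) r := by
    intro r
    have h1 : HasDerivAt (fun s => -(κ * s)) (-(κ * 1)) r := ((hasDerivAt_id r).const_mul κ).neg
    exact (h1.exp.const_mul (K * κ)).neg.congr_deriv (by ring)
  have htd : ∀ t, 0 ≤ t → HasDerivAt (fun t : ℝ => (1 + t) ^ q) (q * (1 + t) ^ (q - 1)) t := by
    intro t ht
    have h1 : HasDerivAt (fun t : ℝ => 1 + t) 1 t := (hasDerivAt_id t).const_add 1
    exact (h1.rpow_const (p := q) (Or.inl (by positivity))).congr_deriv (by ring)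
  have main := compare H (R := R') (t0 := 0) (t1 := t1) le_rfl htT S W
    (fun r t => -(K * κ * Real.exp (-(κ * r))) +
      (1 + t) ^ q * (A * (2 * k * r * (R ^ 2 - r ^ 2) ^ (-k - 1))))
    (fun r t => K * κ ^ 2 * Real.exp (-(κ * r)) +
      (1 + t) ^ q * (A * (2 * k * (R ^ 2 - r ^ 2) ^ (-k - 1) +
        4 * k * (k + 1) * r ^ 2 * (R ^ 2 - r ^ 2) ^ (-k - 2))))
    (fun r t => (q * (1 + t) ^ (q - 1) * ψ r) * (1 / m) * W r t ^ (1 / m - 1))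
    ?_ ?_ ?_ ?_ ?_ ?_ ?_ ?_ ?_ r1 ⟨hr1, hr1R'.le⟩ t1 ⟨ht1, le_rfl⟩
  · have h1 := Real.rpow_le_rpow (H.nn r1 hr1 t1 ⟨ht1, htT.le⟩) main.le hm0.le
    rw [hSm r1 ⟨hr1, hr1R'.le⟩ t1 ht1] at h1
    exact h1
  · -- continuity
    have hψc : ContinuousOn ψ (Icc 0 R') := by
      apply ContinuousOn.mul continuousOn_const
      exact ContinuousOn.rpow_const (by fun_prop) (fun r hr => Or.inl (zpos r hr).ne')
    have hWc : ContinuousOn (fun p : ℝ × ℝ => W p.1 p.2) (Icc 0 R' ×ˢ Icc 0 t1) := by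
      apply ContinuousOn.add (by fun_prop)
      apply ContinuousOn.mul
      · exact ContinuousOn.rpow_const (by fun_prop) (fun p _ => Or.inr hq0.le)
      · exact hψc.comp continuousOn_fst (fun p hp => hp.1)
    exact hWc.rpow_const (fun p hp => Or.inr (by positivity))
  · intro r hr t ht; exact (hSm r hr t ht.1).symm
  · intro r hr
    apply hlt r hr 0 ⟨le_rfl, H.hT.le⟩
    have := h0 r hr.1
    have := hψ0 r hr
    rw [hW]
    simp only [add_zero, Real.one_rpow, one_mul]
    linarith
  · intro t ht
    apply hlt R' ⟨hR'0, le_rfl⟩ t ⟨ht.1, by linarith [ht.2]⟩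
    have h1 := hM' R' ⟨hR'0, hR'R.le⟩ t ⟨ht.1, by linarith [ht.2]⟩
    have h2 : ψ R' = A * z0 ^ (-k) := by
      rw [hψ]; simp only; rw [hR'sq]; congr 2; ring
    have h3 : 1 ≤ (1 + t) ^ q := Real.one_le_rpow (by linarith [ht.1]) hq0.le
    have h4 := hψ0 R' ⟨hR'0, le_rfl⟩
    have h5 : ψ R' ≤ (1 + t) ^ q * ψ R' := by nlinarith
    have h6 : 0 < K * Real.exp (-(κ * R')) := by positivity
    rw [hW]; simp only
    linarith
  · intro r hr t ht
    have hrI : r ∈ Icc 0 R' := ⟨hr.1.le, hr.2.le⟩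
    have h1 : HasDerivAt (fun τ => W r τ) (q * (1 + t) ^ (q - 1) * ψ r) t :=
      ((htd t ht.1.le).mul_const (ψ r)).const_add (K * Real.exp (-(κ * r)))
    exact h1.rpow_const (p := 1 / m) (Or.inl (hW0 r hrI t ht.1.le).ne')
  · intro r hr t ht
    exact (hed r).add ((hψd r ⟨hr.1.le, hr.2⟩).const_mul _)
  · intro r hr t ht
    exact (hedd r).add ((hψdd r ⟨hr.1.le, hr.2⟩).const_mul _)
  · intro r hr t ht
    have hrI : r ∈ Icc 0 R' := ⟨hr.1.le, hr.2.le⟩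
    set z := R ^ 2 - r ^ 2 with hz
    have hz0 : 0 < z := zpos r hrI
    set co := Real.cosh r / Real.sinh r with hco
    have hc1 := coth_ge_one hr.1
    have hc2 := coth_le hr.1
    have ht0 : 0 < 1 + t := by linarith [ht.1]
    set s := (1 + t) ^ q with hs
    have hs0 : 0 < s := by positivity
    have hψr := hψ0 r hrI
    -- lower bound for the time derivative
    have hexp : 1 / m - 1 = 1 / q := by rw [hq]; field_simp
    have hp1 : 0 ≤ 1 / m - 1 := by rw [hexp]; positivity
    have e1 : (s * ψ r) ^ (1 / m - 1) ≤ W r t ^ (1 / m - 1) := by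
      apply Real.rpow_le_rpow (by positivity) _ hp1
      rw [hW]; simp only
      have : 0 < K * Real.exp (-(κ * r)) := by positivity
      linarith
    have e2 : (s * ψ r) ^ (1 / m - 1) = (1 + t) * (C * R ^ 3 * z ^ (-2:ℝ)) := by
      have hψe : ψ r = (C * R ^ 3 * z ^ (-2:ℝ)) ^ q := by
        rw [Real.mul_rpow (by positivity) (by positivity), ← Real.rpow_mul hz0.le, hψ]
        simp only
        rw [hA, hk]; congr 2; ring
      rw [hψe, hs, ← Real.mul_rpow ht0.le (by positivity), hexp,
        ← Real.rpow_mul (by positivity), mul_one_div_cancel hq0.ne', Real.rpow_one]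
    have e3 : q * (1 + t) ^ (q - 1) * ψ r * (1 / m) * ((1 + t) * (C * R ^ 3 * z ^ (-2:ℝ)))
        = s * ψ r * (1 / (1 - m)) * (C * R ^ 3 * z ^ (-2:ℝ)) := by
      have : (1 + t) ^ (q - 1) * (1 + t) = s := by
        rw [hs, Real.rpow_sub_one ht0.ne']; field_simp
      rw [← this]
      have h1 : q * (1 / m) = 1 / (1 - m) := by rw [hq]; field_simp
      rw [← h1]; ring
    have e4 : s * ψ r * (1 / (1 - m)) * (C * R ^ 3 * z ^ (-2:ℝ)) ≤
        q * (1 + t) ^ (q - 1) * ψ r * (1 / m) * W r t ^ (1 / m - 1) := by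
      rw [← e3, ← e2]
      gcongr
    refine lt_of_lt_of_le ?_ e4
    have z1 : z ^ (-k - 1) = z ^ (-k) * z * z ^ (-2:ℝ) := by
      rw [← Real.rpow_add_one hz0.ne', ← Real.rpow_add hz0]; congr 1; ring
    have z2 : z ^ (-k - 2) = z ^ (-k) * z ^ (-2:ℝ) := by
      rw [← Real.rpow_add hz0]; congr 1
    have hψz : ψ r = A * z ^ (-k) := rfl
    rw [z1, z2]
    set P := A * z ^ (-k) with hP
    set y := z ^ (-2:ℝ) with hy
    have hy0 : 0 < y := by positivity
    have hP0 : 0 < P := by positivity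
    set E := K * Real.exp (-(κ * r)) with hE
    have hE0 : 0 < E := by positivity
    have hm1' : 0 < 1 - m := by linarith
    have hCR : 1 / (1 - m) * (C * R ^ 3) = (4 * k * N + 4 * k * (k + 1)) * R ^ 3 := by
      rw [hC]; field_simp
    have hr0 := hr.1
    have hrR2 : r < R := by linarith [hr.2]
    have hN1 : (N:ℝ) - 1 = 2 * κ := by rw [hκ]; ring
    have b4 := gs_alg (N := N) (s := s) (P := P) (y := y) hN2 hk0 hr0 hrR2 hR1 hz hz0 hc1 hc2 (by positivity) hP0 hy0
    have b5 : E * κ ^ 2 - ((N:ℝ) - 1) * co * (E * κ) < 0 := by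
      rw [hN1]
      have : 0 < E * κ ^ 2 := by positivity
      nlinarith
    have lhs : K * κ ^ 2 * Real.exp (-(κ * r)) +
        s * (A * (2 * k * (z ^ (-k) * z * y) + 4 * k * (k + 1) * r ^ 2 * (z ^ (-k) * y))) +
        ((N:ℝ) - 1) * co * (-(K * κ * Real.exp (-(κ * r))) +
          s * (A * (2 * k * r * (z ^ (-k) * z * y)))) =
        (E * κ ^ 2 - ((N:ℝ) - 1) * co * (E * κ)) +
        s * P * y * (2 * k * z * (1 + ((N:ℝ) - 1) * (r * co)) + 4 * k * (k + 1) * r ^ 2) := by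
      rw [hE, hP]; ring
    have rhs : s * ψ r * (1 / (1 - m)) * (C * R ^ 3 * y) =
        s * P * y * ((4 * k * N + 4 * k * (k + 1)) * R ^ 3) := by
      rw [← hCR, hψz]; ring
    rw [rhs]
    calc _ = _ := lhs
      _ < _ := by linarith
  · intro t ht
    refine ⟨-(K * κ), by nlinarith, ?_⟩
    have h1 := (hed 0).add ((hψd 0 ⟨le_rfl, by linarith⟩).const_mul ((1 + t) ^ q))
    have h2 := h1.hasDerivWithinAt (s := Ici 0)
    refine h2.congr_deriv ?_
    simp

lemma global_decay {N : ℕ} {m T : ℝ} {u ut vr vrr : ℝ → ℝ → ℝ} (H : Reg N m T u ut vr vrr)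
    {K : ℝ} (hK : 0 < K)
    (h0 : ∀ r, 0 ≤ r → u r 0 ^ m < K * Real.exp (-(((N:ℝ) - 1) / 2 * r))) :
    ∀ r, 0 ≤ r → ∀ t ∈ Icc 0 T, u r t ^ m ≤ K * Real.exp (-(((N:ℝ) - 1) / 2 * r)) := by
  intro r hr t ht
  have hm0 := H.hm0
  have hm1 := H.hm1
  rcases ht.2.eq_or_lt with h | h
  · rw [h, H.ext r hr, Real.zero_rpow hm0.ne']; positivity
  set q := m / (1 - m) with hq
  have hq0 : 0 < q := by rw [hq]; apply div_pos <;> linarith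
  set C := (1 - m) * (4 * (2 * q) * N + 4 * (2 * q) * (2 * q + 1)) with hC
  have hC0 : 0 ≤ C := by rw [hC]; apply mul_nonneg <;> [linarith; positivity]
  have hlim : Tendsto (fun R : ℝ => K * Real.exp (-(((N:ℝ) - 1) / 2 * r)) +
      (1 + t) ^ q * (4 * C * R⁻¹) ^ q) atTop
      (𝓝 (K * Real.exp (-(((N:ℝ) - 1) / 2 * r)) + (1 + t) ^ q * (4 * C * 0) ^ q)) := by
    apply Tendsto.const_add
    apply Tendsto.const_mul
    apply Tendsto.rpow_const _ (Or.inr hq0.le)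
    exact tendsto_inv_atTop_zero.const_mul _
  rw [mul_zero, Real.zero_rpow hq0.ne', mul_zero, add_zero] at hlim
  refine ge_of_tendsto hlim ?_
  filter_upwards [eventually_ge_atTop (2 * r + 1)] with R hR
  have hst := global_step H hK h0 hq rfl hC hr ht.1 h (by linarith) (by linarith : r < R)
  refine hst.trans ?_
  have hR0 : 0 < R := by linarith
  have hz : R ^ 2 / 2 ≤ R ^ 2 - r ^ 2 := by nlinarith
  have hz0 : 0 < R ^ 2 / 2 := by positivity
  have e1 : (R ^ 2 - r ^ 2) ^ (-(2 * q)) ≤ (R ^ 2 / 2) ^ (-(2 * q)) :=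
    Real.rpow_le_rpow_of_nonpos hz0 hz (by linarith)
  have e2 : (C * R ^ 3) ^ q * (R ^ 2 / 2) ^ (-(2 * q)) = (4 * C * R⁻¹) ^ q := by
    rw [show -(2 * q) = (-2) * q by ring, Real.rpow_mul hz0.le,
      ← Real.mul_rpow (by positivity) (by positivity)]
    congr 1
    rw [Real.rpow_neg hz0.le, Real.rpow_two]
    field_simp
    norm_num
  rw [← e2]
  have : 0 ≤ t := ht.1
  gcongr


lemma clampC {F : ℝ → ℝ → ℝ} {a b c d : ℝ} (hab : a ≤ b) (hcd : c ≤ d)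
    (hF : ContinuousOn (fun p : ℝ × ℝ => F p.1 p.2) (Icc a b ×ˢ Icc c d)) :
    ∃ G : ℝ → ℝ → ℝ, Continuous (fun p : ℝ × ℝ => G p.1 p.2) ∧
      ∀ x ∈ Icc a b, ∀ t ∈ Icc c d, G x t = F x t := by
  refine ⟨fun x t => F (max a (min b x)) (max c (min d t)), ?_, ?_⟩
  · have h1 : Continuous (fun p : ℝ × ℝ => (max a (min b p.1), max c (min d p.2))) := by fun_prop
    refine hF.comp_continuous h1 (fun p => ⟨⟨le_max_left _ _, ?_⟩, ⟨le_max_left _ _, ?_⟩⟩)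
    · exact max_le hab (min_le_left _ _)
    · exact max_le hcd (min_le_left _ _)
  · intro x hx t ht
    simp only
    rw [min_eq_right hx.2, max_eq_right hx.1, min_eq_right ht.2, max_eq_right ht.1]

lemma param_cont {F : ℝ → ℝ → ℝ} {a b c d : ℝ} (hab : a ≤ b) (hcd : c ≤ d)
    (hF : ContinuousOn (fun p : ℝ × ℝ => F p.1 p.2) (Icc a b ×ˢ Icc c d)) :
    ContinuousOn (fun t => ∫ x in a..b, F x t) (Icc c d) := by
  obtain ⟨G, hG, hGF⟩ := clampC hab hcd hF
  have h1 : Continuous (fun t => ∫ x in a..b, G x t) :=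
    intervalIntegral.continuous_parametric_intervalIntegral_of_continuous' (f := fun t x => G x t)
      (hG.comp continuous_swap) a b
  refine h1.continuousOn.congr (fun t ht => ?_)
  apply intervalIntegral.integral_congr
  intro x hx
  rw [uIcc_of_le hab] at hx
  exact (hGF x hx t ht).symm

lemma param_prim {F : ℝ → ℝ → ℝ} {a b c d : ℝ} (hab : a ≤ b) (hcd : c ≤ d)
    (hF : ContinuousOn (fun p : ℝ × ℝ => F p.1 p.2) (Icc a b ×ˢ Icc c d)) :
    ContinuousOn (fun p : ℝ × ℝ => ∫ x in a..p.1, F x p.2) (Icc a b ×ˢ Icc c d) := by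
  obtain ⟨G, hG, hGF⟩ := clampC hab hcd hF
  have h1 : Continuous (fun p : ℝ × ℝ => ∫ x in a..p.2, G x p.1) :=
    intervalIntegral.continuous_parametric_primitive_of_continuous (f := fun t x => G x t)
      (hG.comp continuous_swap)
  refine (h1.comp continuous_swap).continuousOn.congr (fun p hp => ?_)
  apply intervalIntegral.integral_congr
  intro x hx
  rw [uIcc_of_le hp.1.1] at hx
  exact (hGF x ⟨hx.1, hx.2.trans hp.1.2⟩ p.2 hp.2).symm

lemma param_swap {F : ℝ → ℝ → ℝ} {a b c d : ℝ} (hab : a ≤ b) (hcd : c ≤ d)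
    (hF : ContinuousOn (fun p : ℝ × ℝ => F p.1 p.2) (Icc a b ×ˢ Icc c d)) :
    ∫ x in a..b, ∫ t in c..d, F x t = ∫ t in c..d, ∫ x in a..b, F x t := by
  apply intervalIntegral_intervalIntegral_swap
  rw [uIoc_of_le hab, uIoc_of_le hcd]
  have h1 : IntegrableOn (fun p : ℝ × ℝ => F p.1 p.2) (Icc a b ×ˢ Icc c d) volume := by
    have : IntegrableOn (fun p : ℝ × ℝ => F p.1 p.2) (Icc a b ×ˢ Icc c d) volume :=
      hF.integrableOn_compact (isCompact_Icc.prod isCompact_Icc)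
    exact this
  exact h1.mono_set (prod_mono Ioc_subset_Icc_self Ioc_subset_Icc_self)

lemma param_deriv {F F' : ℝ → ℝ → ℝ} {a b c d : ℝ} (hab : a ≤ b)
    (hF : ∀ t ∈ Ioo c d, ContinuousOn (fun x => F x t) (Icc a b))
    (hF' : ContinuousOn (fun p : ℝ × ℝ => F' p.1 p.2) (Icc a b ×ˢ Ioo c d))
    (hd : ∀ x ∈ Ioc a b, ∀ t ∈ Ioo c d, HasDerivAt (fun t => F x t) (F' x t) t)
    {t : ℝ} (ht : t ∈ Ioo c d) :
    HasDerivAt (fun t => ∫ x in a..b, F x t) (∫ x in a..b, F' x t) t := by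
  obtain ⟨e, he⟩ : ∃ e > 0, Icc (t - e) (t + e) ⊆ Ioo c d := by
    refine ⟨min (t - c) (d - t) / 2, ?_, ?_⟩
    · have := lt_min (sub_pos.mpr ht.1) (sub_pos.mpr ht.2); linarith
    · intro s hs
      have h1 := min_le_left (t - c) (d - t)
      have h2 := min_le_right (t - c) (d - t)
      have := lt_min (sub_pos.mpr ht.1) (sub_pos.mpr ht.2)
      constructor <;> [linarith [hs.1]; linarith [hs.2]]
  obtain ⟨he0, hes⟩ := he
  have hcpt : IsCompact (Icc a b ×ˢ Icc (t - e) (t + e)) := isCompact_Icc.prod isCompact_Icc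
  have hFc := hF'.mono (prod_mono (le_refl (Icc a b)) hes)
  obtain ⟨M, hM⟩ := hcpt.exists_bound_of_continuousOn hFc
  have hin : Icc (t - e) (t + e) ∈ 𝓝 t := Icc_mem_nhds (by linarith) (by linarith)
  refine (intervalIntegral.hasDerivAt_integral_of_dominated_loc_of_deriv_le
    (F := fun t x => F x t) (F' := fun t x => F' x t) (bound := fun _ => M) hin ?_ ?_ ?_ ?_ ?_ ?_).2
  · filter_upwards [hin] with s hs
    rw [uIoc_of_le hab]
    exact ((hF s (hes hs)).mono Ioc_subset_Icc_self).aestronglyMeasurable measurableSet_Ioc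
  · apply ContinuousOn.intervalIntegrable
    rw [uIcc_of_le hab]; exact hF t ht
  · rw [uIoc_of_le hab]
    apply ContinuousOn.aestronglyMeasurable _ measurableSet_Ioc
    exact hF'.comp (f := fun x => (x, t)) (by fun_prop) (fun x hx => ⟨Ioc_subset_Icc_self hx, ht⟩)
  · filter_upwards with x hx s hs
    rw [uIoc_of_le hab] at hx
    exact hM (x, s) ⟨Ioc_subset_Icc_self hx, hs⟩
  · exact intervalIntegrable_const
  · filter_upwards with x hx s hs
    rw [uIoc_of_le hab] at hx
    exact hd x hx s (hes hs)

lemma cs_int {A B C : ℝ → ℝ} {a b : ℝ} (hab : a ≤ b)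
    (hA : IntervalIntegrable A volume a b) (hB : IntervalIntegrable B volume a b)
    (hC : IntervalIntegrable C volume a b)
    (h : ∀ x ∈ Icc a b, ∀ l : ℝ, 0 ≤ A x * (l * l) + 2 * C x * l + B x) :
    (∫ x in a..b, C x) ^ 2 ≤ (∫ x in a..b, A x) * ∫ x in a..b, B x := by
  have key : ∀ l : ℝ, 0 ≤ (∫ x in a..b, A x) * (l * l) + (2 * ∫ x in a..b, C x) * l
      + ∫ x in a..b, B x := by
    intro l
    have h1 : 0 ≤ ∫ x in a..b, (A x * (l * l) + 2 * C x * l + B x) :=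
      intervalIntegral.integral_nonneg hab (fun x hx => h x hx l)
    have e : ∫ x in a..b, (A x * (l * l) + 2 * C x * l + B x) =
        (∫ x in a..b, A x) * (l * l) + (2 * ∫ x in a..b, C x) * l + ∫ x in a..b, B x := by
      rw [intervalIntegral.integral_add ((hA.mul_const _).add ((hC.const_mul 2).mul_const l)) hB,
        intervalIntegral.integral_add (hA.mul_const _) ((hC.const_mul 2).mul_const l),
        intervalIntegral.integral_mul_const, intervalIntegral.integral_mul_const,
        intervalIntegral.integral_const_mul]
    linarith
  have := discrim_le_zero key
  unfold discrim at this
  nlinarith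

lemma partition_lemma {f g : ℝ → ℝ} {a b : ℝ} (hab : a ≤ b)
    (h : ∀ t1 t2, a ≤ t1 → t1 ≤ t2 → t2 ≤ b → f t2 - f t1 ≤ (t2 - t1) * (g t2 - g t1)) :
    f b ≤ f a := by
  have key : ∀ n : ℕ, f b - f a ≤ (b - a) / ((n:ℝ) + 1) * (g b - g a) := by
    intro n
    have hn : (0:ℝ) < (n:ℝ) + 1 := by positivity
    set d := (b - a) / ((n:ℝ) + 1) with hd
    have hd0 : 0 ≤ d := div_nonneg (by linarith) hn.le
    have hdn : d * ((n:ℝ) + 1) = b - a := by rw [hd]; field_simp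
    have h1 : ∀ i : ℕ, i ≤ n + 1 → f (a + i * d) - f a ≤ d * (g (a + i * d) - g a) := by
      intro i
      induction i with
      | zero => simp
      | succ k ih =>
        intro hk
        have hk' : ((k + 1 : ℕ):ℝ) ≤ (n:ℝ) + 1 := by exact_mod_cast hk
        have h2 := ih (by omega)
        have h4 : (0:ℝ) ≤ k * d := by positivity
        have h3 := h (a + k * d) (a + (k + 1 : ℕ) * d) (by linarith)
          (by push_cast; linarith) (by nlinarith)
        have : (a + ((k + 1 : ℕ):ℝ) * d) - (a + k * d) = d := by push_cast; ring
        rw [this] at h3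
        linarith
    have h2 := h1 (n + 1) le_rfl
    have : a + ((n + 1 : ℕ):ℝ) * d = b := by push_cast; linarith
    rwa [this] at h2
  have hl : Tendsto (fun n : ℕ => (b - a) / ((n:ℝ) + 1) * (g b - g a)) atTop (𝓝 0) := by
    have h1 := tendsto_one_div_add_atTop_nhds_zero_nat (𝕜 := ℝ)
    have h2 := (h1.const_mul (b - a)).mul_const (g b - g a)
    simp only [mul_zero, zero_mul] at h2
    refine h2.congr (fun n => ?_)
    ring
  have := ge_of_tendsto' hl key
  linarith


lemma rpow_tan_pos {p y1 y2 : ℝ} (hp : 0 < p) (hp1 : p < 1) (h2 : 0 < y2) (h1 : 0 < y1) :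
    y1 ^ p - y2 ^ p ≤ p * y2 ^ (p - 1) * (y1 - y2) := by
  have h := rpow_one_add_le_one_add_mul_self (s := y1 / y2 - 1) (p := p)
    (by have := div_pos h1 h2; linarith) hp.le hp1.le
  rw [show 1 + (y1 / y2 - 1) = y1 / y2 by ring, Real.div_rpow h1.le h2.le,
    div_le_iff₀ (by positivity)] at h
  rw [Real.rpow_sub_one h2.ne']
  have e : (1 + p * (y1 / y2 - 1)) * y2 ^ p = y2 ^ p + p * (y2 ^ p / y2) * (y1 - y2) := by
    field_simp
  linarith

lemma rpow_tan_neg {p y1 y2 : ℝ} (hp : 0 < p) (hp1 : p < 1) (h2 : 0 < y2) (h1 : 0 < y1) :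
    y2 ^ (-p) - y1 ^ (-p) ≤ p * y2 ^ (-p - 1) * (y1 - y2) := by
  have h := rpow_one_add_le_one_add_mul_self (s := y1 / y2 - 1) (p := p)
    (by have := div_pos h1 h2; linarith) hp.le hp1.le
  rw [show 1 + (y1 / y2 - 1) = y1 / y2 by ring] at h
  have hd : 0 < (y1 / y2) ^ p := by have := div_pos h1 h2; positivity
  have h3 : 1 - p * (y1 / y2 - 1) ≤ ((y1 / y2) ^ p)⁻¹ := by
    rw [← one_div, le_div_iff₀ hd]
    nlinarith [sq_nonneg ((y1 / y2) ^ p - 1)]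
  rw [← Real.rpow_neg (by positivity), Real.div_rpow h1.le h2.le,
    le_div_iff₀ (by positivity)] at h3
  rw [Real.rpow_sub_one h2.ne']
  have e : (1 - p * (y1 / y2 - 1)) * y2 ^ (-p) = y2 ^ (-p) - p * (y2 ^ (-p) / y2) * (y1 - y2) := by
    field_simp
  linarith

lemma ode_part {m T t0 : ℝ} (hm0 : 0 < m) (hm1 : m < 1) {X Y : ℝ → ℝ}
    (hX : ∀ t ∈ Ico t0 T, 0 < X t) (hY : ∀ t ∈ Ico t0 T, 0 < Y t)
    (hXa : ∀ t1 t2, t0 ≤ t1 → t1 ≤ t2 → t2 < T → X t2 ≤ X t1)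
    (hY1 : ∀ t1 t2, t0 ≤ t1 → t1 ≤ t2 → t2 < T → Y t1 - Y t2 ≤ 2 * (t2 - t1) * X t1)
    (hYa : ∀ t1 t2, t0 ≤ t1 → t1 ≤ t2 → t2 < T → Y t2 ≤ Y t1)
    (hX2 : ∀ t1 t2, t0 ≤ t1 → t1 ≤ t2 → t2 < T →
      (1 + m) * (t2 - t1) * (X t2 ^ 2 / Y t1) ≤ X t1 - X t2)
    (hYT : Tendsto Y (𝓝[<] T) (𝓝 0)) (ht0 : t0 < T) :
    ∃ C > 0, ∀ t ∈ Ico t0 T, X t ≤ C * (T - t) ^ ((1 + m) / (1 - m)) := by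
  set p : ℝ := (1 + m) / 2 with hp
  have hp0 : 0 < p := by rw [hp]; linarith
  have hp1 : p < 1 := by rw [hp]; linarith
  set Z : ℝ → ℝ := fun t => X t * Y t ^ (-p) with hZ
  have hZpos : ∀ t ∈ Ico t0 T, 0 < Z t := fun t ht => by
    have := hX t ht; have := hY t ht; rw [hZ]; positivity
  have negmono : ∀ k : ℝ, 0 < k → ∀ t1 t2, t0 ≤ t1 → t1 ≤ t2 → t2 < T → Y t1 ^ (-k) ≤ Y t2 ^ (-k) := by
    intro k hk t1 t2 h1 h2 h3
    exact Real.rpow_le_rpow_of_nonpos (hY t2 ⟨h1.trans h2, h3⟩) (hYa t1 t2 h1 h2 h3) (by linarith)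
  have hZa : ∀ a b, t0 ≤ a → a ≤ b → b < T → Z b ≤ Z a := by
    intro a b ha hab hb
    set y : ℝ → ℝ := fun t => Y t ^ (-p - 1) with hy
    apply partition_lemma (f := Z)
      (g := fun t => (1 + m) * X a * (X a * y t - y b * X t)) hab
    intro t1 t2 h1 h2 h3
    have I1 : t1 ∈ Ico t0 T := ⟨by linarith, by linarith⟩
    have I2 : t2 ∈ Ico t0 T := ⟨by linarith, by linarith⟩
    have hX1 := hX t1 I1
    have hX2p := hX t2 I2
    have hY1p := hY t1 I1
    have hY2p := hY t2 I2
    have hd : 0 ≤ t2 - t1 := by linarith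
    have e1 := rpow_tan_neg hp0 hp1 hY2p hY1p
    have e2 := hY1 t1 t2 I1.1 h2 I2.2
    have e3 := hX2 t1 t2 I1.1 h2 I2.2
    have hy1 : 0 < y t1 := by rw [hy]; positivity
    have hy2 : 0 < y t2 := by rw [hy]; positivity
    have hy12 : y t1 ≤ y t2 := by
      have := negmono (p + 1) (by linarith) t1 t2 I1.1 h2 I2.2
      rw [hy]; simp only; rw [show -p - 1 = -(p + 1) by ring]; exact this
    have hy1b : y t1 ≤ y b := by
      have := negmono (p + 1) (by linarith) t1 b I1.1 (by linarith) hb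
      rw [hy]; simp only; rw [show -p - 1 = -(p + 1) by ring]; exact this
    have e4 : Y t2 ^ (-p) - Y t1 ^ (-p) ≤ (1 + m) * (t2 - t1) * X t1 * y t2 := by
      refine e1.trans ?_
      have : p * y t2 * (Y t1 - Y t2) ≤ p * y t2 * (2 * (t2 - t1) * X t1) :=
        mul_le_mul_of_nonneg_left e2 (by positivity)
      calc _ ≤ _ := this
        _ = _ := by rw [hp]; ring
    have e5 : (1 + m) * (t2 - t1) * X t2 ^ 2 * y t1 ≤ (X t1 - X t2) * Y t1 ^ (-p) := by
      have := mul_le_mul_of_nonneg_right e3 (by positivity : 0 ≤ Y t1 ^ (-p))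
      refine le_trans (le_of_eq ?_) this
      rw [hy]; simp only; rw [Real.rpow_sub_one hY1p.ne']; field_simp
    have e6 : Z t2 - Z t1 ≤ (1 + m) * (t2 - t1) * X t2 * (X t1 * y t2 - X t2 * y t1) := by
      have e7 := mul_le_mul_of_nonneg_left e4 hX2p.le
      have : Z t2 - Z t1 = X t2 * (Y t2 ^ (-p) - Y t1 ^ (-p)) - (X t1 - X t2) * Y t1 ^ (-p) := by
        rw [hZ]; ring
      rw [this]
      linarith [show X t2 * ((1 + m) * (t2 - t1) * X t1 * y t2) - (1 + m) * (t2 - t1) * X t2 ^ 2 * y t1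
        = (1 + m) * (t2 - t1) * X t2 * (X t1 * y t2 - X t2 * y t1) by ring]
    have hX12 := hXa t1 t2 I1.1 h2 I2.2
    have hXa1 := hXa a t1 ha h1 I1.2
    have hXa2 : X t2 ≤ X a := by linarith
    have e8 : X t1 * y t2 - X t2 * y t1 ≤ X a * (y t2 - y t1) + y b * (X t1 - X t2) := by
      have i1 : X t1 * (y t2 - y t1) ≤ X a * (y t2 - y t1) := mul_le_mul_of_nonneg_right hXa1 (by linarith)
      have i2 : y t1 * (X t1 - X t2) ≤ y b * (X t1 - X t2) := mul_le_mul_of_nonneg_right hy1b (by linarith)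
      linarith
    have e9 : 0 ≤ X a * (y t2 - y t1) + y b * (X t1 - X t2) := by
      have i0 : 0 ≤ X a := by linarith
      have := mul_nonneg i0 (sub_nonneg.mpr hy12)
      have := mul_nonneg (hy1.le.trans hy1b) (sub_nonneg.mpr hX12)
      linarith
    have hc : 0 ≤ (1 + m) * (t2 - t1) := mul_nonneg (by linarith) hd
    calc Z t2 - Z t1 ≤ (1 + m) * (t2 - t1) * X t2 * (X t1 * y t2 - X t2 * y t1) := e6
      _ ≤ (1 + m) * (t2 - t1) * X t2 * (X a * (y t2 - y t1) + y b * (X t1 - X t2)) := by gcongr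
      _ ≤ (1 + m) * (t2 - t1) * X a * (X a * (y t2 - y t1) + y b * (X t1 - X t2)) := by gcongr
      _ = _ := by ring
  set Z0 := Z t0 with hZ0
  have hZ0p : 0 < Z0 := hZpos t0 ⟨le_rfl, ht0⟩
  have hYb : ∀ a b, t0 ≤ a → a ≤ b → b < T →
      Y a ^ (1 - p) ≤ Y b ^ (1 - p) + (1 - m) * Z0 * (b - a) := by
    intro a b ha hab hb
    have := partition_lemma (f := fun t => - Y t ^ (1 - p) - (1 - m) * Z0 * t)
      (g := fun t => (1 - m) * X a * Y t ^ (-p)) hab ?_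
    · linarith
    intro t1 t2 h1 h2 h3
    have I1 : t1 ∈ Ico t0 T := ⟨by linarith, by linarith⟩
    have I2 : t2 ∈ Ico t0 T := ⟨by linarith, by linarith⟩
    have hX1 := hX t1 I1
    have hY1p := hY t1 I1
    have hY2p := hY t2 I2
    have hd : 0 ≤ t2 - t1 := by linarith
    have e1 := rpow_tan_pos (p := 1 - p) (by linarith) (by linarith) hY2p hY1p
    rw [show 1 - p - 1 = -p by ring] at e1
    have e2 := hY1 t1 t2 I1.1 h2 I2.2
    have hXa1 := hXa a t1 ha h1 I1.2
    have e3 : (1 - p) * Y t2 ^ (-p) * (Y t1 - Y t2) ≤ (1 - p) * Y t2 ^ (-p) * (2 * (t2 - t1) * X t1) := by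
      apply mul_le_mul_of_nonneg_left e2
      apply mul_nonneg (by linarith); positivity
    have e4 : (1 - p) * Y t2 ^ (-p) * (2 * (t2 - t1) * X t1) =
        (1 - m) * (t2 - t1) * (Z t1 + X t1 * (Y t2 ^ (-p) - Y t1 ^ (-p))) := by
      rw [hZ, hp]; ring
    have e5 := hZa t0 t1 le_rfl I1.1 I1.2
    have e6 := negmono p hp0 t1 t2 I1.1 h2 I2.2
    have e7 : X t1 * (Y t2 ^ (-p) - Y t1 ^ (-p)) ≤ X a * (Y t2 ^ (-p) - Y t1 ^ (-p)) :=
      mul_le_mul_of_nonneg_right hXa1 (by linarith)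
    have hc : 0 ≤ (1 - m) * (t2 - t1) := mul_nonneg (by linarith) hd
    have e8 : (1 - m) * (t2 - t1) * (Z t1 + X t1 * (Y t2 ^ (-p) - Y t1 ^ (-p))) ≤
        (1 - m) * (t2 - t1) * (Z0 + X a * (Y t2 ^ (-p) - Y t1 ^ (-p))) := by
      apply mul_le_mul_of_nonneg_left _ hc
      linarith
    linarith [show (1 - m) * (t2 - t1) * (Z0 + X a * (Y t2 ^ (-p) - Y t1 ^ (-p))) =
      (1 - m) * Z0 * (t2 - t1) + (t2 - t1) * ((1 - m) * X a * Y t2 ^ (-p) - (1 - m) * X a * Y t1 ^ (-p)) by ring]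
  have hYT' : ∀ a ∈ Ico t0 T, Y a ^ (1 - p) ≤ (1 - m) * Z0 * (T - a) := by
    intro a ha
    have l1 : Tendsto (fun b => Y b ^ (1 - p) + (1 - m) * Z0 * (b - a)) (𝓝[<] T)
        (𝓝 (0 ^ (1 - p) + (1 - m) * Z0 * (T - a))) := by
      apply Tendsto.add
      · exact hYT.rpow_const (Or.inr (by linarith))
      · apply Tendsto.const_mul
        exact (tendsto_id.sub_const a).mono_left nhdsWithin_le_nhds
    rw [Real.zero_rpow (by linarith), zero_add] at l1
    refine ge_of_tendsto l1 ?_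
    filter_upwards [Ioo_mem_nhdsLT ha.2] with b hb
    exact hYb a b ha.1 hb.1.le hb.2
  have hc0 : 0 < (1 - m) * Z0 := mul_pos (by linarith) hZ0p
  refine ⟨Z0 * ((1 - m) * Z0) ^ ((1 + m) / (1 - m)), by positivity, fun t ht => ?_⟩
  have hYp := hY t ht
  have hTt : 0 < T - t := sub_pos.mpr ht.2
  have e1 : X t = Z t * Y t ^ p := by
    rw [hZ]; simp only; rw [mul_assoc, ← Real.rpow_add hYp]; simp
  have e2 : Y t ^ p ≤ ((1 - m) * Z0 * (T - t)) ^ ((1 + m) / (1 - m)) := by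
    have := Real.rpow_le_rpow (by positivity) (hYT' t ht) (show 0 ≤ (1 + m) / (1 - m) by
      apply div_nonneg <;> linarith)
    rw [← Real.rpow_mul hYp.le] at this
    have he : (1 - p) * ((1 + m) / (1 - m)) = p := by
      have : (1 - m) ≠ 0 := by linarith
      rw [hp]; field_simp; ring
    rwa [he] at this
  rw [e1]
  have e3 := hZa t0 t le_rfl ht.1 ht.2
  calc Z t * Y t ^ p ≤ Z0 * ((1 - m) * Z0 * (T - t)) ^ ((1 + m) / (1 - m)) := by
        have := hZpos t ht
        gcongr
    _ = _ := by rw [Real.mul_rpow hc0.le hTt.le]; ring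


noncomputable def Uf (N : ℕ) (u : ℝ → ℝ → ℝ) (r t : ℝ) : ℝ := ∫ s in (0:ℝ)..r, u s t * om N s
noncomputable def Pf (N : ℕ) (u : ℝ → ℝ → ℝ) (r t : ℝ) : ℝ := Uf N u r t / om N r

lemma om_deriv {N : ℕ} (hN : 2 ≤ N) {r : ℝ} (hr : 0 < r) :
    HasDerivAt (om N) (((N:ℝ) - 1) * (Real.cosh r / Real.sinh r) * om N r) r := by
  have h := (Real.hasDerivAt_sinh r).pow (N - 1)
  refine h.congr_deriv ?_
  have hs := (Real.sinh_pos_iff.mpr hr).ne'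
  rw [castN hN]
  unfold om
  obtain ⟨k, rfl⟩ : ∃ k, N = k + 2 := ⟨N - 2, by omega⟩
  rw [show k + 2 - 1 - 1 = k by omega, show k + 2 - 1 = k + 1 by omega, pow_succ]
  field_simp

section
variable {N : ℕ} {m T : ℝ} {u ut vr vrr : ℝ → ℝ → ℝ}

lemma local_Ici {F : ℝ × ℝ → ℝ} {S : Set ℝ} (h : ∀ R, 0 ≤ R → ContinuousOn F (Icc 0 R ×ˢ S)) :
    ContinuousOn F (Ici 0 ×ˢ S) := by
  rintro ⟨r, t⟩ ⟨hr, ht⟩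
  have hr' : 0 ≤ r := hr
  have h1 := h (r + 1) (by linarith) (r, t) ⟨⟨hr', by linarith⟩, ht⟩
  refine h1.mono_of_mem_nhdsWithin ?_
  have h2 : {p : ℝ × ℝ | p.1 < r + 1} ∈ 𝓝 (r, t) :=
    (isOpen_lt continuous_fst continuous_const).mem_nhds (by simp)
  filter_upwards [self_mem_nhdsWithin, mem_nhdsWithin_of_mem_nhds h2] with p hp hp2
  exact ⟨⟨hp.1, le_of_lt hp2⟩, hp.2⟩

lemma sl_t {F : ℝ → ℝ → ℝ} {A B : Set ℝ} (h : ContinuousOn (fun p : ℝ × ℝ => F p.1 p.2) (A ×ˢ B))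
    {t : ℝ} (ht : t ∈ B) : ContinuousOn (fun r => F r t) A :=
  h.comp (f := fun r => (r, t)) (by fun_prop) (fun _ hr => ⟨hr, ht⟩)

lemma sl_r {F : ℝ → ℝ → ℝ} {A B : Set ℝ} (h : ContinuousOn (fun p : ℝ × ℝ => F p.1 p.2) (A ×ˢ B))
    {r : ℝ} (hr : r ∈ A) : ContinuousOn (fun t => F r t) B :=
  h.comp (f := fun t => (r, t)) (by fun_prop) (fun _ ht => ⟨hr, ht⟩)

lemma om_c2 (N : ℕ) (S : Set (ℝ × ℝ)) : ContinuousOn (fun p : ℝ × ℝ => om N p.1) S :=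
  ((om_cont N).comp continuous_fst).continuousOn

namespace Reg
variable (H : Reg N m T u ut vr vrr)
include H

lemma cv : ContinuousOn (fun p : ℝ × ℝ => u p.1 p.2 ^ m) (Ici 0 ×ˢ Icc 0 T) :=
  H.cu.rpow_const (fun _ _ => Or.inr H.hm0.le)

lemma cuo : ContinuousOn (fun p : ℝ × ℝ => u p.1 p.2 * om N p.1) (Ici 0 ×ˢ Icc 0 T) :=
  H.cu.mul (om_c2 N _)

lemma Uf_cont : ContinuousOn (fun p : ℝ × ℝ => Uf N u p.1 p.2) (Ici 0 ×ˢ Icc 0 T) := by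
  apply local_Ici
  intro R hR
  exact param_prim (F := fun r t => u r t * om N r) hR H.hT.le
    (H.cuo.mono (prod_mono Icc_subset_Ici_self (le_refl _)))

lemma Uf_nonneg {r t : ℝ} (hr : 0 ≤ r) (ht : t ∈ Icc 0 T) : 0 ≤ Uf N u r t :=
  intervalIntegral.integral_nonneg hr
    (fun s hs => mul_nonneg (H.nn s hs.1 t ht) (om_nonneg N hs.1))

lemma Uf_dr {r t : ℝ} (hr : 0 < r) (ht : t ∈ Icc 0 T) :
    HasDerivAt (fun ρ => Uf N u ρ t) (u r t * om N r) r := by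
  have hc := sl_t (F := fun r t => u r t * om N r) H.cuo ht
  apply intervalIntegral.integral_hasDerivAt_right
  · apply ContinuousOn.intervalIntegrable
    rw [uIcc_of_le hr.le]
    exact hc.mono Icc_subset_Ici_self
  · exact (hc.mono Ioi_subset_Ici_self).stronglyMeasurableAtFilter isOpen_Ioi r hr
  · exact hc.continuousAt (Ici_mem_nhds hr)

lemma flux_dr {r t : ℝ} (hr : 0 < r) (ht : t ∈ Ioo 0 T) :
    HasDerivAt (fun ρ => om N ρ * vr ρ t) (ut r t * om N r) r := by
  have h := (om_deriv H.hN hr).mul (H.dvrr r hr t ht)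
  refine h.congr_deriv ?_
  rw [H.pde r hr t ht]; ring

lemma flux_int {r t : ℝ} (hr : 0 ≤ r) (ht : t ∈ Ioo 0 T) :
    ∫ s in (0:ℝ)..r, ut s t * om N s = om N r * vr r t := by
  have h := intervalIntegral.integral_eq_sub_of_hasDerivAt_of_le (f := fun ρ => om N ρ * vr ρ t)
    (f' := fun ρ => ut ρ t * om N ρ) hr
    ((om_cont N).continuousOn.mul ((sl_t H.cvr ht).mono Icc_subset_Ici_self))
    (fun x hx => H.flux_dr hx.1 ht) ?_
  · rw [h, om_zero H.hN]; ring
  · apply ContinuousOn.intervalIntegrable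
    rw [uIcc_of_le hr]
    exact ((sl_t H.cut ht).mono Icc_subset_Ici_self).mul (om_cont N).continuousOn

lemma Uf_dt {r t : ℝ} (hr : 0 ≤ r) (ht : t ∈ Ioo 0 T) :
    HasDerivAt (fun τ => Uf N u r τ) (om N r * vr r t) t := by
  rw [← H.flux_int hr ht]
  apply param_deriv (F := fun s τ => u s τ * om N s) (F' := fun s τ => ut s τ * om N s) hr (c := 0) (d := T) _ _ _ ht
  · intro t ht
    exact (sl_t (F := fun r t => u r t * om N r) H.cuo (Ioo_subset_Icc_self ht)).mono Icc_subset_Ici_self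
  · exact (H.cut.mul (om_c2 N _)).mono (prod_mono Icc_subset_Ici_self (le_refl _))
  · intro x hx t ht
    exact (H.dut x hx.1.le t ht).mul_const _

lemma Pf_dt {r t : ℝ} (hr : 0 ≤ r) (ht : t ∈ Ioo 0 T) :
    HasDerivAt (fun τ => Pf N u r τ) (vr r t) t := by
  rcases hr.eq_or_lt with h | h
  · rw [← h, H.vr0 t ht]
    have : (fun τ => Pf N u 0 τ) = fun _ => 0 := by
      funext τ; simp [Pf, om_zero H.hN]
    rw [this]; exact hasDerivAt_const _ _
  · have h1 := (H.Uf_dt hr ht).div_const (om N r)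
    refine h1.congr_deriv ?_
    have := (om_pos N h).ne'
    field_simp

lemma Uf_eq {r t : ℝ} (hr : 0 ≤ r) : Uf N u r t = Pf N u r t * om N r := by
  rcases hr.eq_or_lt with h | h
  · rw [← h, om_zero H.hN]; simp [Uf]
  · unfold Pf
    have := (om_pos N h).ne'
    field_simp

lemma Pf_nonneg {r t : ℝ} (hr : 0 ≤ r) (ht : t ∈ Icc 0 T) : 0 ≤ Pf N u r t :=
  div_nonneg (H.Uf_nonneg hr ht) (om_nonneg N hr)

lemma Pf_le {M : ℝ} (hM : ∀ r, 0 ≤ r → ∀ t ∈ Icc 0 T, u r t ≤ M) {r t : ℝ} (hr : 0 ≤ r)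
    (ht : t ∈ Icc 0 T) : Pf N u r t ≤ M * r := by
  have hM0 : 0 ≤ M := (H.nn 0 le_rfl t ht).trans (hM 0 le_rfl t ht)
  rcases hr.eq_or_lt with h | h
  · rw [← h]; simp [Pf, om_zero H.hN]
  unfold Pf
  rw [div_le_iff₀ (om_pos N h)]
  have h1 : Uf N u r t ≤ ∫ s in (0:ℝ)..r, M * om N r := by
    apply intervalIntegral.integral_mono_on hr
    · apply ContinuousOn.intervalIntegrable
      rw [uIcc_of_le hr]
      exact (sl_t (F := fun r t => u r t * om N r) H.cuo ht).mono Icc_subset_Ici_self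
    · exact intervalIntegrable_const
    · intro x hx
      exact mul_le_mul (hM x hx.1 t ht) (om_mono N hx.1 hx.2) (om_nonneg N hx.1) hM0
  rw [intervalIntegral.integral_const] at h1
  simp only [sub_zero, smul_eq_mul] at h1
  linarith

lemma Pf_cont {M : ℝ} (hM : ∀ r, 0 ≤ r → ∀ t ∈ Icc 0 T, u r t ≤ M) :
    ContinuousOn (fun p : ℝ × ℝ => Pf N u p.1 p.2) (Ici 0 ×ˢ Icc 0 T) := by
  rintro ⟨r, t⟩ ⟨hr, ht⟩
  have hr' : 0 ≤ r := hr
  rcases hr'.eq_or_lt with h | h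
  · subst h
    have h0 : Pf N u 0 t = 0 := by simp [Pf, om_zero H.hN]
    unfold ContinuousWithinAt
    simp only [h0]
    have hl : Tendsto (fun p : ℝ × ℝ => M * p.1) (𝓝[Ici 0 ×ˢ Icc 0 T] (0, t)) (𝓝 0) := by
      have : Tendsto (fun p : ℝ × ℝ => M * p.1) (𝓝 (0, t)) (𝓝 (M * 0)) :=
        (continuous_const.mul continuous_fst).tendsto _
      rw [mul_zero] at this
      exact this.mono_left nhdsWithin_le_nhds
    refine squeeze_zero' ?_ ?_ hl
    · filter_upwards [self_mem_nhdsWithin] with p hp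
      exact H.Pf_nonneg hp.1 hp.2
    · filter_upwards [self_mem_nhdsWithin] with p hp
      exact H.Pf_le hM hp.1 hp.2
  · exact (H.Uf_cont (r, t) ⟨hr, ht⟩).div (om_c2 N _ (r, t) ⟨hr, ht⟩) (om_pos N h).ne'
end Reg
end


structure Dec (N : ℕ) (m T : ℝ) (u ut vr vrr : ℝ → ℝ → ℝ) (M C β : ℝ) : Prop where
  H : Reg N m T u ut vr vrr
  hC : 0 < C
  hβ : 0 < β
  bM : ∀ r, 0 ≤ r → ∀ t ∈ Icc 0 T, u r t ≤ M
  bv : ∀ r, 0 ≤ r → ∀ t ∈ Icc 0 T, u r t ^ m ≤ C * Real.exp (-(β * r))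
  bX : ∀ r, 0 ≤ r → ∀ t ∈ Icc 0 T, u r t * u r t ^ m * om N r ≤ C * Real.exp (-(β * r))
  bVU : ∀ r, 0 ≤ r → ∀ t ∈ Icc 0 T, u r t ^ m * Uf N u r t ≤ C * Real.exp (-(β * r))
  bY : ∀ r, 0 ≤ r → ∀ t ∈ Icc 0 T, Pf N u r t ^ 2 * om N r ≤ C * Real.exp (-(β * r))

lemma dec_of_decay {N : ℕ} {m T : ℝ} {u ut vr vrr : ℝ → ℝ → ℝ} (H : Reg N m T u ut vr vrr)
    {K : ℝ} (hK : 0 < K)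
    (hd : ∀ r, 0 ≤ r → ∀ t ∈ Icc 0 T, u r t ^ m ≤ K * Real.exp (-(((N:ℝ) - 1) / 2 * r))) :
    ∃ M C β, Dec N m T u ut vr vrr M C β := by
  have hm0 := H.hm0
  have hm1 := H.hm1
  have hN2 : (2:ℝ) ≤ N := by exact_mod_cast H.hN
  set κ : ℝ := ((N:ℝ) - 1) / 2 with hκ
  have hκ0 : 0 < κ := by rw [hκ]; linarith
  set γ := max (κ / 2) (2 * κ - κ / m) with hγ
  have hg0 : 0 < γ := lt_of_lt_of_le (by linarith) (le_max_left _ _)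
  have hg1 : γ < κ := by
    apply max_lt (by linarith)
    have : κ < κ / m := by rw [lt_div_iff₀ hm0]; nlinarith
    linarith
  have hg2 : 2 * κ - κ / m ≤ γ := le_max_right _ _
  set M := K ^ (1 / m) with hM
  have hM0 : 0 < M := by rw [hM]; positivity
  have hu1 : ∀ r, 0 ≤ r → ∀ t ∈ Icc 0 T, u r t ≤ M * Real.exp (-(κ / m * r)) := by
    intro r hr t ht
    have h1 := Real.rpow_le_rpow (Real.rpow_nonneg (H.nn r hr t ht) m) (hd r hr t ht)
      (by positivity : 0 ≤ 1 / m)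
    rw [← Real.rpow_mul (H.nn r hr t ht), mul_one_div_cancel hm0.ne', Real.rpow_one,
      Real.mul_rpow hK.le (Real.exp_pos _).le, ← Real.exp_mul] at h1
    refine h1.trans (le_of_eq ?_)
    congr 2; field_simp
  have huo : ∀ r, 0 ≤ r → ∀ t ∈ Icc 0 T, u r t * om N r ≤ M * Real.exp (γ * r) := by
    intro r hr t ht
    have h1 : u r t * om N r ≤ (M * Real.exp (-(κ / m * r))) * Real.exp (((N:ℝ) - 1) * r) :=
      mul_le_mul (hu1 r hr t ht) (om_le_exp H.hN hr) (om_nonneg N hr) (by positivity)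
    refine h1.trans ?_
    rw [mul_assoc, ← Real.exp_add]
    apply mul_le_mul_of_nonneg_left _ hM0.le
    apply Real.exp_le_exp.mpr
    have : -(κ / m * r) + ((N:ℝ) - 1) * r = (2 * κ - κ / m) * r := by rw [hκ]; ring
    rw [this]
    exact mul_le_mul_of_nonneg_right hg2 hr
  have hbM : ∀ r, 0 ≤ r → ∀ t ∈ Icc 0 T, u r t ≤ M := by
    intro r hr t ht
    refine (hu1 r hr t ht).trans ?_
    have : Real.exp (-(κ / m * r)) ≤ 1 := Real.exp_le_one_iff.mpr (by
      have : 0 ≤ κ / m * r := by positivity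
      linarith)
    nlinarith
  have hU : ∀ r, 0 ≤ r → ∀ t ∈ Icc 0 T, Uf N u r t ≤ M / γ * Real.exp (γ * r) := by
    intro r hr t ht
    have h1 : Uf N u r t ≤ ∫ s in (0:ℝ)..r, M * Real.exp (γ * s) := by
      apply intervalIntegral.integral_mono_on hr
      · apply ContinuousOn.intervalIntegrable
        rw [uIcc_of_le hr]
        exact (sl_t (F := fun r t => u r t * om N r) H.cuo ht).mono Icc_subset_Ici_self
      · apply Continuous.intervalIntegrable; fun_prop
      · intro x hx; exact huo x hx.1 t ht
    have h2 : ∫ s in (0:ℝ)..r, M * Real.exp (γ * s) =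
        M / γ * Real.exp (γ * r) - M / γ * Real.exp (γ * 0) := by
      apply intervalIntegral.integral_eq_sub_of_hasDerivAt
      · intro x _
        have h1 : HasDerivAt (fun s => γ * s) (γ * 1) x := (hasDerivAt_id x).const_mul γ
        refine (h1.exp.const_mul (M / γ)).congr_deriv ?_
        field_simp
      · apply Continuous.intervalIntegrable; fun_prop
    have h3 : 0 < M / γ * Real.exp (γ * 0) := by positivity
    linarith
  set β := κ - γ with hβ
  have hβ0 : 0 < β := by linarith
  set C1 := K * M with hC1
  set C2 := K * (M / γ) with hC2
  set C3 := (M / γ) ^ 2 * 4 ^ (N - 1) with hC3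
  set C4 := M ^ 2 * om N 1 * Real.exp β with hC4
  have o1 := om_pos N one_pos
  have p1 : 0 < C1 := by positivity
  have p2 : 0 < C2 := by positivity
  have p3 : 0 < C3 := by positivity
  have p4 : 0 < C4 := by positivity
  have E : ∀ {c r x : ℝ}, c ≤ K + C1 + C2 + C3 + C4 → x ≤ c * Real.exp (-(β * r)) →
      x ≤ (K + C1 + C2 + C3 + C4) * Real.exp (-(β * r)) := fun h1 h2 =>
    h2.trans (mul_le_mul_of_nonneg_right h1 (Real.exp_pos _).le)
  refine ⟨M, K + C1 + C2 + C3 + C4, β, H, by positivity, hβ0, hbM, ?_, ?_, ?_, ?_⟩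
  · intro r hr t ht
    apply E (c := K) (by linarith)
    refine (hd r hr t ht).trans ?_
    gcongr
    linarith
  · intro r hr t ht
    apply E (c := C1) (by linarith)
    have h1 := mul_le_mul (hd r hr t ht) (huo r hr t ht)
      (mul_nonneg (H.nn r hr t ht) (om_nonneg N hr)) (by positivity)
    calc _ = u r t ^ m * (u r t * om N r) := by ring
      _ ≤ _ := h1
      _ = C1 * (Real.exp (-(κ * r)) * Real.exp (γ * r)) := by ring
      _ = _ := by rw [← Real.exp_add]; congr 2; rw [hβ]; ring
  · intro r hr t ht
    apply E (c := C2) (by linarith)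
    have h1 := mul_le_mul (hd r hr t ht) (hU r hr t ht) (H.Uf_nonneg hr ht) (by positivity)
    calc _ ≤ _ := h1
      _ = C2 * (Real.exp (-(κ * r)) * Real.exp (γ * r)) := by ring
      _ = _ := by rw [← Real.exp_add]; congr 2; rw [hβ]; ring
  · intro r hr t ht
    rcases le_total 1 r with h | h
    · apply E (c := C3) (by linarith)
      have hop := om_pos N (by linarith : 0 < r)
      have e1 : Pf N u r t ^ 2 * om N r = Uf N u r t ^ 2 * (om N r)⁻¹ := by
        unfold Pf; field_simp
      have h1 : Uf N u r t ^ 2 ≤ (M / γ * Real.exp (γ * r)) ^ 2 :=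
        pow_le_pow_left₀ (H.Uf_nonneg hr ht) (hU r hr t ht) 2
      rw [e1]
      calc _ ≤ (M / γ * Real.exp (γ * r)) ^ 2 * (4 ^ (N - 1) * Real.exp (-(((N:ℝ) - 1) * r))) :=
            mul_le_mul h1 (inv_om_le H.hN h) (inv_pos.mpr hop).le (by positivity)
        _ = C3 * (Real.exp (γ * r) * Real.exp (γ * r) * Real.exp (-(((N:ℝ) - 1) * r))) := by
            rw [hC3]; ring
        _ = C3 * Real.exp (-(2 * β * r)) := by
            rw [← Real.exp_add, ← Real.exp_add]; congr 2; rw [hβ, hκ]; ring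
        _ ≤ _ := by
            gcongr; nlinarith
    · apply E (c := C4) (by linarith)
      have h1 : Pf N u r t ≤ M * 1 := (H.Pf_le hbM hr ht).trans (by gcongr)
      have h2 : Pf N u r t ^ 2 ≤ (M * 1) ^ 2 := pow_le_pow_left₀ (H.Pf_nonneg hr ht) h1 2
      calc _ ≤ (M * 1) ^ 2 * om N 1 := mul_le_mul h2 (om_mono N hr h) (om_nonneg N hr) (by positivity)
        _ = M ^ 2 * om N 1 * 1 := by ring
        _ ≤ M ^ 2 * om N 1 * (Real.exp β * Real.exp (-(β * r))) := by
            gcongr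
            rw [← Real.exp_add]
            apply Real.one_le_exp
            nlinarith
        _ = _ := by rw [hC4]; ring


noncomputable def XR (N : ℕ) (m : ℝ) (u : ℝ → ℝ → ℝ) (R t : ℝ) : ℝ :=
  ∫ r in (0:ℝ)..R, u r t * u r t ^ m * om N r
noncomputable def YR (N : ℕ) (u : ℝ → ℝ → ℝ) (R t : ℝ) : ℝ :=
  ∫ r in (0:ℝ)..R, Pf N u r t ^ 2 * om N r
noncomputable def DR (N : ℕ) (vr : ℝ → ℝ → ℝ) (R t : ℝ) : ℝ :=
  ∫ r in (0:ℝ)..R, vr r t ^ 2 * om N r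
noncomputable def Xf (N : ℕ) (m : ℝ) (u : ℝ → ℝ → ℝ) (t : ℝ) : ℝ :=
  ∫ r in Ioi (0:ℝ), u r t * u r t ^ m * om N r
noncomputable def Yf (N : ℕ) (u : ℝ → ℝ → ℝ) (t : ℝ) : ℝ :=
  ∫ r in Ioi (0:ℝ), Pf N u r t ^ 2 * om N r

lemma tail_lemma {f : ℝ → ℝ} {C β : ℝ} (hβ : 0 < β) (hC : 0 < C) (hf : ContinuousOn f (Ici 0))
    (h0 : ∀ r, 0 ≤ r → 0 ≤ f r) (hb : ∀ r, 0 ≤ r → f r ≤ C * Real.exp (-(β * r))) :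
    IntegrableOn f (Ioi 0) ∧ Tendsto (fun R => ∫ r in (0:ℝ)..R, f r) atTop (𝓝 (∫ r in Ioi 0, f r)) ∧
    ∀ R, 0 ≤ R → ∫ r in (0:ℝ)..R, f r ≤ ∫ r in Ioi 0, f r ∧
      ∫ r in Ioi 0, f r ≤ (∫ r in (0:ℝ)..R, f r) + C / β * Real.exp (-(β * R)) := by
  have hint : IntegrableOn f (Ioi 0) := by
    have h1 : IntegrableOn (fun r => C * Real.exp (-β * r)) (Ioi 0) :=
      (integrableOn_exp_mul_Ioi (by linarith : -β < 0) 0).const_mul C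
    refine h1.mono' ((hf.mono Ioi_subset_Ici_self).aestronglyMeasurable measurableSet_Ioi) ?_
    rw [ae_restrict_iff' measurableSet_Ioi]
    filter_upwards with r hr
    have hr' : 0 ≤ r := le_of_lt hr
    rw [Real.norm_of_nonneg (h0 r hr')]
    rw [show -β * r = -(β * r) by ring]
    exact hb r hr'
  have hl := intervalIntegral_tendsto_integral_Ioi 0 hint tendsto_id
  have hl' : Tendsto (fun R => ∫ r in (0:ℝ)..R, f r) atTop (𝓝 (∫ r in Ioi 0, f r)) := hl
  refine ⟨hint, hl', fun R hR => ?_⟩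
  have hii : ∀ a b, 0 ≤ a → a ≤ b → IntervalIntegrable f volume a b := fun a b ha hab => by
    apply ContinuousOn.intervalIntegrable
    rw [uIcc_of_le hab]
    exact hf.mono (fun x hx => ha.trans hx.1)
  constructor
  · refine ge_of_tendsto hl' ?_
    filter_upwards [eventually_ge_atTop R] with R' hR'
    rw [← intervalIntegral.integral_add_adjacent_intervals (hii 0 R le_rfl hR) (hii R R' hR hR')]
    have : 0 ≤ ∫ r in R..R', f r :=
      intervalIntegral.integral_nonneg hR' (fun x hx => h0 x (hR.trans hx.1))
    linarith
  · refine le_of_tendsto hl' ?_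
    filter_upwards [eventually_ge_atTop R] with R' hR'
    rw [← intervalIntegral.integral_add_adjacent_intervals (hii 0 R le_rfl hR) (hii R R' hR hR')]
    have h1 : ∫ r in R..R', f r ≤ ∫ r in R..R', C * Real.exp (-(β * r)) := by
      apply intervalIntegral.integral_mono_on hR' (hii R R' hR hR')
      · apply Continuous.intervalIntegrable; fun_prop
      · intro x hx; exact hb x (hR.trans hx.1)
    rw [intervalIntegral.integral_const_mul] at h1
    have h2 := mul_le_mul_of_nonneg_left (int_exp_neg_le hβ (a := R) (b := R')) hC.le
    have : C * (Real.exp (-(β * R)) / β) = C / β * Real.exp (-(β * R)) := by ring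
    linarith

section
variable {N : ℕ} {m T : ℝ} {u ut vr vrr : ℝ → ℝ → ℝ} {M C β : ℝ}

namespace Dec
variable (D : Dec N m T u ut vr vrr M C β)
include D

lemma cP : ContinuousOn (fun p : ℝ × ℝ => Pf N u p.1 p.2) (Ici 0 ×ˢ Icc 0 T) := D.H.Pf_cont D.bM

lemma cPo : ContinuousOn (fun p : ℝ × ℝ => Pf N u p.1 p.2) (Ici 0 ×ˢ Ioo 0 T) :=
  D.cP.mono (prod_mono (le_refl _) Ioo_subset_Icc_self)

lemma cx : ContinuousOn (fun p : ℝ × ℝ => u p.1 p.2 * u p.1 p.2 ^ m * om N p.1) (Ici 0 ×ˢ Icc 0 T) :=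
  (D.H.cu.mul D.H.cv).mul (om_c2 N _)

lemma cy : ContinuousOn (fun p : ℝ × ℝ => Pf N u p.1 p.2 ^ 2 * om N p.1) (Ici 0 ×ˢ Icc 0 T) :=
  (D.cP.pow 2).mul (om_c2 N _)

lemma x_nn {r t : ℝ} (hr : 0 ≤ r) (ht : t ∈ Icc 0 T) : 0 ≤ u r t * u r t ^ m * om N r := by
  have h1 := D.H.nn r hr t ht
  have h2 := om_nonneg N hr
  positivity

lemma y_nn {r t : ℝ} (hr : 0 ≤ r) : 0 ≤ Pf N u r t ^ 2 * om N r := by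
  have h2 := om_nonneg N hr
  positivity

lemma X_tail {t : ℝ} (ht : t ∈ Icc 0 T) :
    IntegrableOn (fun r => u r t * u r t ^ m * om N r) (Ioi 0) ∧
    Tendsto (fun R => XR N m u R t) atTop (𝓝 (Xf N m u t)) ∧
    ∀ R, 0 ≤ R → XR N m u R t ≤ Xf N m u t ∧
      Xf N m u t ≤ XR N m u R t + C / β * Real.exp (-(β * R)) := tail_lemma D.hβ D.hC
  (sl_t (F := fun r t => u r t * u r t ^ m * om N r) D.cx ht)
  (fun r hr => D.x_nn hr ht) (fun r hr => D.bX r hr t ht)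

lemma Y_tail {t : ℝ} (ht : t ∈ Icc 0 T) :
    IntegrableOn (fun r => Pf N u r t ^ 2 * om N r) (Ioi 0) ∧
    Tendsto (fun R => YR N u R t) atTop (𝓝 (Yf N u t)) ∧
    ∀ R, 0 ≤ R → YR N u R t ≤ Yf N u t ∧
      Yf N u t ≤ YR N u R t + C / β * Real.exp (-(β * R)) := tail_lemma D.hβ D.hC
  (sl_t (F := fun r t => Pf N u r t ^ 2 * om N r) D.cy ht)
  (fun r hr => D.y_nn hr) (fun r hr => D.bY r hr t ht)

lemma ii_of {f : ℝ → ℝ} {R : ℝ} (hR : 0 ≤ R) (hf : ContinuousOn f (Ici 0)) :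
    IntervalIntegrable f volume 0 R := by
  apply ContinuousOn.intervalIntegrable
  rw [uIcc_of_le hR]
  exact hf.mono Icc_subset_Ici_self

lemma ibp1 {R s t : ℝ} (hR : 0 ≤ R) (hs : s ∈ Ioo 0 T) (ht : t ∈ Ioo 0 T) :
    ∫ r in (0:ℝ)..R, Pf N u r s * vr r t * om N r =
      u R t ^ m * Uf N u R s - ∫ r in (0:ℝ)..R, u r s * u r t ^ m * om N r := by
  have hs' := Ioo_subset_Icc_self hs
  have ht' := Ioo_subset_Icc_self ht
  have h := intervalIntegral.integral_mul_deriv_eq_deriv_mul_of_hasDerivAt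
    (u := fun r => Uf N u r s) (v := fun r => u r t ^ m) (u' := fun r => u r s * om N r)
    (v' := fun r => vr r t) (a := 0) (b := R) ?_ ?_ ?_ ?_ ?_ ?_
  · have e1 : ∫ r in (0:ℝ)..R, Pf N u r s * vr r t * om N r = ∫ r in (0:ℝ)..R, Uf N u r s * vr r t := by
      apply intervalIntegral.integral_congr
      intro r hr
      rw [uIcc_of_le hR] at hr
      simp only
      rw [D.H.Uf_eq hr.1]; ring
    have e2 : ∫ r in (0:ℝ)..R, u r s * u r t ^ m * om N r = ∫ r in (0:ℝ)..R, u r s * om N r * u r t ^ m := by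
      congr 1; funext r; ring
    rw [e1, e2, h]
    have : Uf N u 0 s = 0 := by simp [Uf]
    rw [this]; ring
  · rw [uIcc_of_le hR]
    exact (sl_t D.H.Uf_cont hs').mono Icc_subset_Ici_self
  · rw [uIcc_of_le hR]
    exact (sl_t (F := fun r t => u r t ^ m) D.H.cv ht').mono Icc_subset_Ici_self
  · intro r hr
    rw [min_eq_left hR] at hr
    exact D.H.Uf_dr hr.1 hs'
  · intro r hr
    rw [min_eq_left hR] at hr
    exact D.H.dvr r hr.1 t ht
  · exact D.ii_of hR (sl_t (F := fun r t => u r t * om N r) D.H.cuo hs')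
  · exact D.ii_of hR (sl_t D.H.cvr ht)

lemma YR_deriv {R t : ℝ} (hR : 0 ≤ R) (ht : t ∈ Ioo 0 T) :
    HasDerivAt (fun t => YR N u R t) (2 * (u R t ^ m * Uf N u R t - XR N m u R t)) t := by
  have h := param_deriv (F := fun r t => Pf N u r t ^ 2 * om N r)
    (F' := fun r t => 2 * (Pf N u r t * vr r t * om N r)) hR (c := 0) (d := T) ?_ ?_ ?_ ht
  · rw [intervalIntegral.integral_const_mul, D.ibp1 hR ht ht] at h
    exact h
  · intro t ht
    exact (sl_t (F := fun r t => Pf N u r t ^ 2 * om N r) D.cy (Ioo_subset_Icc_self ht)).mono Icc_subset_Ici_self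
  · exact (continuousOn_const.mul ((D.cPo.mul D.H.cvr).mul (om_c2 N _))).mono
      (prod_mono Icc_subset_Ici_self (le_refl _))
  · intro r hr t ht
    refine (((D.H.Pf_dt hr.1.le ht).pow 2).mul_const (om N r)).congr_deriv ?_
    simp only [Nat.cast_ofNat, Nat.add_one_sub_one, pow_one]
    ring

lemma FR_deriv {R h t : ℝ} (hR : 0 ≤ R) (hh : 0 < h) (ht : t ∈ Ioo 0 (T - h)) :
    ∃ d, d ≤ 4 * C * Real.exp (-(β * R)) ∧
    HasDerivAt (fun t => ∫ r in (0:ℝ)..R, (Pf N u r (t + h) - Pf N u r t) ^ 2 * om N r) d t := by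
  have sub1 : ∀ t ∈ Ioo 0 (T - h), t ∈ Ioo 0 T := fun t ht => ⟨ht.1, by linarith [ht.2]⟩
  have sub2 : ∀ t ∈ Ioo 0 (T - h), t + h ∈ Ioo 0 T := fun t ht =>
    ⟨by linarith [ht.1], by linarith [ht.2]⟩
  have hshift : ∀ {F : ℝ → ℝ → ℝ}, ContinuousOn (fun p : ℝ × ℝ => F p.1 p.2) (Ici 0 ×ˢ Ioo 0 T) →
      ContinuousOn (fun p : ℝ × ℝ => F p.1 (p.2 + h) - F p.1 p.2) (Ici 0 ×ˢ Ioo 0 (T - h)) := by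
    intro F hF
    apply ContinuousOn.sub
    · exact hF.comp (f := fun p : ℝ × ℝ => (p.1, p.2 + h)) (by fun_prop) (fun p hp => ⟨hp.1, sub2 _ hp.2⟩)
    · exact hF.mono (prod_mono (le_refl _) sub1)
  have hP := hshift D.cPo
  have hV := hshift D.H.cvr
  refine ⟨_, ?_, param_deriv (F := fun r t => (Pf N u r (t + h) - Pf N u r t) ^ 2 * om N r)
    (F' := fun r t => 2 * ((Pf N u r (t + h) - Pf N u r t) * (vr r (t + h) - vr r t) * om N r)) hR
    (c := 0) (d := T - h) ?_ ?_ ?_ ht⟩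
  · have t1 := sub1 t ht
    have t2 := sub2 t ht
    have t1' := Ioo_subset_Icc_self t1
    have t2' := Ioo_subset_Icc_self t2
    have iP : ∀ {s t : ℝ}, s ∈ Ioo 0 T → t ∈ Ioo 0 T →
        IntervalIntegrable (fun r => Pf N u r s * vr r t * om N r) volume 0 R := fun hs ht =>
      D.ii_of hR (((sl_t D.cPo hs).mul (sl_t D.H.cvr ht)).mul (om_cont N).continuousOn)
    have iu : ∀ {s t : ℝ}, s ∈ Ioo 0 T → t ∈ Ioo 0 T →
        IntervalIntegrable (fun r => u r s * u r t ^ m * om N r) volume 0 R := fun hs ht =>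
      D.ii_of hR (((sl_t D.H.cu (Ioo_subset_Icc_self hs)).mul
        (sl_t (F := fun r t => u r t ^ m) D.H.cv (Ioo_subset_Icc_self ht))).mul (om_cont N).continuousOn)
    rw [intervalIntegral.integral_const_mul]
    have e1 : ∫ r in (0:ℝ)..R, (Pf N u r (t + h) - Pf N u r t) * (vr r (t + h) - vr r t) * om N r =
        (∫ r in (0:ℝ)..R, Pf N u r (t + h) * vr r (t + h) * om N r)
        + (∫ r in (0:ℝ)..R, Pf N u r t * vr r t * om N r)
        - (∫ r in (0:ℝ)..R, Pf N u r (t + h) * vr r t * om N r)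
        - (∫ r in (0:ℝ)..R, Pf N u r t * vr r (t + h) * om N r) := by
      rw [← intervalIntegral.integral_add (iP t2 t2) (iP t1 t1),
        ← intervalIntegral.integral_sub ((iP t2 t2).add (iP t1 t1)) (iP t2 t1),
        ← intervalIntegral.integral_sub (((iP t2 t2).add (iP t1 t1)).sub (iP t2 t1)) (iP t1 t2)]
      congr 1; funext r; ring
    have e2 : 0 ≤ (∫ r in (0:ℝ)..R, u r (t + h) * u r (t + h) ^ m * om N r)
        + (∫ r in (0:ℝ)..R, u r t * u r t ^ m * om N r)
        - (∫ r in (0:ℝ)..R, u r (t + h) * u r t ^ m * om N r)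
        - (∫ r in (0:ℝ)..R, u r t * u r (t + h) ^ m * om N r) := by
      rw [← intervalIntegral.integral_add (iu t2 t2) (iu t1 t1),
        ← intervalIntegral.integral_sub ((iu t2 t2).add (iu t1 t1)) (iu t2 t1),
        ← intervalIntegral.integral_sub (((iu t2 t2).add (iu t1 t1)).sub (iu t2 t1)) (iu t1 t2)]
      apply intervalIntegral.integral_nonneg hR
      intro r hr
      have e3 : 0 ≤ (u r (t + h) - u r t) * (u r (t + h) ^ m - u r t ^ m) := by
        rcases le_total (u r t) (u r (t + h)) with hle | hle
        · exact mul_nonneg (by linarith) (sub_nonneg.mpr (Real.rpow_le_rpow (D.H.nn r hr.1 t t1') hle D.H.hm0.le))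
        · exact mul_nonneg_of_nonpos_of_nonpos (by linarith)
            (sub_nonpos.mpr (Real.rpow_le_rpow (D.H.nn r hr.1 _ t2') hle D.H.hm0.le))
      have := mul_nonneg e3 (om_nonneg N hr.1)
      linarith [show (u r (t + h) - u r t) * (u r (t + h) ^ m - u r t ^ m) * om N r =
        u r (t + h) * u r (t + h) ^ m * om N r + u r t * u r t ^ m * om N r
        - u r (t + h) * u r t ^ m * om N r - u r t * u r (t + h) ^ m * om N r by ring]
    rw [e1, D.ibp1 hR t2 t2, D.ibp1 hR t1 t1, D.ibp1 hR t2 t1, D.ibp1 hR t1 t2]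
    have b1 := D.bVU R hR _ t1'
    have b2 := D.bVU R hR _ t2'
    have n1 := mul_nonneg (Real.rpow_nonneg (D.H.nn R hR _ t1') m) (D.H.Uf_nonneg hR t2')
    have n2 := mul_nonneg (Real.rpow_nonneg (D.H.nn R hR _ t2') m) (D.H.Uf_nonneg hR t1')
    linarith
  · intro t ht
    exact (((sl_t (F := fun r t => Pf N u r (t + h) - Pf N u r t) hP ht).pow 2).mul
      (om_cont N).continuousOn).mono Icc_subset_Ici_self
  · exact (continuousOn_const.mul ((hP.mul hV).mul (om_c2 N _))).mono
      (prod_mono Icc_subset_Ici_self (le_refl _))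
  · intro r hr t ht
    have d1 : HasDerivAt (fun t => Pf N u r (t + h)) (vr r (t + h)) t :=
      (D.H.Pf_dt hr.1.le (sub2 t ht)).comp_add_const t h
    refine (((d1.sub (D.H.Pf_dt hr.1.le (sub1 t ht))).pow 2).mul_const (om N r)).congr_deriv ?_
    simp only [Nat.cast_ofNat, Nat.add_one_sub_one, pow_one, Pi.sub_apply]
    ring

end Dec
end

section
variable {N : ℕ} {m T : ℝ} {u ut vr vrr : ℝ → ℝ → ℝ} {M C β : ℝ}

namespace Dec
variable (D : Dec N m T u ut vr vrr M C β)
include D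

lemma cvo : ContinuousOn (fun p : ℝ × ℝ => u p.1 p.2 ^ m) (Ici 0 ×ˢ Ioo 0 T) :=
  D.H.cv.mono (prod_mono (le_refl _) Ioo_subset_Icc_self)

lemma cd : ContinuousOn (fun p : ℝ × ℝ => vr p.1 p.2 ^ 2 * om N p.1) (Ici 0 ×ˢ Ioo 0 T) :=
  (D.H.cvr.pow 2).mul (om_c2 N _)

lemma XR_deriv {R t : ℝ} (hR : 0 ≤ R) (ht : t ∈ Ioo 0 T) :
    HasDerivAt (fun t => XR N m u R t)
      ((1 + m) * (om N R * (u R t ^ m * vr R t) - DR N vr R t)) t := by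
  have h := param_deriv (F := fun r t => u r t * u r t ^ m * om N r)
    (F' := fun r t => (1 + m) * (u r t ^ m * (ut r t * om N r))) hR (c := 0) (d := T) ?_ ?_ ?_ ht
  · rw [intervalIntegral.integral_const_mul] at h
    have h2 := intervalIntegral.integral_mul_deriv_eq_deriv_mul_of_hasDerivAt
      (u := fun r => u r t ^ m) (v := fun r => om N r * vr r t) (u' := fun r => vr r t)
      (v' := fun r => ut r t * om N r) (a := 0) (b := R) ?_ ?_ ?_ ?_ ?_ ?_
    · rw [h2] at h
      refine h.congr_deriv ?_
      have e : ∫ r in (0:ℝ)..R, vr r t * (om N r * vr r t) = DR N vr R t := by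
        unfold DR; congr 1; funext r; ring
      rw [e, om_zero D.H.hN]; ring
    · rw [uIcc_of_le hR]
      exact (sl_t (F := fun r t => u r t ^ m) D.cvo ht).mono Icc_subset_Ici_self
    · rw [uIcc_of_le hR]
      exact ((om_cont N).continuousOn.mul (sl_t D.H.cvr ht)).mono Icc_subset_Ici_self
    · intro r hr
      rw [min_eq_left hR] at hr
      exact D.H.dvr r hr.1 t ht
    · intro r hr
      rw [min_eq_left hR] at hr
      exact D.H.flux_dr hr.1 ht
    · exact D.ii_of hR (sl_t D.H.cvr ht)
    · exact D.ii_of hR ((sl_t D.H.cut ht).mul (om_cont N).continuousOn)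
  · intro t ht
    exact (sl_t (F := fun r t => u r t * u r t ^ m * om N r) D.cx (Ioo_subset_Icc_self ht)).mono Icc_subset_Ici_self
  · exact (continuousOn_const.mul (D.cvo.mul (D.H.cut.mul (om_c2 N _)))).mono
      (prod_mono Icc_subset_Ici_self (le_refl _))
  · intro r hr t ht
    have hp := D.H.pos r hr.1.le t ht
    have h1 := D.H.dut r hr.1.le t ht
    refine ((h1.mul (h1.rpow_const (p := m) (Or.inl hp.ne'))).mul_const (om N r)).congr_deriv ?_
    rw [Real.rpow_sub_one hp.ne']
    field_simp

lemma DR_cont {R t1 t2 : ℝ} (hR : 0 ≤ R) (h1 : 0 < t1) (h12 : t1 ≤ t2) (h2 : t2 < T) :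
    ContinuousOn (fun t => DR N vr R t) (Icc t1 t2) :=
  param_cont (F := fun r t => vr r t ^ 2 * om N r) hR h12
    (D.cd.mono (prod_mono Icc_subset_Ici_self (fun t ht => ⟨lt_of_lt_of_le h1 ht.1, lt_of_le_of_lt ht.2 h2⟩)))

lemma XR_diff {R t1 t2 : ℝ} (hR : 0 ≤ R) (h1 : 0 < t1) (h12 : t1 ≤ t2) (h2 : t2 < T) :
    XR N m u R t1 - XR N m u R t2 = (1 + m) * ((∫ t in t1..t2, DR N vr R t)
      - om N R * ∫ t in t1..t2, u R t ^ m * vr R t) := by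
  have hsub : Icc t1 t2 ⊆ Ioo 0 T := fun t ht => ⟨lt_of_lt_of_le h1 ht.1, lt_of_le_of_lt ht.2 h2⟩
  have i1 : IntervalIntegrable (fun t => DR N vr R t) volume t1 t2 := by
    apply ContinuousOn.intervalIntegrable
    rw [uIcc_of_le h12]; exact D.DR_cont hR h1 h12 h2
  have i2 : IntervalIntegrable (fun t => u R t ^ m * vr R t) volume t1 t2 := by
    apply ContinuousOn.intervalIntegrable
    rw [uIcc_of_le h12]
    exact ((sl_r (F := fun r t => u r t ^ m) D.cvo hR).mul (sl_r D.H.cvr hR)).mono hsub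
  have h := intervalIntegral.integral_eq_sub_of_hasDerivAt (f := fun t => XR N m u R t)
    (f' := fun t => (1 + m) * (om N R * (u R t ^ m * vr R t) - DR N vr R t)) (a := t1) (b := t2) ?_ ?_
  · rw [intervalIntegral.integral_const_mul, intervalIntegral.integral_sub (i2.const_mul _) i1,
      intervalIntegral.integral_const_mul] at h
    linarith
  · intro t ht
    rw [uIcc_of_le h12] at ht
    exact D.XR_deriv hR (hsub ht)
  · exact ((i2.const_mul _).sub i1).const_mul _

lemma freq_B {t1 t2 : ℝ} (h1 : 0 < t1) (h12 : t1 ≤ t2) (h2 : t2 < T) :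
    ∃ᶠ R in atTop, ∫ t in t1..t2, u R t ^ m * vr R t ≤ 0 := by
  intro hcon
  have hsub : Icc t1 t2 ⊆ Ioo 0 T := fun t ht => ⟨lt_of_lt_of_le h1 ht.1, lt_of_le_of_lt ht.2 h2⟩
  have hsub' : Icc t1 t2 ⊆ Icc 0 T := hsub.trans Ioo_subset_Icc_self
  simp only [not_le] at hcon
  obtain ⟨R0, hR0⟩ := eventually_atTop.mp hcon
  set R1 := max R0 1 with hR1
  have hR1p : 1 ≤ R1 := le_max_right _ _
  have hR1q : R0 ≤ R1 := le_max_left _ _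
  set V : ℝ → ℝ := fun R => ∫ t in t1..t2, (u R t ^ m) ^ 2 with hV
  have hVd : ∀ R, 0 < R → HasDerivAt V (2 * ∫ t in t1..t2, u R t ^ m * vr R t) R := by
    intro R hR
    rw [← intervalIntegral.integral_const_mul]
    refine param_deriv (F := fun t R => (u R t ^ m) ^ 2) (F' := fun t R => 2 * (u R t ^ m * vr R t))
      h12 (c := 0) (d := R + 1) ?_ ?_ ?_ ⟨hR, by linarith⟩
    · intro r hr
      exact ((sl_r (F := fun r t => u r t ^ m) D.cvo hr.1.le).mono hsub).pow 2
    · have : ContinuousOn (fun p : ℝ × ℝ => 2 * (u p.1 p.2 ^ m * vr p.1 p.2)) (Ici 0 ×ˢ Ioo 0 T) :=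
        continuousOn_const.mul (D.cvo.mul D.H.cvr)
      exact this.comp (f := fun p : ℝ × ℝ => (p.2, p.1)) (by fun_prop)
        (fun p hp => ⟨hp.2.1.le, hsub hp.1⟩)
    · intro t ht r hr
      refine ((D.H.dvr r hr.1 t (hsub ⟨ht.1.le, ht.2⟩)).pow 2).congr_deriv ?_
      simp only [Nat.cast_ofNat, Nat.add_one_sub_one, pow_one]
      ring
  have hmono : StrictMonoOn V (Ici R1) := by
    apply strictMonoOn_of_deriv_pos (convex_Ici R1)
    · intro R hR
      exact (hVd R (by have : R1 ≤ R := hR; linarith)).continuousAt.continuousWithinAt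
    · intro R hR
      rw [interior_Ici] at hR
      have hR' : R1 < R := hR
      rw [(hVd R (by linarith)).deriv]
      have := hR0 R (by linarith)
      linarith
  have hV0 : 0 ≤ V R1 := intervalIntegral.integral_nonneg h12 (fun t _ => sq_nonneg _)
  have hV1 : V R1 < V (R1 + 1) := hmono (mem_Ici.mpr le_rfl) (by simp) (by linarith)
  have hVle : ∀ R, 0 ≤ R → V R ≤ (t2 - t1) * (C * Real.exp (-(β * R))) ^ 2 := by
    intro R hR
    have : V R ≤ ∫ t in t1..t2, (C * Real.exp (-(β * R))) ^ 2 := by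
      apply intervalIntegral.integral_mono_on h12
      · apply ContinuousOn.intervalIntegrable
        rw [uIcc_of_le h12]
        exact ((sl_r (F := fun r t => u r t ^ m) D.cvo hR).mono hsub).pow 2
      · exact intervalIntegrable_const
      · intro t ht
        exact pow_le_pow_left₀ (Real.rpow_nonneg (D.H.nn R hR t (hsub' ht)) m) (D.bv R hR t (hsub' ht)) 2
    rwa [intervalIntegral.integral_const, smul_eq_mul] at this
  have hlim : Tendsto (fun R => (t2 - t1) * (C * Real.exp (-(β * R))) ^ 2) atTop (𝓝 ((t2 - t1) * (C * 0) ^ 2)) := by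
    apply Tendsto.const_mul
    apply Tendsto.pow
    apply Tendsto.const_mul
    apply Real.tendsto_exp_neg_atTop_nhds_zero.comp
    exact tendsto_id.const_mul_atTop D.hβ
  have hlim' : ∀ᶠ R in atTop, (t2 - t1) * (C * Real.exp (-(β * R))) ^ 2 < V (R1 + 1) := by
    apply hlim.eventually_lt_const
    simp; linarith
  obtain ⟨R, hR, hR2⟩ := (hlim'.and (eventually_gt_atTop (R1 + 1))).exists
  have := hVle R (by linarith)
  have := hmono (show R1 + 1 ∈ Ici R1 by simp) (show R ∈ Ici R1 by simp; linarith) hR2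
  linarith

lemma freq_X {t1 t2 : ℝ} (h1 : 0 < t1) (h12 : t1 ≤ t2) (h2 : t2 < T) :
    ∃ᶠ R in atTop, 0 ≤ R ∧ (1 + m) * (∫ t in t1..t2, DR N vr R t) ≤ XR N m u R t1 - XR N m u R t2 := by
  refine ((D.freq_B h1 h12 h2).and_eventually (eventually_ge_atTop 0)).mono ?_
  rintro R ⟨hB, hR⟩
  refine ⟨hR, ?_⟩
  rw [D.XR_diff hR h1 h12 h2]
  apply mul_le_mul_of_nonneg_left _ (by linarith [D.H.hm0])
  have := mul_nonneg (om_nonneg N hR) (neg_nonneg.mpr hB)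
  linarith

lemma DR_nonneg {R t : ℝ} (hR : 0 ≤ R) : 0 ≤ DR N vr R t :=
  intervalIntegral.integral_nonneg hR (fun r hr => mul_nonneg (sq_nonneg _) (om_nonneg N hr.1))

lemma cs_r {R t : ℝ} (hR : 0 ≤ R) (ht : t ∈ Ioo 0 T) :
    (XR N m u R t - u R t ^ m * Uf N u R t) ^ 2 ≤ YR N u R t * DR N vr R t := by
  have h := cs_int (A := fun r => Pf N u r t ^ 2 * om N r) (B := fun r => vr r t ^ 2 * om N r)
    (C := fun r => Pf N u r t * vr r t * om N r) hR
    (D.ii_of hR (sl_t (F := fun r t => Pf N u r t ^ 2 * om N r) D.cy (Ioo_subset_Icc_self ht)))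
    (D.ii_of hR (sl_t (F := fun r t => vr r t ^ 2 * om N r) D.cd ht))
    (D.ii_of hR (((sl_t D.cPo ht).mul (sl_t D.H.cvr ht)).mul (om_cont N).continuousOn)) ?_
  · rw [D.ibp1 hR ht ht] at h
    refine le_trans (le_of_eq ?_) h
    unfold XR; ring
  · intro r hr l
    have := mul_nonneg (sq_nonneg (Pf N u r t * l + vr r t)) (om_nonneg N hr.1)
    linarith [show (Pf N u r t * l + vr r t) ^ 2 * om N r = Pf N u r t ^ 2 * om N r * (l * l) +
      2 * (Pf N u r t * vr r t * om N r) * l + vr r t ^ 2 * om N r by ring]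

lemma time_cs {R h t : ℝ} (hR : 0 ≤ R) (hh : 0 ≤ h) (ht : 0 < t) (hth : t + h < T) :
    ∫ r in (0:ℝ)..R, (Pf N u r (t + h) - Pf N u r t) ^ 2 * om N r ≤ h * ∫ s in t..t + h, DR N vr R s := by
  have hle : t ≤ t + h := by linarith
  have hsub : Icc t (t + h) ⊆ Ioo 0 T := fun s hs => ⟨lt_of_lt_of_le ht hs.1, lt_of_le_of_lt hs.2 hth⟩
  have hcd : ContinuousOn (fun p : ℝ × ℝ => vr p.1 p.2 ^ 2 * om N p.1) (Icc 0 R ×ˢ Icc t (t + h)) :=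
    D.cd.mono (prod_mono Icc_subset_Ici_self hsub)
  have hsw := param_swap (F := fun r t => vr r t ^ 2 * om N r) hR hle hcd
  have e : ∫ s in t..t + h, DR N vr R s = ∫ r in (0:ℝ)..R, ∫ s in t..t + h, vr r s ^ 2 * om N r := hsw.symm
  rw [e, ← intervalIntegral.integral_const_mul]
  apply intervalIntegral.integral_mono_on hR
  · apply D.ii_of hR
    have a1 := sl_t D.cPo (hsub ⟨le_rfl, hle⟩)
    have a2 := sl_t D.cPo (hsub ⟨hle, le_rfl⟩)
    exact ((a2.sub a1).pow 2).mul (om_cont N).continuousOn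
  · apply ContinuousOn.intervalIntegrable
    rw [uIcc_of_le hR]
    apply continuousOn_const.mul
    exact param_cont (F := fun s r => vr r s ^ 2 * om N r) hle hR
      (hcd.comp (f := fun p : ℝ × ℝ => (p.2, p.1)) (by fun_prop) (fun p hp => ⟨hp.2, hp.1⟩))
  · intro r hr
    have hvc : ContinuousOn (fun s => vr r s) (Icc t (t + h)) := (sl_r D.H.cvr hr.1).mono hsub
    have hvi : IntervalIntegrable (fun s => vr r s) volume t (t + h) := by
      apply ContinuousOn.intervalIntegrable; rwa [uIcc_of_le hle]
    have hv2 : IntervalIntegrable (fun s => vr r s ^ 2) volume t (t + h) := by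
      apply ContinuousOn.intervalIntegrable; rw [uIcc_of_le hle]; exact hvc.pow 2
    have h1 : Pf N u r (t + h) - Pf N u r t = ∫ s in t..t + h, vr r s := by
      symm
      apply intervalIntegral.integral_eq_sub_of_hasDerivAt
      · intro s hs
        rw [uIcc_of_le hle] at hs
        exact D.H.Pf_dt hr.1 (hsub hs)
      · exact hvi
    have h2 := cs_int (A := fun _ => 1) (B := fun s => vr r s ^ 2) (C := fun s => vr r s) hle
      intervalIntegrable_const hv2 hvi (fun s _ l => by nlinarith [sq_nonneg (l + vr r s)])
    rw [intervalIntegral.integral_const, smul_eq_mul, mul_one, add_sub_cancel_left] at h2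
    rw [h1, intervalIntegral.integral_mul_const, ← mul_assoc]
    exact mul_le_mul_of_nonneg_right h2 (om_nonneg N hr.1)

end Dec
end


section
variable {N : ℕ} {m T : ℝ} {u ut vr vrr : ℝ → ℝ → ℝ} {M C β : ℝ}

namespace Dec
variable (D : Dec N m T u ut vr vrr M C β)
include D

lemma X_pos {t : ℝ} (ht : t ∈ Ioo 0 T) : 0 < Xf N m u t := by
  have ht' := Ioo_subset_Icc_self ht
  refine lt_of_lt_of_le ?_ ((D.X_tail ht').2.2 1 zero_le_one).1
  refine intervalIntegral.intervalIntegral_pos_of_pos_on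
    (D.ii_of zero_le_one (sl_t (F := fun r t => u r t * u r t ^ m * om N r) D.cx ht')) ?_ one_pos
  intro r hr
  have h1 := D.H.pos r hr.1.le t ht
  have h2 := om_pos N hr.1
  positivity

lemma Y_pos {t : ℝ} (ht : t ∈ Ioo 0 T) : 0 < Yf N u t := by
  have ht' := Ioo_subset_Icc_self ht
  refine lt_of_lt_of_le ?_ ((D.Y_tail ht').2.2 1 zero_le_one).1
  refine intervalIntegral.intervalIntegral_pos_of_pos_on
    (D.ii_of zero_le_one (sl_t (F := fun r t => Pf N u r t ^ 2 * om N r) D.cy ht')) ?_ one_pos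
  intro r hr
  have h2 := om_pos N hr.1
  have h3 : 0 < Uf N u r t := by
    refine intervalIntegral.intervalIntegral_pos_of_pos_on
      (D.ii_of hr.1.le (sl_t (F := fun r t => u r t * om N r) D.H.cuo ht')) ?_ hr.1
    intro s hs
    exact mul_pos (D.H.pos s hs.1.le t ht) (om_pos N hs.1)
  have h4 : 0 < Pf N u r t := div_pos h3 h2
  positivity

lemma DR_int_nonneg {R t1 t2 : ℝ} (hR : 0 ≤ R) (h12 : t1 ≤ t2) : 0 ≤ ∫ t in t1..t2, DR N vr R t :=
  intervalIntegral.integral_nonneg h12 (fun _ _ => D.DR_nonneg hR)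

lemma X_anti {t1 t2 : ℝ} (h1 : 0 < t1) (h12 : t1 ≤ t2) (h2 : t2 < T) :
    Xf N m u t2 ≤ Xf N m u t1 := by
  refine le_of_tendsto_of_tendsto_of_frequently
    (D.X_tail ⟨(h1.trans_le h12).le, h2.le⟩).2.1 (D.X_tail ⟨h1.le, (h12.trans_lt h2).le⟩).2.1 ?_
  refine (D.freq_X h1 h12 h2).mono ?_
  rintro R ⟨hR, h⟩
  have := mul_nonneg (by linarith [D.H.hm0] : 0 ≤ 1 + m) (D.DR_int_nonneg hR h12)
  linarith

lemma exp_lim (c : ℝ) : Tendsto (fun R => c * Real.exp (-(β * R))) atTop (𝓝 0) := by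
  have h : Tendsto (fun R => Real.exp (-(β * R))) atTop (𝓝 0) := by
    apply Real.tendsto_exp_atBot.comp
    exact tendsto_neg_atTop_atBot.comp (tendsto_id.const_mul_atTop D.hβ)
  simpa using h.const_mul c

lemma vU_nn {R t : ℝ} (hR : 0 ≤ R) (ht : t ∈ Icc 0 T) : 0 ≤ u R t ^ m * Uf N u R t :=
  mul_nonneg (Real.rpow_nonneg (D.H.nn R hR t ht) _) (D.H.Uf_nonneg hR ht)

lemma Y_mvt {t1 t2 R : ℝ} (h1 : 0 < t1) (h12 : t1 ≤ t2) (h2 : t2 < T) (hR : 0 ≤ R) :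
    YR N u R t1 - YR N u R t2 ≤ 2 * (t2 - t1) * Xf N m u t1 ∧
    YR N u R t2 ≤ YR N u R t1 + 2 * (t2 - t1) * C * Real.exp (-(β * R)) := by
  rcases h12.eq_or_lt with rfl | hlt
  · simp
  have hsub : ∀ t ∈ Icc t1 t2, t ∈ Ioo 0 T := fun t ht => ⟨h1.trans_le ht.1, ht.2.trans_lt h2⟩
  obtain ⟨ξ, hξ, he⟩ := exists_hasDerivAt_eq_slope (fun t => YR N u R t) _ hlt
    (fun t ht => (D.YR_deriv hR (hsub t ht)).continuousAt.continuousWithinAt)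
    (fun t ht => D.YR_deriv hR (hsub t (Ioo_subset_Icc_self ht)))
  have hξ' := hsub ξ (Ioo_subset_Icc_self hξ)
  have hξ'' := Ioo_subset_Icc_self hξ'
  rw [eq_div_iff (by linarith)] at he
  have a1 := D.vU_nn hR hξ''
  have a2 := D.bVU R hR ξ hξ''
  have a3 := ((D.X_tail hξ'').2.2 R hR).1
  have a4 := D.X_anti h1 hξ.1.le (hξ.2.trans h2)
  have a5 : 0 ≤ XR N m u R ξ := intervalIntegral.integral_nonneg hR (fun r hr => D.x_nn hr.1 hξ'')
  have hd : 0 < t2 - t1 := by linarith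
  constructor
  · nlinarith
  · nlinarith

lemma Y_anti {t1 t2 : ℝ} (h1 : 0 < t1) (h12 : t1 ≤ t2) (h2 : t2 < T) :
    Yf N u t2 ≤ Yf N u t1 := by
  refine le_of_tendsto_of_tendsto (D.Y_tail ⟨(h1.trans_le h12).le, h2.le⟩).2.1
    (g := fun R => YR N u R t1 + 2 * (t2 - t1) * C * Real.exp (-(β * R))) ?_ ?_
  · simpa using (D.Y_tail ⟨h1.le, (h12.trans_lt h2).le⟩).2.1.add (D.exp_lim (2 * (t2 - t1) * C))
  · filter_upwards [eventually_ge_atTop 0] with R hR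
    exact (D.Y_mvt h1 h12 h2 hR).2

lemma Y_lip {t1 t2 : ℝ} (h1 : 0 < t1) (h12 : t1 ≤ t2) (h2 : t2 < T) :
    Yf N u t1 - Yf N u t2 ≤ 2 * (t2 - t1) * Xf N m u t1 := by
  refine le_of_tendsto ((D.Y_tail ⟨h1.le, (h12.trans_lt h2).le⟩).2.1.sub
    (D.Y_tail ⟨(h1.trans_le h12).le, h2.le⟩).2.1) ?_
  filter_upwards [eventually_ge_atTop 0] with R hR
  exact (D.Y_mvt h1 h12 h2 hR).1

lemma X_drop {t1 t2 : ℝ} (h1 : 0 < t1) (h12 : t1 ≤ t2) (h2 : t2 < T) :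
    (1 + m) * (t2 - t1) * (Xf N m u t2 ^ 2 / Yf N u t1) ≤ Xf N m u t1 - Xf N m u t2 := by
  have hm0 := D.H.hm0
  have hsub : ∀ t ∈ Icc t1 t2, t ∈ Ioo 0 T := fun t ht => ⟨h1.trans_le ht.1, ht.2.trans_lt h2⟩
  have ht1 := hsub t1 ⟨le_rfl, h12⟩
  have ht2 := hsub t2 ⟨h12, le_rfl⟩
  have hY := D.Y_pos ht1
  have hX := D.X_pos ht2
  set c := C / β + C with hc
  refine le_of_tendsto_of_tendsto_of_frequently
    (f := fun R => (1 + m) * (t2 - t1) * ((Xf N m u t2 - c * Real.exp (-(β * R))) ^ 2 / Yf N u t1))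
    (g := fun R => XR N m u R t1 - XR N m u R t2) (b := atTop) ?_ ?_ ?_
  · have h := ((tendsto_const_nhds (x := Xf N m u t2)).sub (D.exp_lim c))
    rw [sub_zero] at h
    exact ((h.pow 2).div_const _).const_mul _
  · exact (D.X_tail (Ioo_subset_Icc_self ht1)).2.1.sub (D.X_tail (Ioo_subset_Icc_self ht2)).2.1
  · have hev : ∀ᶠ R in atTop, c * Real.exp (-(β * R)) ≤ Xf N m u t2 :=
      (D.exp_lim c).eventually_le_const hX
    refine ((D.freq_X h1 h12 h2).and_eventually hev).mono ?_
    rintro R ⟨⟨hR, h⟩, hE⟩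
    refine le_trans ?_ h
    rw [mul_assoc]
    refine mul_le_mul_of_nonneg_left ?_ (by linarith)
    set k := (Xf N m u t2 - c * Real.exp (-(β * R))) ^ 2 / Yf N u t1 with hk
    have : ∫ t in t1..t2, k ≤ ∫ t in t1..t2, DR N vr R t := by
      apply intervalIntegral.integral_mono_on h12 (by simp)
      · apply ContinuousOn.intervalIntegrable
        rw [uIcc_of_le h12]; exact D.DR_cont hR h1 h12 h2
      · intro s hs
        have hs' := hsub s hs
        have hs'' := Ioo_subset_Icc_self hs'
        have b1 := D.cs_r hR hs'
        have b2 := ((D.Y_tail hs'').2.2 R hR).1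
        have b3 := D.Y_anti h1 hs.1 hs'.2
        have b4 := ((D.X_tail hs'').2.2 R hR).2
        have b5 := D.X_anti hs'.1 hs.2 h2
        have b6 := D.bVU R hR s hs''
        have b7 : Xf N m u t2 - c * Real.exp (-(β * R)) ≤ XR N m u R s - u R s ^ m * Uf N u R s := by
          rw [hc]; linarith
        rw [hk, div_le_iff₀ hY]
        have b8 := pow_le_pow_left₀ (by linarith : 0 ≤ Xf N m u t2 - c * Real.exp (-(β * R))) b7 2
        have b9 := mul_le_mul_of_nonneg_right (b2.trans b3) (D.DR_nonneg hR (t := s))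
        linarith
    simpa using this

lemma Y_lim : Tendsto (Yf N u) (𝓝[<] T) (𝓝 0) := by
  have hT := D.H.hT
  have e0 : Yf N u T = 0 := by
    unfold Yf
    rw [setIntegral_eq_zero_of_forall_eq_zero]
    intro r hr
    have hU : Uf N u r T = 0 := by
      unfold Uf
      rw [intervalIntegral.integral_congr (g := fun _ => (0:ℝ))]
      · simp
      · intro s hs
        rw [uIcc_of_le (le_of_lt hr)] at hs
        simp only
        rw [D.H.ext s hs.1, zero_mul]
    simp [Pf, hU]
  rw [← e0]
  have hcW : ContinuousWithinAt (Yf N u) (Icc 0 T) T := by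
    unfold Yf
    refine continuousWithinAt_of_dominated (bound := fun r => C * Real.exp (-β * r)) ?_ ?_ ?_ ?_
    · filter_upwards [self_mem_nhdsWithin] with t ht
      exact (D.Y_tail ht).1.aestronglyMeasurable
    · filter_upwards [self_mem_nhdsWithin] with t ht
      rw [ae_restrict_iff' measurableSet_Ioi]
      filter_upwards with r hr
      rw [Real.norm_of_nonneg (D.y_nn (le_of_lt hr)), show -β * r = -(β * r) by ring]
      exact D.bY r (le_of_lt hr) t ht
    · exact (integrableOn_exp_mul_Ioi (by linarith [D.hβ] : -β < 0) 0).const_mul C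
    · rw [ae_restrict_iff' measurableSet_Ioi]
      filter_upwards with r hr
      exact (sl_r (F := fun r t => Pf N u r t ^ 2 * om N r) D.cy (mem_Ici.mpr (le_of_lt hr))) T ⟨hT.le, le_rfl⟩
  refine hcW.tendsto.mono_left ?_
  rw [← nhdsWithin_Ioo_eq_nhdsLT hT]
  exact nhdsWithin_mono _ Ioo_subset_Icc_self

lemma X_bound : ∃ K > 0, ∀ t ∈ Ico (T / 2) T, Xf N m u t ≤ K * (T - t) ^ ((1 + m) / (1 - m)) := by
  have hT := D.H.hT
  have h2 : 0 < T / 2 := by linarith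
  refine ode_part (Y := Yf N u) D.H.hm0 D.H.hm1 (fun t ht => D.X_pos ⟨h2.trans_le ht.1, ht.2⟩)
    (fun t ht => D.Y_pos ⟨h2.trans_le ht.1, ht.2⟩)
    (fun t1 t2 a b c => D.X_anti (h2.trans_le a) b c)
    (fun t1 t2 a b c => D.Y_lip (h2.trans_le a) b c)
    (fun t1 t2 a b c => D.Y_anti (h2.trans_le a) b c)
    (fun t1 t2 a b c => D.X_drop (h2.trans_le a) b c) D.Y_lim (by linarith)

end Dec
end


noncomputable def FR (N : ℕ) (u : ℝ → ℝ → ℝ) (h R t : ℝ) : ℝ :=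
  ∫ r in (0:ℝ)..R, (Pf N u r (t + h) - Pf N u r t) ^ 2 * om N r

section
variable {N : ℕ} {m T : ℝ} {u ut vr vrr : ℝ → ℝ → ℝ} {M C β : ℝ}

namespace Dec
variable (D : Dec N m T u ut vr vrr M C β)
include D

lemma FR_mvt {h R t b : ℝ} (hR : 0 ≤ R) (hh : 0 < h) (ht : 0 < t) (htb : t ≤ b) (hb : b + h < T) :
    FR N u h R b ≤ FR N u h R t + 4 * C * Real.exp (-(β * R)) * (b - t) := by
  have hd : ∀ s ∈ Icc t b, ∃ d ≤ 4 * C * Real.exp (-(β * R)), HasDerivAt (FR N u h R) d s := by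
    intro s hs
    exact D.FR_deriv hR hh (t := s) ⟨ht.trans_le hs.1, by linarith [hs.2]⟩
  have := Convex.image_sub_le_mul_sub_of_deriv_le (convex_Icc t b) (f := FR N u h R)
    (C := 4 * C * Real.exp (-(β * R)))
    (fun s hs => by obtain ⟨d, _, h2⟩ := hd s hs; exact h2.continuousAt.continuousWithinAt)
    (fun s hs => by
      obtain ⟨d, _, h2⟩ := hd s (interior_subset hs)
      exact h2.differentiableAt.differentiableWithinAt)
    (fun s hs => by obtain ⟨d, h1, h2⟩ := hd s (interior_subset hs); rw [h2.deriv]; exact h1)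
    t ⟨le_rfl, htb⟩ b ⟨htb, le_rfl⟩ htb
  linarith

lemma cF {h t : ℝ} (h1 : t ∈ Icc 0 T) (h2 : t + h ∈ Icc 0 T) :
    ContinuousOn (fun r => (Pf N u r (t + h) - Pf N u r t) ^ 2 * om N r) (Ici 0) :=
  (((sl_t D.cP h2).sub (sl_t D.cP h1)).pow 2).mul (om_cont N).continuousOn

lemma FR_bound {a b h R0 : ℝ} {n : ℕ} (hn : 0 < n) (ha : 0 < a) (hab : a < b)
    (hh : h = (b - a) / n) (hb : b + h < T) (hR0 : 0 ≤ R0) :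
    FR N u h R0 b ≤ h ^ 2 * (Xf N m u a / ((1 + m) * (b - a))) := by
  have hm0 := D.H.hm0
  have hn' : (0:ℝ) < n := by exact_mod_cast hn
  have hh0 : 0 < h := by rw [hh]; exact div_pos (by linarith) hn'
  have hnh : n * h = b - a := by rw [hh]; field_simp
  have hbT : b < T := by linarith
  have hb0 : 0 < b := ha.trans hab
  have key : ∀ R, R0 ≤ R → (1 + m) * (∫ t in a..b, DR N vr R t) ≤ XR N m u R a - XR N m u R b →
      FR N u h R0 b ≤ h ^ 2 * (Xf N m u a / ((1 + m) * (b - a))) + 4 * C * T * Real.exp (-(β * R)) := by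
    intro R hRR hX
    have hR : 0 ≤ R := hR0.trans hRR
    have hmono : FR N u h R0 b ≤ FR N u h R b := by
      have hc := D.cF (h := h) (t := b) ⟨hb0.le, hbT.le⟩ ⟨by linarith, hb.le⟩
      apply intervalIntegral.integral_mono_interval le_rfl hR0 hRR _ (D.ii_of hR hc)
      rw [EventuallyLE, ae_restrict_iff' measurableSet_Ioc]
      filter_upwards with r hr
      exact mul_nonneg (sq_nonneg _) (om_nonneg N hr.1.le)
    have hti : ∀ i ∈ Finset.range n, FR N u h R b ≤
        h * (∫ s in (a + (i:ℕ) * h)..(a + ((i + 1 : ℕ):ℝ) * h), DR N vr R s) + 4 * C * T * Real.exp (-(β * R)) := by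
      intro i hi
      have hi' : ((i:ℝ) + 1) ≤ n := by exact_mod_cast Finset.mem_range.mp hi
      have i0 : (0:ℝ) ≤ i := Nat.cast_nonneg i
      have h0 : 0 < a + i * h := by positivity
      have h1 : a + i * h + h ≤ b := by nlinarith
      have e1 := D.FR_mvt hR hh0 h0 (by linarith) hb
      have e2 := D.time_cs hR hh0.le h0 (by linarith)
      have e3 : a + ((i + 1 : ℕ):ℝ) * h = a + i * h + h := by push_cast; ring
      rw [e3]
      have e4 : 4 * C * Real.exp (-(β * R)) * (b - (a + i * h)) ≤ 4 * C * Real.exp (-(β * R)) * T := by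
        apply mul_le_mul_of_nonneg_left (by linarith)
        have := D.hC
        positivity
      unfold FR at e1 ⊢
      linarith
    have hs := Finset.sum_le_sum hti
    rw [Finset.sum_const, Finset.card_range, nsmul_eq_mul, Finset.sum_add_distrib, ← Finset.mul_sum,
      intervalIntegral.sum_integral_adjacent_intervals (a := fun k : ℕ => a + (k:ℝ) * h), Finset.sum_const,
      Finset.card_range, nsmul_eq_mul] at hs
    · simp only [Nat.cast_zero, zero_mul, add_zero] at hs
      rw [hnh, show a + (b - a) = b by ring] at hs
      have f1 := ((D.X_tail (t := a) ⟨ha.le, by linarith⟩).2.2 R hR).1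
      have f2 : 0 ≤ XR N m u R b :=
        intervalIntegral.integral_nonneg hR (fun r hr => D.x_nn hr.1 ⟨hb0.le, hbT.le⟩)
      have f3 : (∫ t in a..b, DR N vr R t) ≤ Xf N m u a / (1 + m) := by
        rw [le_div_iff₀ (by linarith)]; linarith
      have f4 := mul_le_mul_of_nonneg_left f3 hh0.le
      have f5 : (n:ℝ) * FR N u h R b ≤ n * (h ^ 2 * (Xf N m u a / ((1 + m) * (b - a)))
          + 4 * C * T * Real.exp (-(β * R))) := by
        have : (n:ℝ) * (h ^ 2 * (Xf N m u a / ((1 + m) * (b - a)))) = h * (Xf N m u a / (1 + m)) := by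
          rw [← hnh]; field_simp
        rw [mul_add, this]
        linarith
      exact hmono.trans (le_of_mul_le_mul_left f5 hn')
    · intro k hk
      have hk' : ((k:ℝ) + 1) ≤ n := by exact_mod_cast hk
      have i0 : (0:ℝ) ≤ k := Nat.cast_nonneg k
      have h0 : 0 < a + k * h := by positivity
      have h1 : a + k * h + h ≤ b := by nlinarith
      have e3 : a + ((k + 1 : ℕ):ℝ) * h = a + k * h + h := by push_cast; ring
      rw [e3]
      apply ContinuousOn.intervalIntegrable
      rw [uIcc_of_le (by linarith)]
      exact D.DR_cont hR h0 (by linarith) (by linarith)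
  have hlim := (tendsto_const_nhds (x := h ^ 2 * (Xf N m u a / ((1 + m) * (b - a))))).add (D.exp_lim (4 * C * T))
  rw [add_zero] at hlim
  refine le_of_tendsto_of_tendsto_of_frequently tendsto_const_nhds hlim ?_
  refine ((D.freq_X ha hab.le hbT).and_eventually (eventually_ge_atTop R0)).mono ?_
  rintro R ⟨⟨_, h1⟩, h2⟩
  exact key R h2 h1

lemma DR_bound {a b R0 : ℝ} (ha : 0 < a) (hab : a < b) (hb : b < T) (hR0 : 0 ≤ R0) :
    DR N vr R0 b ≤ Xf N m u a / ((1 + m) * (b - a)) := by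
  have hb0 : 0 < b := ha.trans hab
  set hh : ℕ → ℝ := fun n => (b - a) / ((n + 1 : ℕ) : ℝ) with hhd
  have hpos : ∀ n, 0 < hh n := fun n => div_pos (by linarith) (by positivity)
  have hlim : Tendsto hh atTop (𝓝 0) := by
    have := (tendsto_const_div_atTop_nhds_zero_nat (b - a)).comp (tendsto_add_atTop_nat 1)
    exact this
  set c := (b + T) / 2 with hc
  have hbc : b < c := by rw [hc]; linarith
  have hcT : c < T := by rw [hc]; linarith
  have hev : ∀ᶠ n in atTop, hh n < c - b := hlim.eventually_lt_const (by linarith)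
  have hsub : Icc b c ⊆ Ioo 0 T := fun s hs => ⟨hb0.trans_le hs.1, hs.2.trans_lt hcT⟩
  obtain ⟨B, hB⟩ := (isCompact_Icc.prod isCompact_Icc).exists_bound_of_continuousOn
    (D.H.cvr.mono (prod_mono (Icc_subset_Ici_self : Icc 0 R0 ⊆ Ici 0) hsub))
  have hB0 : 0 ≤ B := (norm_nonneg _).trans (hB (0, b) ⟨⟨le_rfl, hR0⟩, ⟨le_rfl, hbc.le⟩⟩)
  have hT : Tendsto (fun n => ∫ r in (0:ℝ)..R0, ((Pf N u r (b + hh n) - Pf N u r b) / hh n) ^ 2 * om N r) atTop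
      (𝓝 (DR N vr R0 b)) := by
    unfold DR
    apply intervalIntegral.tendsto_integral_filter_of_dominated_convergence (fun r => B ^ 2 * om N r)
    · filter_upwards [hev] with n hn
      apply ContinuousOn.aestronglyMeasurable _ measurableSet_uIoc
      rw [uIoc_of_le hR0]
      refine ContinuousOn.mono (s := Ici 0) ?_ (fun r hr => hr.1.le)
      have hp := hpos n
      exact ((((sl_t D.cP ⟨by linarith, by linarith⟩).sub (sl_t D.cP ⟨hb0.le, hb.le⟩)).div_const _).pow 2).mul
        (om_cont N).continuousOn
    · filter_upwards [hev] with n hn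
      filter_upwards with r hr
      rw [uIoc_of_le hR0] at hr
      have ho := om_nonneg N hr.1.le
      rw [Real.norm_of_nonneg (mul_nonneg (sq_nonneg _) ho)]
      apply mul_le_mul_of_nonneg_right _ ho
      apply sq_le_sq'
      all_goals
        have hp := hpos n
        have := Convex.norm_image_sub_le_of_norm_hasDerivWithin_le (f := fun t => Pf N u r t)
          (f' := fun t => vr r t) (s := Icc b c) (C := B)
          (fun t ht => (D.H.Pf_dt hr.1.le (hsub ht)).hasDerivWithinAt)
          (fun t ht => hB (r, t) ⟨⟨hr.1.le, hr.2⟩, ht⟩) (convex_Icc b c)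
          (x := b) (y := b + hh n) ⟨le_rfl, hbc.le⟩ ⟨by linarith, by linarith⟩
        rw [show b + hh n - b = hh n by ring, Real.norm_eq_abs, Real.norm_eq_abs, abs_of_pos hp] at this
        have h2 := abs_le.mp this
      · rw [le_div_iff₀ hp]; linarith
      · rw [div_le_iff₀ hp]; linarith
    · exact (continuous_const.mul (om_cont N)).intervalIntegrable _ _
    · filter_upwards with r hr
      rw [uIoc_of_le hR0] at hr
      apply Tendsto.mul_const
      apply Tendsto.pow
      have hd := (D.H.Pf_dt hr.1.le (t := b) ⟨hb0, hb⟩).tendsto_slope_zero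
      have h2 : Tendsto hh atTop (𝓝[≠] 0) := tendsto_nhdsWithin_iff.mpr
        ⟨hlim, Eventually.of_forall (fun n => (hpos n).ne')⟩
      refine (hd.comp h2).congr (fun n => ?_)
      simp only [Function.comp, smul_eq_mul]
      field_simp
  refine le_of_tendsto hT ?_
  filter_upwards [hev] with n hn
  have hp := hpos n
  have h1 := D.FR_bound (n := n + 1) (h := hh n) (Nat.succ_pos n) ha hab rfl (by linarith) hR0
  have e : ∫ r in (0:ℝ)..R0, ((Pf N u r (b + hh n) - Pf N u r b) / hh n) ^ 2 * om N r
      = FR N u (hh n) R0 b / hh n ^ 2 := by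
    unfold FR
    rw [← intervalIntegral.integral_div]
    congr 1; funext r; rw [div_pow]; ring
  rw [e, div_le_iff₀ (by positivity)]
  linarith

lemma DR_bound2 : ∃ K > 0, ∀ t ∈ Ico (3 * T / 4) T, ∀ R, 0 ≤ R →
    DR N vr R t ≤ K * (T - t) ^ (2 * m / (1 - m)) := by
  obtain ⟨K, hK, h⟩ := D.X_bound
  have hm0 := D.H.hm0
  have hm1 := D.H.hm1
  have hT := D.H.hT
  refine ⟨K * 2 ^ ((1 + m) / (1 - m)) / (1 + m), by positivity, fun t ht R hR => ?_⟩
  have h1 : 0 < T - t := by linarith [ht.2]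
  have hb := D.DR_bound (a := 2 * t - T) (b := t) (by linarith [ht.1]) (by linarith) ht.2 hR
  refine hb.trans ?_
  have hx := h (2 * t - T) ⟨by linarith [ht.1], by linarith⟩
  rw [show T - (2 * t - T) = 2 * (T - t) by ring, Real.mul_rpow (by norm_num) h1.le] at hx
  rw [show t - (2 * t - T) = T - t by ring, div_le_iff₀ (by positivity)]
  refine hx.trans (le_of_eq ?_)
  have e : (T - t) ^ ((1 + m) / (1 - m)) = (T - t) ^ (2 * m / (1 - m)) * (T - t) := by
    rw [← Real.rpow_add_one h1.ne']
    congr 1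
    have : 1 - m ≠ 0 := by linarith
    field_simp; ring
  rw [e]; field_simp

end Dec
end


section
variable {N : ℕ} {m T : ℝ} {u ut vr vrr : ℝ → ℝ → ℝ} {M C β : ℝ}

lemma G_near (hN : 2 ≤ N) {r R : ℝ} (hr : 0 < r) (hr1 : r ≤ 1) (hR : 1 ≤ R) :
    ∫ s in r..R, (om N s)⁻¹ ≤ 4 ^ (N - 1) + (r ^ (N - 2))⁻¹ * Real.log (1 / r) := by
  have hN2 : (2:ℝ) ≤ N := by exact_mod_cast hN
  rw [← intervalIntegral.integral_add_adjacent_intervals (inv_om_ii N hr hr1) (inv_om_ii N one_pos hR)]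
  have h1 := G_tail hN le_rfl hR
  have h2 : 4 ^ (N - 1) * Real.exp (-(((N:ℝ) - 1) * 1)) ≤ 4 ^ (N - 1) * 1 := by
    apply mul_le_mul_of_nonneg_left _ (by positivity)
    rw [Real.exp_le_one_iff]; linarith
  have h3 : ∫ s in r..1, (om N s)⁻¹ ≤ ∫ s in r..1, (r ^ (N - 2))⁻¹ * s⁻¹ := by
    have hi : IntervalIntegrable (fun s : ℝ => (r ^ (N - 2))⁻¹ * s⁻¹) volume r 1 := by
      apply ContinuousOn.intervalIntegrable
      rw [uIcc_of_le hr1]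
      exact continuousOn_const.mul (continuousOn_id.inv₀ (fun s hs => (hr.trans_le hs.1).ne'))
    apply intervalIntegral.integral_mono_on hr1 (inv_om_ii N hr hr1) hi
    intro s hs
    have hs0 : 0 < s := hr.trans_le hs.1
    rw [← mul_inv]
    apply inv_anti₀ (by positivity)
    have e : N - 1 = (N - 2) + 1 := by omega
    have hsi : s ≤ Real.sinh s := Real.self_le_sinh_iff.mpr hs0.le
    unfold om
    rw [e, pow_succ]
    apply mul_le_mul _ hsi hs0.le (by positivity)
    exact pow_le_pow_left₀ hr.le (hs.1.trans hsi) _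
  rw [intervalIntegral.integral_const_mul, integral_inv_of_pos hr one_pos] at h3
  linarith

namespace Dec
variable (D : Dec N m T u ut vr vrr M C β)
include D

lemma ptwise : ∃ K > 0, ∀ t ∈ Ico (3 * T / 4) T, ∀ r, 0 < r → ∀ g, 0 ≤ g →
    (∀ᶠ R in atTop, ∫ s in r..R, (om N s)⁻¹ ≤ g) →
    u r t ^ m ≤ K * (T - t) ^ (m / (1 - m)) * Real.sqrt g := by
  obtain ⟨K, hK, h⟩ := D.DR_bound2
  have hT := D.H.hT
  refine ⟨Real.sqrt K, Real.sqrt_pos.mpr hK, fun t ht r hr g hg hev => ?_⟩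
  have ht' : t ∈ Ioo 0 T := ⟨by linarith [ht.1], ht.2⟩
  have hTt : 0 < T - t := by linarith [ht.2]
  set B := Real.sqrt K * (T - t) ^ (m / (1 - m)) * Real.sqrt g with hB
  have hB0 : 0 ≤ B := by positivity
  have hB2 : B ^ 2 = K * (T - t) ^ (2 * m / (1 - m)) * g := by
    rw [hB, mul_pow, mul_pow, Real.sq_sqrt hK.le, Real.sq_sqrt hg, ← Real.rpow_natCast ((T - t) ^ _),
      ← Real.rpow_mul hTt.le]
    congr 3; push_cast; ring
  have hlim := (tendsto_const_nhds (x := B)).add (D.exp_lim C)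
  rw [add_zero] at hlim
  refine ge_of_tendsto hlim ?_
  filter_upwards [hev, eventually_ge_atTop r] with R hg' hR
  have hR0 : 0 < R := hr.trans_le hR
  have hc : ContinuousOn (fun s => vr s t) (Ici 0) := sl_t D.H.cvr ht'
  have hsub : Icc r R ⊆ Ici 0 := fun s hs => hr.le.trans hs.1
  have iv : IntervalIntegrable (fun s => vr s t) volume r R := by
    apply ContinuousOn.intervalIntegrable; rw [uIcc_of_le hR]; exact hc.mono hsub
  have hcd := sl_t (F := fun r t => vr r t ^ 2 * om N r) D.cd ht'
  have id : IntervalIntegrable (fun s => vr s t ^ 2 * om N s) volume r R := by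
    apply ContinuousOn.intervalIntegrable; rw [uIcc_of_le hR]; exact hcd.mono hsub
  have hftc : ∫ s in r..R, vr s t = u R t ^ m - u r t ^ m := by
    apply intervalIntegral.integral_eq_sub_of_hasDerivAt _ iv
    intro s hs
    rw [uIcc_of_le hR] at hs
    exact D.H.dvr s (hr.trans_le hs.1) t ht'
  have hcs := cs_int hR id (inv_om_ii N hr hR) iv ?_
  · have h1 : ∫ s in r..R, vr s t ^ 2 * om N s ≤ DR N vr R t := by
      apply intervalIntegral.integral_mono_interval hr.le hR le_rfl _ (D.ii_of hR0.le hcd)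
      rw [EventuallyLE, ae_restrict_iff' measurableSet_Ioc]
      filter_upwards with s hs
      exact mul_nonneg (sq_nonneg _) (om_nonneg N hs.1.le)
    have h2 := h1.trans (h t ht R hR0.le)
    have h3 : 0 ≤ ∫ s in r..R, (om N s)⁻¹ := intervalIntegral.integral_nonneg hR
      (fun s hs => inv_nonneg.mpr (om_nonneg N (hsub hs)))
    have h4 := mul_le_mul h2 hg' h3 (by positivity)
    rw [hftc] at hcs
    have h5 := hcs.trans h4
    rw [← hB2] at h5
    have h6 := (abs_le_of_sq_le_sq' h5 hB0).1
    have h7 := D.bv R hR0.le t (Ioo_subset_Icc_self ht')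
    linarith
  · intro s hs l
    have ho := om_pos N (hr.trans_le hs.1)
    have e : vr s t ^ 2 * om N s * (l * l) + 2 * vr s t * l + (om N s)⁻¹
      = (vr s t * om N s * l + 1) ^ 2 * (om N s)⁻¹ := by field_simp; ring
    rw [e]
    positivity

lemma pt_bounds : ∃ K > 0,
    (∀ t ∈ Ico (3 * T / 4) T, ∀ r, 1 ≤ r →
      u r t ^ m ≤ K * (T - t) ^ (m / (1 - m)) * Real.exp (-(((N:ℝ) - 1) / 2 * r))) ∧
    (∀ t ∈ Ico (3 * T / 4) T, ∀ r, 0 < r → r ≤ 1 →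
      u r t ^ m ≤ (T - t) ^ (m / (1 - m)) *
        (K * Real.sqrt (4 ^ (N - 1) + (r ^ (N - 2))⁻¹ * Real.log (1 / r)))) := by
  obtain ⟨K, hK, h⟩ := D.ptwise
  have hN := D.H.hN
  have h2N : (1:ℝ) ≤ 2 ^ (N - 1) := one_le_pow₀ (by norm_num)
  refine ⟨K * 2 ^ (N - 1), by positivity, ?_, ?_⟩
  · intro t ht r hr
    have := h t ht r (by linarith) (4 ^ (N - 1) * Real.exp (-(((N:ℝ) - 1) * r))) (by positivity) (by
      filter_upwards [eventually_ge_atTop r] with R hR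
      exact G_tail hN hr hR)
    refine this.trans (le_of_eq ?_)
    have e : 4 ^ (N - 1) * Real.exp (-(((N:ℝ) - 1) * r)) = (2 ^ (N - 1) * Real.exp (-(((N:ℝ) - 1) / 2 * r))) ^ 2 := by
      have e1 : (4:ℝ) ^ (N - 1) = (2 ^ (N - 1)) ^ 2 := by
        rw [← pow_mul, mul_comm, pow_mul]; norm_num
      have e2 : Real.exp (-(((N:ℝ) - 1) * r)) = Real.exp (-(((N:ℝ) - 1) / 2 * r)) ^ 2 := by
        rw [sq, ← Real.exp_add]; congr 1; ring
      rw [mul_pow, e1, e2]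
    rw [e, Real.sqrt_sq (by positivity)]; ring
  · intro t ht r hr hr1
    have hl : 0 ≤ Real.log (1 / r) := Real.log_nonneg (by rw [le_div_iff₀ hr]; linarith)
    have := h t ht r hr (4 ^ (N - 1) + (r ^ (N - 2))⁻¹ * Real.log (1 / r)) (by positivity) (by
      filter_upwards [eventually_ge_atTop 1] with R hR
      exact G_near hN hr hr1 hR)
    refine this.trans ?_
    have hTt : 0 < T - t := by linarith [ht.2]
    have h0 : 0 ≤ K * (T - t) ^ (m / (1 - m)) * Real.sqrt (4 ^ (N - 1) + (r ^ (N - 2))⁻¹ * Real.log (1 / r)) := by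
      positivity
    have := le_mul_of_one_le_right h0 h2N
    linarith

end Dec

lemma barrier (H : Reg N m T u ut vr vrr) {t0 δ B : ℝ} (ht0 : 0 ≤ t0) (htT : t0 < T)
    (hδ : 0 < δ) (hδ1 : δ < 1) (hB : ∀ r, 0 ≤ r → ∀ t ∈ Icc 0 T, u r t ^ m ≤ B)
    (Φ Φ1 Φ2 : ℝ → ℝ) (hΦ1 : ∀ z, 0 < z → HasDerivAt Φ (Φ1 z) z)
    (hΦ2 : ∀ z, 0 < z → HasDerivAt Φ1 (Φ2 z) z) (hneg : ∀ z, 0 < z → Φ1 z ≤ 0)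
    (hanti : ∀ z1 z2, 0 < z1 → z1 ≤ z2 → Φ z2 ≤ Φ z1)
    (hpos : ∀ z, 0 < z → z ≤ 2 * δ ^ 2 → 0 < Φ z)
    (hinf : Tendsto Φ (𝓝[>] 0) atTop)
    (hsup : ∀ r z, 0 < r → r < δ → r ^ 2 < z → z < 2 * δ ^ 2 →
      (Φ z + 1) ^ (1 / m) / (1 - m) < -(4 * r ^ 2 * Φ2 z) - 2 * N * Φ1 z + ((N:ℝ) - 1) / r)
    (hb : ∀ t ∈ Ico t0 T, ∀ r, 0 < r → r ≤ δ → u r t ^ m ≤ (T - t) ^ (m / (1 - m)) * Φ (2 * r ^ 2)) :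
    ∃ K > 0, ∀ t ∈ Ico t0 T, ∀ r, 0 ≤ r → r ≤ δ → u r t ^ m ≤ (T - t) ^ (m / (1 - m)) * K := by
  have hm0 := H.hm0
  have hm1 := H.hm1
  have hN2 : (2:ℝ) ≤ N := by exact_mod_cast H.hN
  set q := m / (1 - m) with hq
  have hq0 : 0 < q := div_pos hm0 (by linarith)
  have hTt0 : 0 < (T - t0) ^ q := Real.rpow_pos_of_pos (by linarith) _
  obtain ⟨ε, hε0, hεδ, hεB⟩ : ∃ ε, 0 < ε ∧ ε < δ ∧ B / (T - t0) ^ q < Φ (2 * ε ^ 2) := by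
    have h1 : Tendsto (fun ε : ℝ => 2 * ε ^ 2) (𝓝[>] 0) (𝓝[>] 0) := by
      refine tendsto_nhdsWithin_iff.mpr ⟨?_, ?_⟩
      · have : Tendsto (fun ε : ℝ => 2 * ε ^ 2) (𝓝 0) (𝓝 (2 * 0 ^ 2)) := by
          apply Continuous.tendsto; fun_prop
        simp only [ne_eq, OfNat.ofNat_ne_zero, not_false_eq_true, zero_pow, mul_zero] at this
        exact this.mono_left nhdsWithin_le_nhds
      · filter_upwards [self_mem_nhdsWithin] with x hx
        have : (0:ℝ) < x := hx
        exact mem_Ioi.mpr (by positivity)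
    obtain ⟨ε, h2, h3⟩ := (((hinf.comp h1).eventually_gt_atTop (B / (T - t0) ^ q)).and
      (Ioo_mem_nhdsGT hδ)).exists
    exact ⟨ε, h3.1, h3.2, h2⟩
  set V : ℝ → ℝ := fun r => Φ (r ^ 2 + ε ^ 2) + (1 - r) with hV
  have zpos : ∀ r, 0 < r ^ 2 + ε ^ 2 := fun r => by positivity
  have zle : ∀ r, 0 ≤ r → r ≤ δ → r ^ 2 + ε ^ 2 < 2 * δ ^ 2 := fun r h1 h2 => by nlinarith
  have hVpos : ∀ r, 0 ≤ r → r ≤ δ → 0 < V r := fun r h1 h2 => by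
    have := hpos _ (zpos r) (zle r h1 h2).le
    simp only [hV]; linarith
  set W : ℝ → ℝ → ℝ := fun r t => (T - t) ^ q * V r with hW
  set S : ℝ → ℝ → ℝ := fun r t => (T - t) ^ (1 / (1 - m)) * V r ^ (1 / m) with hS
  have h1m : 1 - m ≠ 0 := by linarith
  have hSW : ∀ r ∈ Icc 0 δ, ∀ t, t < T → W r t = S r t ^ m := by
    intro r hr t ht
    have h1 := hVpos r hr.1 hr.2
    have h2 : 0 < T - t := by linarith
    simp only [hS, hW]
    rw [Real.mul_rpow (by positivity) (by positivity), ← Real.rpow_mul h2.le, ← Real.rpow_mul h1.le,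
      one_div_mul_cancel hm0.ne', Real.rpow_one, hq]
    congr 2; ring
  have hlt : ∀ r ∈ Icc 0 δ, ∀ t ∈ Ico t0 T, u r t ^ m < W r t → u r t < S r t := by
    intro r hr t ht h
    have h1 := hVpos r hr.1 hr.2
    have h2 : 0 < T - t := by linarith [ht.2]
    rw [hSW r hr t ht.2] at h
    exact (Real.rpow_lt_rpow_iff (H.nn r hr.1 t ⟨ht0.trans ht.1, ht.2.le⟩) (by positivity) hm0).mp h
  have hzd : ∀ r, HasDerivAt (fun r : ℝ => r ^ 2 + ε ^ 2) (2 * r) r := fun r => by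
    have := (hasDerivAt_pow 2 r).add_const (ε ^ 2)
    simpa using this
  have hVd : ∀ r, HasDerivAt V (Φ1 (r ^ 2 + ε ^ 2) * (2 * r) + -1) r := fun r =>
    ((hΦ1 _ (zpos r)).comp r (hzd r)).add ((hasDerivAt_id r).const_sub 1)
  have hVdd : ∀ r, HasDerivAt (fun r => Φ1 (r ^ 2 + ε ^ 2) * (2 * r) + -1)
      (4 * r ^ 2 * Φ2 (r ^ 2 + ε ^ 2) + 2 * Φ1 (r ^ 2 + ε ^ 2)) r := fun r => by
    have h := ((((hΦ2 _ (zpos r)).comp r (hzd r)).mul ((hasDerivAt_id r).const_mul 2)).add_const (-1))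
    refine h.congr_deriv ?_
    simp only [Function.comp, id]
    ring
  have hbig : ∀ t ∈ Ico t0 T, ∀ r, ε ≤ r → r ≤ δ → u r t ^ m < W r t := by
    intro t ht r h1 h2
    have hr0 : 0 < r := hε0.trans_le h1
    refine lt_of_le_of_lt (hb t ht r hr0 h2) ?_
    apply mul_lt_mul_of_pos_left _ (Real.rpow_pos_of_pos (by linarith [ht.2]) _)
    have := hanti (r ^ 2 + ε ^ 2) (2 * r ^ 2) (zpos r) (by nlinarith)
    simp only [hV]; linarith
  refine ⟨Φ (ε ^ 2) + 1, ?_, ?_⟩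
  · have := hpos (ε ^ 2) (by positivity) (by nlinarith)
    linarith
  intro t1 ht1 r1 hr1 hr1δ
  have main := compare H (R := δ) (t0 := t0) (t1 := t1) ht0 ht1.2 S W
    (fun r t => (T - t) ^ q * (Φ1 (r ^ 2 + ε ^ 2) * (2 * r) + -1))
    (fun r t => (T - t) ^ q * (4 * r ^ 2 * Φ2 (r ^ 2 + ε ^ 2) + 2 * Φ1 (r ^ 2 + ε ^ 2)))
    (fun r t => -((T - t) ^ q * (V r ^ (1 / m) / (1 - m))))
    ?_ ?_ ?_ ?_ ?_ ?_ ?_ ?_ ?_ r1 ⟨hr1, hr1δ⟩ t1 ⟨ht1.1, le_rfl⟩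
  · have h1 := Real.rpow_le_rpow (H.nn r1 hr1 t1 ⟨ht0.trans ht1.1, ht1.2.le⟩) main.le hm0.le
    rw [← hSW r1 ⟨hr1, hr1δ⟩ t1 ht1.2] at h1
    refine h1.trans ?_
    apply mul_le_mul_of_nonneg_left _ (Real.rpow_nonneg (by linarith [ht1.2]) _)
    have := hanti (ε ^ 2) (r1 ^ 2 + ε ^ 2) (by positivity) (by nlinarith)
    simp only [hV]; linarith
  · have hVc : ContinuousOn V (Icc 0 δ) := fun r _ => (hVd r).continuousAt.continuousWithinAt
    apply ContinuousOn.mul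
    · exact ContinuousOn.rpow_const (by fun_prop) (fun p hp => Or.inl (by linarith [hp.2.2, ht1.2]))
    · exact (hVc.comp continuousOn_fst (fun p hp => hp.1)).rpow_const
        (fun p hp => Or.inl (hVpos _ hp.1.1 hp.1.2).ne')
  · intro r hr t ht; exact hSW r hr t (ht.2.trans_lt ht1.2)
  · intro r hr
    apply hlt r hr t0 ⟨le_rfl, htT⟩
    rcases le_or_gt ε r with h | h
    · exact hbig t0 ⟨le_rfl, htT⟩ r h hr.2
    · refine lt_of_le_of_lt (hB r hr.1 t0 ⟨ht0, htT.le⟩) ?_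
      rw [div_lt_iff₀ hTt0] at hεB
      refine hεB.trans ?_
      rw [mul_comm]
      apply mul_lt_mul_of_pos_left _ hTt0
      have := hanti (r ^ 2 + ε ^ 2) (2 * ε ^ 2) (zpos r) (by nlinarith [hr.1])
      simp only [hV]; linarith [hr.2]
  · intro t ht
    have ht' : t ∈ Ico t0 T := ⟨ht.1, ht.2.trans_lt ht1.2⟩
    exact hlt δ ⟨hδ.le, le_rfl⟩ t ht' (hbig t ht' δ hεδ.le le_rfl)
  · intro r hr t ht
    have h2 : 0 < T - t := by linarith [ht.2, ht1.2]
    have h1 : HasDerivAt (fun t : ℝ => T - t) (-1) t := (hasDerivAt_id t).const_sub T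
    have h3 := ((h1.rpow_const (p := 1 / (1 - m)) (Or.inl h2.ne')).mul_const (V r ^ (1 / m)))
    refine h3.congr_deriv ?_
    have e : 1 / (1 - m) - 1 = q := by rw [hq]; field_simp; ring
    rw [e]; ring
  · intro r hr t ht
    exact (hVd r).const_mul _
  · intro r hr t ht
    exact (hVdd r).const_mul _
  · intro r hr t ht
    have h2 : 0 < T - t := by linarith [ht.2, ht1.2]
    have hp : 0 < (T - t) ^ q := Real.rpow_pos_of_pos h2 _
    have hs := hsup r (r ^ 2 + ε ^ 2) hr.1 hr.2 (by nlinarith) (zle r hr.1.le hr.2.le)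
    have hV0 := hVpos r hr.1.le hr.2.le
    have hVle : V r ^ (1 / m) ≤ (Φ (r ^ 2 + ε ^ 2) + 1) ^ (1 / m) := by
      apply Real.rpow_le_rpow hV0.le _ (by positivity)
      simp only [hV]; linarith [hr.1]
    have hVle2 : V r ^ (1 / m) / (1 - m) ≤ (Φ (r ^ 2 + ε ^ 2) + 1) ^ (1 / m) / (1 - m) :=
      div_le_div_of_nonneg_right hVle (by linarith)
    set z := r ^ 2 + ε ^ 2 with hz
    have hc := coth_ge_inv hr.1
    have hn := hneg z (zpos r)
    set ct := Real.cosh r / Real.sinh r with hct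
    have k1 : ((N:ℝ) - 1) / r ≤ ((N:ℝ) - 1) * ct := by
      have := mul_le_mul_of_nonneg_left hc (by linarith : 0 ≤ (N:ℝ) - 1)
      rw [mul_one_div] at this; exact this
    have k2 : 1 ≤ r * ct := by
      rw [div_le_iff₀ hr.1] at hc; linarith
    have k3 : ((N:ℝ) - 1) * ct * (Φ1 z * (2 * r)) ≤ ((N:ℝ) - 1) * (2 * Φ1 z) := by
      have : 0 ≤ ((N:ℝ) - 1) * (-Φ1 z) * (r * ct - 1) := by
        apply mul_nonneg (mul_nonneg _ _) <;> linarith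
      nlinarith
    have k4 : 4 * r ^ 2 * Φ2 z + 2 * Φ1 z + ((N:ℝ) - 1) * ct * (Φ1 z * (2 * r) + -1)
        < -(V r ^ (1 / m) / (1 - m)) := by
      have : ((N:ℝ) - 1) * ct * (Φ1 z * (2 * r) + -1) =
        ((N:ℝ) - 1) * ct * (Φ1 z * (2 * r)) - ((N:ℝ) - 1) * ct := by ring
      rw [this]
      linarith
    have k5 := mul_lt_mul_of_pos_left k4 hp
    linarith
  · intro t ht
    have hp : 0 < (T - t) ^ q := Real.rpow_pos_of_pos (by linarith [ht.2, ht1.2]) _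
    refine ⟨-(T - t) ^ q, by linarith, ?_⟩
    have := ((hVd 0).const_mul ((T - t) ^ q)).hasDerivWithinAt (s := Ici 0)
    refine this.congr_deriv ?_
    ring
end


lemma choose_delta {P Q : ℝ → Prop} (hP : ∀ᶠ z in 𝓝[>] (0:ℝ), P z) (hQ : ∀ᶠ z in 𝓝[>] (0:ℝ), Q z) :
    ∃ δ, 0 < δ ∧ δ < 1 ∧ (∀ z, 0 < z → z ≤ 2 * δ ^ 2 → P z) ∧ (∀ z, 0 < z → z ≤ δ → Q z) := by
  obtain ⟨c, hc, h⟩ := mem_nhdsGT_iff_exists_Ioo_subset.mp (hP.and hQ)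
  have hc0 : (0:ℝ) < c := hc
  have h1 := min_le_left c 1
  have h2 := min_le_right c 1
  have h3 : 0 < min c 1 := lt_min hc0 one_pos
  refine ⟨min c 1 / 2, by linarith, by linarith, ?_, ?_⟩
  · intro z hz hz2
    exact (h ⟨hz, by nlinarith⟩).1
  · intro z hz hz2
    exact (h ⟨hz, by linarith⟩).2

section
variable {N : ℕ} {m T : ℝ} {u ut vr vrr : ℝ → ℝ → ℝ} {M C β : ℝ}

lemma P_case2 {m : ℝ} : ∀ᶠ z in 𝓝[>] (0:ℝ), 0 < -(Real.log z) / 2 ∧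
    (-(Real.log z) / 2 + 1) ^ (1 / m) / (1 - m) < Real.exp (-(Real.log z) / 2) := by
  have h1 : Tendsto (fun z : ℝ => -(Real.log z) / 2) (𝓝[>] 0) atTop :=
    (tendsto_neg_atBot_atTop.comp Real.tendsto_log_nhdsGT_zero).atTop_div_const (by norm_num)
  have h2 : ∀ᶠ x : ℝ in atTop, (x + 1) ^ (1 / m) / (1 - m) < Real.exp x := by
    have h3 := (tendsto_exp_div_rpow_atTop (1 / m)).comp (tendsto_atTop_add_const_right atTop (1:ℝ) tendsto_id)
    filter_upwards [h3.eventually_gt_atTop (Real.exp 1 * (1 / (1 - m))), eventually_gt_atTop 0] with x hx hx0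
    simp only [Function.comp, id] at hx
    have hp : 0 < (x + 1) ^ (1 / m) := by positivity
    rw [lt_div_iff₀ hp, Real.exp_add] at hx
    have he := Real.exp_pos 1
    have : Real.exp 1 * ((x + 1) ^ (1 / m) / (1 - m)) < Real.exp 1 * Real.exp x := by
      calc _ = Real.exp 1 * (1 / (1 - m)) * (x + 1) ^ (1 / m) := by ring
        _ < _ := hx
        _ = _ := by ring
    exact lt_of_mul_lt_mul_left this he.le
  exact (h1.eventually_gt_atTop 0).and (h1.eventually h2)

lemma Q_case2 {K : ℝ} (hK : 0 < K) : ∀ᶠ r in 𝓝[>] (0:ℝ),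
    K * Real.sqrt (4 + Real.log (1 / r)) ≤ -(Real.log (2 * r ^ 2)) / 2 := by
  have h1 : Tendsto (fun z : ℝ => -(Real.log z)) (𝓝[>] 0) atTop :=
    (tendsto_neg_atBot_atTop.comp Real.tendsto_log_nhdsGT_zero)
  filter_upwards [h1.eventually_ge_atTop 4, h1.eventually_ge_atTop (9 * K ^ 2), self_mem_nhdsWithin] with r h4 h9 hr
  have hr0 : (0:ℝ) < r := hr
  rw [Real.log_mul (by norm_num) (by positivity), Real.log_pow, one_div, Real.log_inv]
  set l := -Real.log r with hl
  have hl2 : Real.log r = -l := by rw [hl]; ring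
  have h2 := Real.log_two_lt_d9
  rw [hl2]
  push_cast
  have : Real.sqrt (4 + l) * K ≤ (l + 4) / 3 := by
    have a : (Real.sqrt (4 + l) * K) ^ 2 ≤ ((l + 4) / 3) ^ 2 := by
      rw [mul_pow, Real.sq_sqrt (by linarith)]
      nlinarith
    exact (abs_le_of_sq_le_sq' a (by linarith)).2
  nlinarith

lemma gamma_exists (hN : 3 ≤ N) (hm : m ∈ Set.Ioo (((N : ℝ) - 2) / ((N : ℝ) + 2)) 1) :
    ∃ γ : ℝ, 0 < γ ∧ ((N:ℝ) - 2) / 2 < γ ∧ γ < (N:ℝ) - 2 ∧ γ < 2 * m / (1 - m) := by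
  have hN2 : (3:ℝ) ≤ N := by exact_mod_cast hN
  have h1m : 0 < 1 - m := by linarith [hm.2]
  have h1 := hm.1
  rw [div_lt_iff₀ (by linarith)] at h1
  have h2 : ((N:ℝ) - 2) / 2 < 2 * m / (1 - m) := by
    rw [div_lt_div_iff₀ (by norm_num) h1m]; nlinarith
  obtain ⟨γ, ha, hb⟩ := exists_between (lt_min (by linarith : ((N:ℝ) - 2) / 2 < (N:ℝ) - 2) h2)
  exact ⟨γ, by linarith, ha, hb.trans_le (min_le_left _ _), hb.trans_le (min_le_right _ _)⟩

lemma P_case3 {γ : ℝ} (hm0 : 0 < m) (hm1 : m < 1) (hγ : 0 < γ) (h1 : γ < (N:ℝ) - 2) (h2 : γ < 2 * m / (1 - m)) :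
    ∀ᶠ z in 𝓝[>] (0:ℝ), 
    (z ^ (-γ / 2) + 1) ^ (1 / m) / (1 - m) < γ * ((N:ℝ) - 2 - γ) * z ^ (-γ / 2 - 1) := by
  have h1m : 0 < 1 - m := by linarith
  set e := 1 + γ / 2 - γ / (2 * m) with he
  have he0 : 0 < e := by
    rw [lt_div_iff₀ h1m] at h2
    have : γ / (2 * m) < 1 + γ / 2 := by
      rw [div_lt_iff₀ (by positivity)]; nlinarith
    rw [he]; linarith
  have hc : 0 < γ * ((N:ℝ) - 2 - γ) := mul_pos hγ (by linarith)
  have ht : Tendsto (fun z : ℝ => γ * ((N:ℝ) - 2 - γ) * z ^ (-e)) (𝓝[>] 0) atTop :=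
    (tendsto_rpow_neg_nhdsGT_zero (by linarith)).const_mul_atTop hc
  filter_upwards [ht.eventually_gt_atTop (2 ^ (1 / m) / (1 - m)), Ioo_mem_nhdsGT (one_pos)] with z hz hz1
  have hz0 : 0 < z := hz1.1
  have a1 : 1 ≤ z ^ (-γ / 2) := Real.one_le_rpow_of_pos_of_le_one_of_nonpos hz0 hz1.2.le (by linarith)
  have a2 : (z ^ (-γ / 2) + 1) ^ (1 / m) ≤ (2 * z ^ (-γ / 2)) ^ (1 / m) :=
    Real.rpow_le_rpow (by positivity) (by linarith) (by positivity)
  rw [Real.mul_rpow (by norm_num) (by positivity), ← Real.rpow_mul hz0.le] at a2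
  have a3 : z ^ (-γ / 2 - 1) = z ^ (-e) * z ^ (-γ / 2 * (1 / m)) := by
    rw [← Real.rpow_add hz0]; congr 1; rw [he]; field_simp; ring
  rw [a3]
  have a4 : 0 < z ^ (-γ / 2 * (1 / m)) := by positivity
  have a5 := mul_lt_mul_of_pos_right hz a4
  calc _ ≤ 2 ^ (1 / m) * z ^ (-γ / 2 * (1 / m)) / (1 - m) := div_le_div_of_nonneg_right a2 h1m.le
    _ = 2 ^ (1 / m) / (1 - m) * z ^ (-γ / 2 * (1 / m)) := by ring
    _ < _ := a5
    _ = _ := by ring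

lemma Q_case3 {γ K : ℝ} (hN : 3 ≤ N) (hK : 0 ≤ K) (hγ : 0 < γ) (h1 : ((N:ℝ) - 2) / 2 < γ) :
    ∀ᶠ r in 𝓝[>] (0:ℝ), 
    K * Real.sqrt (4 ^ (N - 1) + (r ^ (N - 2))⁻¹ * Real.log (1 / r)) ≤ (2 * r ^ 2) ^ (-γ / 2) := by
  have hcast : ((N - 2 : ℕ) : ℝ) = (N:ℝ) - 2 := by
    rw [Nat.cast_sub (by omega)]; norm_num
  have t1 : Tendsto (fun r : ℝ => r ^ (2 * γ)) (𝓝[>] 0) (𝓝 0) := by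
    have : Tendsto (fun r : ℝ => r ^ (2 * γ)) (𝓝 0) (𝓝 (0 ^ (2 * γ))) :=
      (Real.continuous_rpow_const (by positivity)).tendsto 0
    rw [Real.zero_rpow (by positivity)] at this
    exact this.mono_left nhdsWithin_le_nhds
  have t2 := tendsto_log_mul_rpow_nhdsGT_zero (r := 2 * γ - ((N:ℝ) - 2)) (by linarith)
  have t3 : Tendsto (fun r : ℝ => K ^ 2 * (4 ^ (N - 1) * r ^ (2 * γ) - Real.log r * r ^ (2 * γ - ((N:ℝ) - 2))))
      (𝓝[>] 0) (𝓝 0) := by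
    have := ((t1.const_mul (4 ^ (N - 1))).sub t2).const_mul (K ^ 2)
    simpa using this
  have hp : (0:ℝ) < 2 ^ (-γ) := by positivity
  filter_upwards [t3.eventually_lt_const hp, Ioo_mem_nhdsGT (one_pos)] with r hr hr1
  have hr0 : 0 < r := hr1.1
  have hl : 0 ≤ Real.log (1 / r) := Real.log_nonneg (by rw [le_div_iff₀ hr0]; linarith [hr1.2])
  have a : (K * Real.sqrt (4 ^ (N - 1) + (r ^ (N - 2))⁻¹ * Real.log (1 / r))) ^ 2 ≤ ((2 * r ^ 2) ^ (-γ / 2)) ^ 2 := by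
    rw [mul_pow, Real.sq_sqrt (by positivity)]
    have e1 : ((2 * r ^ 2) ^ (-γ / 2)) ^ 2 = 2 ^ (-γ) * r ^ (-(2 * γ)) := by
      rw [← Real.rpow_natCast ((2 * r ^ 2) ^ (-γ / 2)), ← Real.rpow_mul (by positivity),
        Real.mul_rpow (by norm_num) (by positivity), ← Real.rpow_natCast r 2, ← Real.rpow_mul hr0.le]
      congr 2 <;> (push_cast; ring)
    have e2 : (r ^ (N - 2))⁻¹ = r ^ (-((N:ℝ) - 2)) := by
      rw [Real.rpow_neg hr0.le, ← hcast, Real.rpow_natCast]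
    have e3 : r ^ (-((N:ℝ) - 2)) = r ^ (2 * γ - ((N:ℝ) - 2)) * r ^ (-(2 * γ)) := by
      rw [← Real.rpow_add hr0]; congr 1; ring
    have e4 : r ^ (2 * γ) * r ^ (-(2 * γ)) = 1 := by
      rw [← Real.rpow_add hr0]; simp
    have e5 : 0 < r ^ (-(2 * γ)) := by positivity
    have e6 := mul_lt_mul_of_pos_right hr e5
    rw [e1, e2, e3, one_div, Real.log_inv]
    refine le_trans (le_of_eq ?_) e6.le
    linear_combination (-(K ^ 2 * 4 ^ (N - 1))) * e4
  exact (abs_le_of_sq_le_sq' a (by positivity)).2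

lemma near_origin (D : Dec N m T u ut vr vrr M C β)
    (hm : m ∈ Set.Ioo (((N : ℝ) - 2) / ((N : ℝ) + 2)) 1) :
    ∃ δ > 0, ∃ K > 0, ∀ t ∈ Ico (3 * T / 4) T, ∀ r, 0 ≤ r → r ≤ δ →
      u r t ^ m ≤ (T - t) ^ (m / (1 - m)) * K := by
  have hm0 := D.H.hm0
  have hm1 := D.H.hm1
  have hT := D.H.hT
  obtain ⟨K, hK, _, hb⟩ := D.pt_bounds
  have hB : ∀ r, 0 ≤ r → ∀ t ∈ Icc 0 T, u r t ^ m ≤ C := by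
    intro r hr t ht
    refine (D.bv r hr t ht).trans ?_
    have : Real.exp (-(β * r)) ≤ 1 := by
      rw [Real.exp_le_one_iff]; have := D.hβ; nlinarith
    have := D.hC
    nlinarith
  rcases eq_or_lt_of_le D.H.hN with h2 | h3
  · subst h2
    obtain ⟨δ, hδ, hδ1, hP, hQ⟩ := choose_delta (P_case2 (m := m)) (Q_case2 hK)
    refine ⟨δ, hδ, barrier D.H (t0 := 3 * T / 4) (B := C) (by linarith) (by linarith) hδ hδ1 hB
      (fun z => -(Real.log z) / 2) (fun z => -(1 / (2 * z))) (fun z => 1 / (2 * z ^ 2)) ?_ ?_ ?_ ?_ ?_ ?_ ?_ ?_⟩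
    · intro z hz
      refine ((Real.hasDerivAt_log hz.ne').neg.div_const 2).congr_deriv ?_
      field_simp
    · intro z hz
      have h := ((hasDerivAt_inv hz.ne').const_mul (-(1/2):ℝ))
      refine (h.congr_deriv ?_).congr_of_eventuallyEq ?_
      · field_simp
      · filter_upwards with x
        rw [one_div, mul_inv]; ring
    · intro z hz
      have : 0 < 1 / (2 * z) := by positivity
      linarith
    · intro z1 z2 h1 h2
      have := Real.log_le_log h1 h2
      linarith
    · intro z h1 h2; exact (hP z h1 h2).1
    · exact (tendsto_neg_atBot_atTop.comp Real.tendsto_log_nhdsGT_zero).atTop_div_const (by norm_num)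
    · intro r z hr hrδ hrz hz
      have hz0 : 0 < z := lt_of_le_of_lt (sq_nonneg r) hrz
      refine (hP z hz0 hz.le).2.trans_le ?_
      have a1 : Real.exp (-(Real.log z) / 2) ≤ 1 / r := by
        rw [← Real.exp_log (by positivity : 0 < 1 / r), Real.exp_le_exp, one_div, Real.log_inv]
        have := Real.log_le_log (by positivity) hrz.le
        rw [Real.log_pow] at this
        push_cast at this
        linarith
      have a2 : -(4 * r ^ 2 * (1 / (2 * z ^ 2))) - 2 * ((2:ℕ):ℝ) * -(1 / (2 * z)) = 2 * (z - r ^ 2) / z ^ 2 := by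
        push_cast; field_simp; ring
      have a3 : 0 ≤ 2 * (z - r ^ 2) / z ^ 2 := by
        apply div_nonneg <;> nlinarith
      rw [a2]
      have a4 : (((2:ℕ):ℝ) - 1) / r = 1 / r := by norm_num
      rw [a4]; linarith
    · intro t ht r hr hrδ
      refine (hb t ht r hr (by linarith)).trans ?_
      apply mul_le_mul_of_nonneg_left _ (Real.rpow_nonneg (by linarith [ht.2]) _)
      have := hQ r hr hrδ
      simpa using this
  · have h3' : 3 ≤ N := h3
    obtain ⟨γ, hγ, g1, g2, g3⟩ := gamma_exists h3' hm
    obtain ⟨δ, hδ, hδ1, hP, hQ⟩ := choose_delta (P_case3 hm0 hm1 hγ g2 g3) (Q_case3 h3' hK.le hγ g1)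
    have hN3 : (3:ℝ) ≤ N := by exact_mod_cast h3'
    refine ⟨δ, hδ, barrier D.H (t0 := 3 * T / 4) (B := C) (by linarith) (by linarith) hδ hδ1 hB
      (fun z => z ^ (-γ / 2)) (fun z => -γ / 2 * z ^ (-γ / 2 - 1))
      (fun z => -γ / 2 * ((-γ / 2 - 1) * z ^ (-γ / 2 - 1 - 1))) ?_ ?_ ?_ ?_ ?_ ?_ ?_ ?_⟩
    · intro z hz
      exact Real.hasDerivAt_rpow_const (Or.inl hz.ne')
    · intro z hz
      exact (Real.hasDerivAt_rpow_const (Or.inl hz.ne')).const_mul _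
    · intro z hz
      have : 0 < z ^ (-γ / 2 - 1) := by positivity
      nlinarith
    · intro z1 z2 h1 h2
      exact Real.rpow_le_rpow_of_nonpos h1 h2 (by linarith)
    · intro z h1 h2; positivity
    · have := tendsto_rpow_neg_nhdsGT_zero (y := -γ / 2) (by linarith)
      exact this
    · intro r z hr hrδ hrz hz
      have hz0 : 0 < z := lt_of_le_of_lt (sq_nonneg r) hrz
      refine (hP z hz0 hz.le).trans_le ?_
      have a1 : 0 ≤ ((N:ℝ) - 1) / r := div_nonneg (by linarith) hr.le
      have a2 : z ^ (-γ / 2 - 1) = z ^ (-γ / 2 - 1 - 1) * z := by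
        rw [← Real.rpow_add_one hz0.ne']; congr 1; ring
      set y := z ^ (-γ / 2 - 1 - 1) with hy
      have hy0 : 0 < y := by positivity
      rw [a2]
      have a3 : 0 ≤ γ * (γ + 2) * y * (z - r ^ 2) := by
        apply mul_nonneg (by positivity); linarith
      have a4 : -(4 * r ^ 2 * (-γ / 2 * ((-γ / 2 - 1) * y))) - 2 * ↑N * (-γ / 2 * (y * z)) =
        γ * ((N:ℝ) - 2 - γ) * (y * z) + γ * (γ + 2) * y * (z - r ^ 2) := by ring
      linarith
    · intro t ht r hr hrδ
      refine (hb t ht r hr (by linarith)).trans ?_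
      apply mul_le_mul_of_nonneg_left _ (Real.rpow_nonneg (by linarith [ht.2]) _)
      exact hQ r hr hrδ
end


lemma late_bound {N : ℕ} {m T : ℝ} {u ut vr vrr : ℝ → ℝ → ℝ} {M C β : ℝ}
    (D : Dec N m T u ut vr vrr M C β)
    (hm : m ∈ Set.Ioo (((N : ℝ) - 2) / ((N : ℝ) + 2)) 1) :
    ∃ K > 0, ∀ t ∈ Ico (3 * T / 4) T, ∀ r, 0 ≤ r →
      u r t ^ m ≤ K * (T - t) ^ (m / (1 - m)) * Real.exp (-(((N:ℝ) - 1) / 2 * r)) := by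
  have hN2 : (2:ℝ) ≤ N := by exact_mod_cast D.H.hN
  obtain ⟨K1, hK1, hA, hB⟩ := D.pt_bounds
  obtain ⟨δ, hδ, K2, hK2, hO⟩ := near_origin D hm
  set κ := ((N:ℝ) - 1) / 2 with hκ
  have hκ0 : 0 < κ := by rw [hκ]; linarith
  set K3 := K1 * Real.sqrt (4 ^ (N - 1) + (δ ^ (N - 2))⁻¹ * Real.log (1 / δ)) with hK3
  have hK30 : 0 ≤ K3 := by positivity
  refine ⟨K1 + (K2 + K3) * Real.exp κ, by positivity, ?_⟩
  intro t ht r hr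
  have hTt : 0 < (T - t) ^ (m / (1 - m)) := Real.rpow_pos_of_pos (by linarith [ht.2]) _
  set p := (T - t) ^ (m / (1 - m)) with hp
  have hE := Real.exp_pos (-(κ * r))
  have small : r ≤ 1 → u r t ^ m ≤ p * (K2 + K3) →
      u r t ^ m ≤ (K1 + (K2 + K3) * Real.exp κ) * p * Real.exp (-(κ * r)) := by
    intro h1 h2
    have h3 : 1 ≤ Real.exp κ * Real.exp (-(κ * r)) := by
      rw [← Real.exp_add, Real.one_le_exp_iff]; nlinarith
    have h4 : 0 ≤ p * (K2 + K3) := by positivity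
    have h5 := le_mul_of_one_le_right h4 h3
    have h6 : 0 ≤ K1 * p * Real.exp (-(κ * r)) := by positivity
    calc _ ≤ p * (K2 + K3) * (Real.exp κ * Real.exp (-(κ * r))) := h2.trans h5
      _ ≤ p * (K2 + K3) * (Real.exp κ * Real.exp (-(κ * r))) + K1 * p * Real.exp (-(κ * r)) := by linarith
      _ = _ := by ring
  rcases le_or_gt 1 r with h1 | h1
  · refine (hA t ht r h1).trans ?_
    have : 0 ≤ (K2 + K3) * Real.exp κ * p * Real.exp (-(κ * r)) := by positivity
    calc _ ≤ K1 * p * Real.exp (-(κ * r)) + (K2 + K3) * Real.exp κ * p * Real.exp (-(κ * r)) := by linarith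
      _ = _ := by ring
  · rcases le_or_gt r δ with h2 | h2
    · apply small h1.le
      refine (hO t ht r hr h2).trans ?_
      apply mul_le_mul_of_nonneg_left _ hTt.le
      linarith
    · apply small h1.le
      have hr0 : 0 < r := hδ.trans h2
      refine (hB t ht r hr0 h1.le).trans ?_
      apply mul_le_mul_of_nonneg_left _ hTt.le
      have : K1 * Real.sqrt (4 ^ (N - 1) + (r ^ (N - 2))⁻¹ * Real.log (1 / r)) ≤ K3 := by
        rw [hK3]
        apply mul_le_mul_of_nonneg_left _ hK1.le
        apply Real.sqrt_le_sqrt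
        have hl : 0 ≤ Real.log (1 / r) := Real.log_nonneg (by rw [le_div_iff₀ hr0]; linarith)
        have a1 : Real.log (1 / r) ≤ Real.log (1 / δ) :=
          Real.log_le_log (by positivity) (one_div_le_one_div_of_le hδ h2.le)
        have a2 : (r ^ (N - 2))⁻¹ ≤ (δ ^ (N - 2))⁻¹ :=
          inv_anti₀ (by positivity) (pow_le_pow_left₀ hδ.le h2.le _)
        have := mul_le_mul a2 a1 hl (by positivity)
        linarith
      linarith

lemma all_bound {N : ℕ} (hN : 2 ≤ N) {m T : ℝ}
    (hm : m ∈ Set.Ioo (((N : ℝ) - 2) / ((N : ℝ) + 2)) 1) (hT : 0 < T)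
    {u : ℝ → ℝ → ℝ} (hu : IsRadialEnergySolution N m T u) :
    ∃ K > 0, ∀ t ∈ Ioo 0 T, ∀ r, 0 ≤ r →
      u r t ^ m ≤ K * (T - t) ^ (m / (1 - m)) * Real.exp (-(((N:ℝ) - 1) / 2 * r)) := by
  obtain ⟨ut, vr, vrr, H⟩ := reg_of_sol N hN m T hm hT u hu
  have hm0 := H.hm0
  have hm1 := H.hm1
  have hN2 : (2:ℝ) ≤ N := by exact_mod_cast hN
  obtain ⟨M0, hM0⟩ := hu.init_bdd
  obtain ⟨K0, hK0, hinit⟩ := init_decay hN hu.init_energy (M := M0 ^ m) (fun r hr =>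
    Real.rpow_le_rpow (H.nn r hr 0 ⟨le_rfl, hT.le⟩) (hM0 r hr) hm0.le)
  have hd := global_decay H (K := K0 + 1) (by linarith) (fun r hr => by
    refine lt_of_le_of_lt (hinit r hr) ?_
    exact mul_lt_mul_of_pos_right (by linarith) (Real.exp_pos _))
  obtain ⟨M, C, β, D⟩ := dec_of_decay H (by linarith) hd
  obtain ⟨K, hK, hl⟩ := late_bound D hm
  have hq0 : 0 < m / (1 - m) := div_pos hm0 (by linarith)
  set q := m / (1 - m) with hq
  have hT4 : 0 < (T / 4) ^ q := by positivity
  refine ⟨K + (K0 + 1) / (T / 4) ^ q, by positivity, ?_⟩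
  intro t ht r hr
  have hTt : 0 < T - t := by linarith [ht.2]
  have hp : 0 < (T - t) ^ q := by positivity
  have hE := Real.exp_pos (-(((N:ℝ) - 1) / 2 * r))
  rw [add_mul, add_mul]
  rcases le_or_gt (3 * T / 4) t with h | h
  · have := hl t ⟨h, ht.2⟩ r hr
    have h2 : 0 ≤ (K0 + 1) / (T / 4) ^ q * (T - t) ^ q * Real.exp (-(((N:ℝ) - 1) / 2 * r)) := by positivity
    linarith
  · have h1 := hd r hr t ⟨ht.1.le, ht.2.le⟩
    have h2 : (T / 4) ^ q ≤ (T - t) ^ q := Real.rpow_le_rpow (by positivity) (by linarith) hq0.le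
    have h3 : K0 + 1 ≤ (K0 + 1) / (T / 4) ^ q * (T - t) ^ q := by
      rw [div_mul_eq_mul_div, le_div_iff₀ hT4]
      exact mul_le_mul_of_nonneg_left h2 (by linarith)
    have h4 := mul_le_mul_of_nonneg_right h3 hE.le
    have h5 : 0 ≤ K * (T - t) ^ q * Real.exp (-(((N:ℝ) - 1) / 2 * r)) := by positivity
    linarith

lemma final_bound
    (N : ℕ) (hN : 2 ≤ N) (m T : ℝ)
    (hm : m ∈ Set.Ioo (((N : ℝ) - 2) / ((N : ℝ) + 2)) 1) (hT : 0 < T)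
    (u : ℝ → ℝ → ℝ) (hu : IsRadialEnergySolution N m T u) :
    ∃ C > (0:ℝ), ∀ r ∈ Set.Ici (0:ℝ), ∀ τ > (0:ℝ),
      rescaled m T u r τ ≤ C * Real.exp (-((N : ℝ) - 1) * r / (2 * m)) := by
  have hm0 := m_pos hN hm
  have hm1 := hm.2
  obtain ⟨ut, vr, vrr, H⟩ := reg_of_sol N hN m T hm hT u hu
  obtain ⟨K, hK, hb⟩ := all_bound hN hm hT hu
  refine ⟨K ^ (1 / m) * T ^ (1 / (1 - m)), by positivity, ?_⟩
  intro r hr τ hτ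
  have hr0 : 0 ≤ r := hr
  set t := T - T * Real.exp (-τ / T) with ht
  have hTt : T - t = T * Real.exp (-τ / T) := by rw [ht]; ring
  have hE := Real.exp_pos (-τ / T)
  have hE1 : Real.exp (-τ / T) < 1 := by
    rw [Real.exp_lt_one_iff, neg_div, neg_lt_zero]; positivity
  have htm : t ∈ Ioo 0 T := ⟨by rw [ht]; nlinarith, by rw [ht]; nlinarith⟩
  have hpos := H.pos r hr0 t htm
  have h1 := Real.rpow_le_rpow (by positivity) (hb t htm r hr0) (by positivity : 0 ≤ 1 / m)
  have h1m : 1 - m ≠ 0 := by linarith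
  rw [← Real.rpow_mul hpos.le, mul_one_div_cancel hm0.ne', Real.rpow_one, hTt,
    Real.mul_rpow (by positivity) (by positivity), Real.mul_rpow (by positivity) (by positivity),
    ← Real.rpow_mul (by positivity), show m / (1 - m) * (1 / m) = 1 / (1 - m) by field_simp,
    Real.mul_rpow hT.le hE.le, ← Real.exp_mul, ← Real.exp_mul] at h1
  have h2 := mul_le_mul_of_nonneg_left h1 (Real.exp_pos (τ / ((1 - m) * T))).le
  unfold rescaled
  refine le_trans (le_of_eq ?_) (h2.trans (le_of_eq ?_))
  · rw [ht]
  · have e1 : Real.exp (τ / ((1 - m) * T)) * Real.exp (-τ / T * (1 / (1 - m))) = 1 := by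
      rw [← Real.exp_add, Real.exp_eq_one_iff]; field_simp; ring
    have e2 : -(((N:ℝ) - 1) / 2 * r) * (1 / m) = -((N : ℝ) - 1) * r / (2 * m) := by
      field_simp
    rw [e2]
    linear_combination (K ^ (1 / m) * T ^ (1 / (1 - m)) * Real.exp (-((N : ℝ) - 1) * r / (2 * m))) * e1

/-- Uniform-in-time exponential decay of the rescaled solution. -/
theorem rescaled_uniform_decay
    (N : ℕ) (hN : 2 ≤ N) (m T : ℝ)
    (hm : m ∈ Set.Ioo (((N : ℝ) - 2) / ((N : ℝ) + 2)) 1) (hT : 0 < T)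
    (u : ℝ → ℝ → ℝ) (hu : IsRadialEnergySolution N m T u) :
    ∃ C > (0:ℝ), ∀ r ∈ Set.Ici (0:ℝ), ∀ τ > (0:ℝ),
      rescaled m T u r τ ≤ C * Real.exp (-((N : ℝ) - 1) * r / (2 * m)) :=
  final_bound N hN m T hm hT u hu
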